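/- For every ε > 0 there exists a constant C_ε > 0 such that for all real M, N ≥ 1 and all complex sequences (α_m) and (β_n) with |α_m| ≤ 1 and |β_n| ≤ 1 for all m, n, one has |Σ_{m ≤ M} Σ_{n ≤ N} α_m * β_n * μ^2(2m) * μ^2(2n) * (m/n)| ≤ C_ε * M * N * (M^(-1/2) + N^(-1/2)) * (M*N)^ε, where the sums range over positive integers m ≤ M and n ≤ N. -/

import Mathlib

/-- Divisor bound for squarefree integers. -/
theorem card_divisors_le_rpow_of_squarefree {η : ℝ} (hη : 0 < η) :
    ∃ C : ℝ, 1 ≤ C ∧ ∀ n : ℕ, Squarefree n → (n.divisors.card : ℝ) ≤ C * (n : ℝ) ^ η := by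
  obtain ⟨P, hP⟩ := exists_nat_gt ((2 : ℝ) ^ (1 / η))
  refine ⟨2 ^ P, one_le_pow₀ (by norm_num), fun n hn => ?_⟩
  have h1 : n.divisors.card = ∏ p ∈ n.primeFactors, 2 := by
    rw [Nat.card_divisors hn.ne_zero]
    refine Finset.prod_congr rfl fun p hp => ?_
    rw [Nat.factorization_eq_one_of_squarefree hn (Nat.prime_of_mem_primeFactors hp)
      (Nat.dvd_of_mem_primeFactors hp)]
  have h2 : (n : ℝ) ^ η = ∏ p ∈ n.primeFactors, (p : ℝ) ^ η := by
    rw [Real.finsetProd_rpow _ _ (fun _ _ => Nat.cast_nonneg _), ← Nat.cast_prod,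
      Nat.prod_primeFactors_of_squarefree hn]
  have h3 : ∏ p ∈ n.primeFactors, (2 : ℝ) ≤
      ∏ p ∈ n.primeFactors, ((if p < P then 2 else 1) * (p : ℝ) ^ η) := by
    refine Finset.prod_le_prod (fun _ _ => by norm_num) fun p hp => ?_
    have hp1 : (1 : ℝ) ≤ p := by exact_mod_cast (Nat.prime_of_mem_primeFactors hp).one_le
    split_ifs with h
    · have := Real.one_le_rpow hp1 hη.le
      linarith
    · have hPp : (2 : ℝ) ^ (1 / η) ≤ p := hP.le.trans (by exact_mod_cast not_lt.mp h)
      calc (2 : ℝ) = ((2 : ℝ) ^ (1 / η)) ^ η := by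
            rw [← Real.rpow_mul (by norm_num)]; field_simp; simp
        _ ≤ (p : ℝ) ^ η := Real.rpow_le_rpow (by positivity) hPp hη.le
        _ = _ := by ring
  rw [h1]
  push_cast
  refine h3.trans ?_
  rw [Finset.prod_mul_distrib, ← h2]
  gcongr
  rw [Finset.prod_ite]
  simp only [Finset.prod_const, one_pow, mul_one]
  refine pow_le_pow_right₀ (by norm_num) ?_
  calc _ ≤ (Finset.range P).card := Finset.card_le_card fun p hp => by simp_all
    _ = P := by simp

open Filter Topology in
/-- Theta series with a large parameter are dominated by their constant term. -/
theorem tendsto_tsum_exp_neg_sq {A : ℝ → ℂ} (hA : ∀ B, (A B).re = B) (r : ℝ) :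
    Tendsto (fun B => ∑' k : ℤ, Complex.exp (-Real.pi * A B * k ^ 2 +
      2 * Real.pi * (Complex.I * r) * k)) atTop (𝓝 1) := by
  have hn : ∀ B (k : ℤ), ‖Complex.exp (-Real.pi * A B * k ^ 2 +
      2 * Real.pi * (Complex.I * r) * k)‖ = Real.exp (-Real.pi * B * k ^ 2) := by
    intro B k
    rw [Complex.norm_exp]
    congr 1
    have h1 : (-Real.pi * A B * k ^ 2 + 2 * Real.pi * (Complex.I * r) * k : ℂ) =
      ((-Real.pi * k ^ 2 : ℝ) : ℂ) * A B + ((2 * Real.pi * r * k : ℝ) : ℂ) * Complex.I := by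
      push_cast; ring
    rw [h1, Complex.add_re, Complex.re_ofReal_mul, Complex.re_ofReal_mul, hA]
    simp; ring
  have hs : Summable fun k : ℤ => Real.exp (-Real.pi * 1 * (k : ℝ) ^ 2) := by
    have := (HurwitzZeta.hasSum_int_evenKernel 0 one_pos).summable
    simpa using this
  have key := tendsto_tsum_of_dominated_convergence (𝓕 := atTop) (g := fun k : ℤ =>
      if k = 0 then (1 : ℂ) else 0) (f := fun B (k : ℤ) => Complex.exp (-Real.pi * A B * k ^ 2 +
      2 * Real.pi * (Complex.I * r) * k)) hs ?_ ?_
  · simpa using key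
  · intro k
    by_cases hk : k = 0
    · simp [hk]
    · simp only [hk, if_false]
      rw [tendsto_zero_iff_norm_tendsto_zero]
      simp_rw [hn]
      have hk2 : (0 : ℝ) < Real.pi * (k : ℝ) ^ 2 := by positivity
      refine Real.tendsto_exp_atBot.comp ?_
      have := (tendsto_id (α := ℝ) (x := atTop)).const_mul_atTop hk2
      refine (tendsto_neg_atTop_atBot.comp this).congr fun B => ?_
      simp; ring
  · filter_upwards [eventually_ge_atTop 1] with B hB k
    rw [hn]
    refine Real.exp_le_exp.mpr ?_
    have : (0 : ℝ) ≤ Real.pi * (k : ℝ) ^ 2 := by positivity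
    nlinarith

theorem summable_cexp_neg_mul_int_sq {a : ℂ} (ha : 0 < a.re) (r : ℝ) :
    Summable fun k : ℤ => Complex.exp (-Real.pi * a * ((k : ℂ) + r) ^ 2) := by
  refine Summable.of_norm ?_
  have := (HurwitzZeta.hasSum_int_evenKernel r ha).summable
  convert this using 2 with k
  rw [Complex.norm_exp]
  have h1 : (-Real.pi * a * ((k : ℂ) + r) ^ 2 : ℂ) =
      ((-Real.pi * (k + r) ^ 2 : ℝ) : ℂ) * a := by
    push_cast; ring
  rw [h1, Complex.re_ofReal_mul]

/-- A sum over the integers split into residue classes. -/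
theorem tsum_int_eq_sum_range_tsum {q : ℕ} (hq : q ≠ 0) {f : ℤ → ℂ} (hf : Summable f) :
    ∑' n : ℤ, f n = ∑ r ∈ Finset.range q, ∑' k : ℤ, f (r + q * k) := by
  have : NeZero q := ⟨hq⟩
  have h := (Int.divModEquiv q).symm.tsum_eq f
  rw [← h, Finset.sum_range]
  have hs := ((Int.divModEquiv q).symm.summable_iff).mpr hf
  have := (hs.prod_symm).tsum_prod (f := fun p => f ((Int.divModEquiv q).symm p.swap))
  rw [← (Equiv.prodComm _ _).tsum_eq] 
  simp only [Equiv.prodComm_apply]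
  refine this.trans ?_
  rw [tsum_fintype]
  refine Finset.sum_congr rfl fun r _ => tsum_congr fun k => ?_
  congr 1
  simp [Int.divModEquiv]
  ring

theorem tsum_exp_shift {A : ℂ} (hA : 0 < A.re) (r : ℝ) :
    ∑' k : ℤ, Complex.exp (-Real.pi / A * ((k : ℂ) + r) ^ 2) = A ^ (1 / 2 : ℂ) *
      ∑' k : ℤ, Complex.exp (-Real.pi * A * k ^ 2 + 2 * Real.pi * (Complex.I * (-r : ℝ)) * k) := by
  rw [Complex.tsum_exp_neg_quadratic hA, ← mul_assoc, mul_one_div_cancel, one_mul]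
  · refine tsum_congr fun k => ?_
    congr 2
    push_cast
    linear_combination ((k + r + k - Complex.I * Complex.I * r) * r) * Complex.I_mul_I
  · rw [Ne, Complex.cpow_eq_zero_iff]
    rintro ⟨h, -⟩
    simp [h] at hA

theorem quadratic_sum_theta_identity {q : ℕ} (hq : q % 4 = 1) {B : ℝ} (hB : 0 < B) {A a : ℂ}
    (hA : A = B - Complex.I / (2 * q)) (ha : a * (1 / (4 * B) + Complex.I * q / 2) = 1) :
    A ^ (1 / 2 : ℂ) * ∑ r ∈ Finset.range q, Complex.exp (2 * Real.pi * Complex.I * (r ^ 2 / q)) *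
      ∑' k : ℤ, Complex.exp (-Real.pi * A * k ^ 2 +
        2 * Real.pi * (Complex.I * (-(r / q) : ℝ)) * k) =
    1 / a ^ (1 / 2 : ℂ) * ((B : ℂ) ^ (1 / 2 : ℂ) *
      ((∑' k : ℤ, Complex.exp (-Real.pi * B * k ^ 2 +
        2 * Real.pi * (Complex.I * (-0 : ℝ)) * k)) -
      Complex.I * ∑' k : ℤ, Complex.exp (-Real.pi * B * k ^ 2 +
        2 * Real.pi * (Complex.I * (-(1 / 2) : ℝ)) * k))) := by
  have hq0 : q ≠ 0 := by omega
  have hqC : (q : ℂ) ≠ 0 := by exact_mod_cast hq0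
  have hBC : (B : ℂ) ≠ 0 := by exact_mod_cast hB.ne'
  have hAre : A.re = B := by
    rw [hA]
    have : (Complex.I / (2 * q) : ℂ) = ((1 / (2 * q) : ℝ) : ℂ) * Complex.I := by
      push_cast; ring
    rw [this]; simp
  have hA0 : A ≠ 0 := fun h => by simp [h] at hAre; exact hB.ne hAre
  have hden : (1 / (4 * B) + Complex.I * q / 2 : ℂ) ≠ 0 := fun h => by
    rw [h, mul_zero] at ha
    exact zero_ne_one ha
  have ha0 : a ≠ 0 := fun h => by simp [h] at ha
  have hinv : a = (1 / (4 * B) + Complex.I * q / 2)⁻¹ := eq_inv_of_mul_eq_one_left ha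
  have hinv' : a⁻¹ = 1 / (4 * B) + Complex.I * q / 2 := by rw [hinv, inv_inv]
  have hare : 0 < a.re := by
    rw [hinv, Complex.inv_re]
    have h1 : (1 / (4 * B) + Complex.I * q / 2 : ℂ).re = 1 / (4 * B) := by
      have : (1 / (4 * B) + Complex.I * q / 2 : ℂ) =
        ((1 / (4 * B) : ℝ) : ℂ) + ((q / 2 : ℝ) : ℂ) * Complex.I := by push_cast; ring
      rw [this]; simp
    rw [h1]
    have := Complex.normSq_pos.mpr hden
    positivity
  -- the relation between the parameters
  have hrel : a = -2 * Complex.I / q + 1 / (q ^ 2 * A) := by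
    have h4 : 4 * B * (1 / (4 * B) + Complex.I * q / 2) = A * (2 * Complex.I * q) := by
      rw [hA]; field_simp
      linear_combination 2 * Complex.I_sq
    have h5 : a * (A * (2 * Complex.I * q)) = 4 * B := by
      rw [← h4]; linear_combination (4 * B : ℂ) * ha
    have h6 : A * (2 * q) = 2 * B * q - Complex.I * 1 := by
      rw [hA]; field_simp
    field_simp
    linear_combination (-(q * Complex.I) / 2) * h5 + a * A * q ^ 2 * Complex.I_sq +
      Complex.I * h6 - Complex.I_sq
  have hmain := Complex.tsum_exp_neg_mul_int_sq hare
  have hL : ∑' n : ℤ, Complex.exp (-Real.pi * a * (n : ℂ) ^ 2) =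
      A ^ (1 / 2 : ℂ) * ∑ r ∈ Finset.range q, Complex.exp (2 * Real.pi * Complex.I * (r ^ 2 / q)) *
      ∑' k : ℤ, Complex.exp (-Real.pi * A * k ^ 2 +
        2 * Real.pi * (Complex.I * (-(r / q) : ℝ)) * k) := by
    have hs := summable_cexp_neg_mul_int_sq hare 0
    simp only [Complex.ofReal_zero, add_zero] at hs
    rw [tsum_int_eq_sum_range_tsum hq0 hs, Finset.mul_sum]
    refine Finset.sum_congr rfl fun r _ => ?_
    have h3 := tsum_exp_shift (by rw [hAre]; exact hB : 0 < A.re) (r / q)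
    rw [mul_left_comm, ← h3, ← tsum_mul_left]
    refine tsum_congr fun k => ?_
    rw [← Complex.exp_add, Complex.exp_eq_exp_iff_exists_int]
    refine ⟨2 * r * k + q * k ^ 2, ?_⟩
    rw [hrel]
    push_cast
    field_simp
    ring
  have hR : ∑' n : ℤ, Complex.exp (-Real.pi / a * (n : ℂ) ^ 2) = (B : ℂ) ^ (1 / 2 : ℂ) *
      ((∑' k : ℤ, Complex.exp (-Real.pi * B * k ^ 2 +
        2 * Real.pi * (Complex.I * (-0 : ℝ)) * k)) -
      Complex.I * ∑' k : ℤ, Complex.exp (-Real.pi * B * k ^ 2 +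
        2 * Real.pi * (Complex.I * (-(1 / 2) : ℝ)) * k)) := by
    have hare' : 0 < (a⁻¹).re := by
      rw [Complex.inv_re]
      have := Complex.normSq_pos.mpr ha0
      positivity
    have hs := summable_cexp_neg_mul_int_sq hare' 0
    simp only [Complex.ofReal_zero, add_zero, ← div_eq_mul_inv] at hs
    rw [tsum_int_eq_sum_range_tsum two_ne_zero hs, Finset.sum_range_succ, Finset.sum_range_one,
      mul_sub, mul_left_comm ((B : ℂ) ^ (1 / 2 : ℂ)) Complex.I,
      ← tsum_exp_shift (by simpa using hB : 0 < (B : ℂ).re),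
      ← tsum_exp_shift (by simpa using hB : 0 < (B : ℂ).re), sub_eq_add_neg, ← neg_mul,
      ← tsum_mul_left]
    congr 1
    · refine tsum_congr fun k => ?_
      rw [Complex.exp_eq_exp_iff_exists_int]
      refine ⟨- (q * k ^ 2), ?_⟩
      rw [div_eq_mul_inv _ a, hinv']
      push_cast
      field_simp
      ring
    · refine tsum_congr fun k => ?_
      have hI : -Complex.I = Complex.exp (-(Real.pi / 2 * Complex.I)) := by
        rw [Complex.exp_neg, Complex.exp_pi_div_two_mul_I, Complex.inv_I]
      rw [hI, ← Complex.exp_add, Complex.exp_eq_exp_iff_exists_int]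
      obtain ⟨t, ht⟩ : ∃ t : ℕ, q = 4 * t + 1 := ⟨q / 4, by omega⟩
      refine ⟨- (q * (k ^ 2 + k)) - t, ?_⟩
      rw [div_eq_mul_inv _ a, hinv']
      have hq4 : (q : ℂ) = 4 * t + 1 := by exact_mod_cast ht
      push_cast
      rw [hq4]
      field_simp
      ring
  rw [← hL, hmain, hR]

open Filter Topology in
/-- Evaluation of the quadratic Gauss sum modulo `q ≡ 1 (mod 4)`, including its sign. -/
theorem sum_range_exp_sq {q : ℕ} (hq : q % 4 = 1) :
    ∑ r ∈ Finset.range q, Complex.exp (2 * Real.pi * Complex.I * (r ^ 2 / q)) = √(q : ℝ) := by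
  have hq0 : q ≠ 0 := by omega
  have hqC : (q : ℂ) ≠ 0 := by exact_mod_cast hq0
  let A : ℝ → ℂ := fun B => B - Complex.I / (2 * q)
  let a : ℝ → ℂ := fun B => (1 / (4 * B) + Complex.I * q / 2)⁻¹
  have hAre : ∀ B, (A B).re = B := fun B => by
    have : (Complex.I / (2 * q) : ℂ) = ((1 / (2 * q) : ℝ) : ℂ) * Complex.I := by
      push_cast; ring
    simp only [A]
    rw [this]; simp
  have hB0 : Tendsto (fun B : ℝ => (B : ℂ)⁻¹) atTop (𝓝 0) := by
    have := (Complex.continuous_ofReal.tendsto 0).comp tendsto_inv_atTop_zero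
    simpa [Function.comp_def] using this
  have hQ : Tendsto (fun B => ∑ r ∈ Finset.range q,
      Complex.exp (2 * Real.pi * Complex.I * (r ^ 2 / q)) *
      ∑' k : ℤ, Complex.exp (-Real.pi * A B * k ^ 2 +
        2 * Real.pi * (Complex.I * (-(r / q) : ℝ)) * k)) atTop
      (𝓝 (∑ r ∈ Finset.range q, Complex.exp (2 * Real.pi * Complex.I * (r ^ 2 / q)))) := by
    refine tendsto_finsetSum _ fun r _ => ?_
    simpa using (tendsto_tsum_exp_neg_sq hAre (-(r / q))).const_mul
      (Complex.exp (2 * Real.pi * Complex.I * (r ^ 2 / q)))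
  have hAB : Tendsto (fun B : ℝ => (A B * (B : ℂ)⁻¹) ^ (1 / 2 : ℂ)) atTop (𝓝 1) := by
    have h1 : Tendsto (fun B : ℝ => A B * (B : ℂ)⁻¹) atTop (𝓝 1) := by
      have : Tendsto (fun B : ℝ => 1 - Complex.I / (2 * q) * (B : ℂ)⁻¹) atTop (𝓝 1) := by
        simpa using (hB0.const_mul (Complex.I / (2 * q))).const_sub 1
      refine this.congr' ?_
      filter_upwards [eventually_gt_atTop 0] with B hB
      have : (B : ℂ) ≠ 0 := by exact_mod_cast hB.ne'
      simp only [A]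
      field_simp
    have := Filter.Tendsto.cpow h1 (tendsto_const_nhds (x := (1 / 2 : ℂ)))
      (Or.inl (by simp) : (1 : ℂ) ∈ Complex.slitPlane)
    simpa using this
  have hw : ((1 - Complex.I) / √(q : ℝ)) ^ 2 = (Complex.I * q / 2)⁻¹ := by
    have : ((√(q : ℝ) : ℝ) : ℂ) ^ 2 = q := by
      rw [← Complex.ofReal_pow, Real.sq_sqrt (by positivity)]; simp
    rw [div_pow, this]
    have hI := Complex.I_ne_zero
    field_simp
    linear_combination (Complex.I - 2) * Complex.I_sq
  have hsq : (0 : ℝ) < √(q : ℝ) := Real.sqrt_pos.mpr (by positivity)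
  have hwroot : ((Complex.I * q / 2)⁻¹) ^ (1 / 2 : ℂ) = (1 - Complex.I) / √(q : ℝ) := by
    rw [← hw, one_div, Complex.sq_cpow_two_inv]
    rw [Complex.div_ofReal_re]
    simp [hsq]
    
  have hRa : Tendsto (fun B : ℝ => 1 / a B ^ (1 / 2 : ℂ)) atTop
      (𝓝 (√(q : ℝ) / (1 - Complex.I))) := by
    have h1 : Tendsto a atTop (𝓝 ((Complex.I * q / 2)⁻¹)) := by
      refine Tendsto.inv₀ ?_ (by simp [hq0])
      have := (hB0.const_mul (1 / 4 : ℂ)).add_const (Complex.I * q / 2)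
      simp only [mul_zero, zero_add] at this
      refine this.congr fun B => ?_
      rw [one_div, one_div, mul_inv]
    have h2 : (Complex.I * q / 2 : ℂ)⁻¹ ∈ Complex.slitPlane := by
      refine Or.inr ?_
      have : (Complex.I * q / 2 : ℂ)⁻¹ = ((-(2 / q) : ℝ) : ℂ) * Complex.I := by
        have hI := Complex.I_ne_zero
        push_cast; field_simp; simp
      rw [this]; simp [hq0]
    have h3 := h1.cpow (tendsto_const_nhds (x := (1 / 2 : ℂ))) h2
    rw [hwroot] at h3
    have h4 : (1 - Complex.I) / √(q : ℝ) ≠ 0 := by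
      refine div_ne_zero (fun h => ?_) (by exact_mod_cast hsq.ne')
      have := congrArg Complex.re h
      simp at this
    simpa using h3.inv₀ h4
  have hT := fun r => tendsto_tsum_exp_neg_sq (A := fun B : ℝ => (B : ℂ)) (fun B => by simp) r
  have hRR := hRa.mul ((hT (-0)).sub ((hT (-(1 / 2))).const_mul Complex.I))
  have hLL := hAB.mul hQ
  have heq := tendsto_nhds_unique (hLL.congr' ?_) hRR
  · rw [one_mul] at heq
    rw [heq, mul_one, div_mul_cancel₀]
    intro h
    have := congrArg Complex.re h
    simp at this
  · filter_upwards [eventually_gt_atTop 0] with B hB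
    have hBC : (B : ℂ) ≠ 0 := by exact_mod_cast hB.ne'
    have hid := quadratic_sum_theta_identity hq hB (A := A B) (a := a B) rfl (by
      refine inv_mul_cancel₀ fun h => ?_
      have := congrArg Complex.im h
      have h1 : (1 / (4 * B) + Complex.I * q / 2 : ℂ) =
        ((1 / (4 * B) : ℝ) : ℂ) + ((q / 2 : ℝ) : ℂ) * Complex.I := by push_cast; ring
      rw [h1] at this
      simp [hq0] at this)
    have hpow : A B ^ (1 / 2 : ℂ) = (B : ℂ) ^ (1 / 2 : ℂ) * (A B * (B : ℂ)⁻¹) ^ (1 / 2 : ℂ) := by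
      rw [← Complex.ofReal_inv]
      conv_lhs => rw [show A B = ((B : ℝ) : ℂ) * (A B * ((B⁻¹ : ℝ) : ℂ)) by
        push_cast; field_simp]
      have h0 : A B * ((B⁻¹ : ℝ) : ℂ) ≠ 0 := by
        refine mul_ne_zero (fun h => ?_) (by exact_mod_cast (inv_pos.mpr hB).ne')
        have := hAre B
        rw [h] at this
        exact hB.ne (by simpa using this)
      rw [Complex.cpow_def_of_ne_zero (mul_ne_zero hBC h0), Complex.log_ofReal_mul hB h0,
        Complex.cpow_def_of_ne_zero hBC, Complex.cpow_def_of_ne_zero h0, ← Complex.exp_add,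
        ← Complex.ofReal_log hB.le, add_mul]
    have hB2 : (B : ℂ) ^ (1 / 2 : ℂ) ≠ 0 := by simp [hBC]
    rw [hpow] at hid
    refine mul_left_cancel₀ hB2 ?_
    linear_combination hid

theorem sum_range_mul_of_coprime {m n : ℕ} (hmn : m.Coprime n) (f : ℤ → ℂ)
    (hf : ∀ a b : ℤ, a ≡ b [ZMOD (m * n : ℕ)] → f a = f b) :
    ∑ a ∈ Finset.range (m * n), f a =
      ∑ x ∈ Finset.range m, ∑ y ∈ Finset.range n, f (n * x + m * y) := by
  rw [← Finset.sum_product']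
  symm
  have hmaps : Set.MapsTo (fun p : ℕ × ℕ => (n * p.1 + m * p.2) % (m * n))
      (Finset.range m ×ˢ Finset.range n : Finset (ℕ × ℕ)) (Finset.range (m * n)) := by
    rintro ⟨x, y⟩ h
    simp only [Finset.coe_product, Finset.coe_range, Set.mem_prod, Set.mem_Iio] at h ⊢
    exact Nat.mod_lt _ (Nat.mul_pos (by omega) (by omega))
  have hinj : Set.InjOn (fun p : ℕ × ℕ => (n * p.1 + m * p.2) % (m * n))
      (Finset.range m ×ˢ Finset.range n : Finset (ℕ × ℕ)) := by
    rintro ⟨x, y⟩ h ⟨x', y'⟩ h' heq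
    simp only [Finset.coe_product, Finset.coe_range, Set.mem_prod, Set.mem_Iio] at h h' heq
    have h1 : n * x + m * y ≡ n * x' + m * y' [MOD m * n] := heq
    have hx : n * x + m * y ≡ n * x' + m * y' [MOD m] := h1.of_mul_right n
    have hy : n * x + m * y ≡ n * x' + m * y' [MOD n] := h1.of_mul_left m
    have hx2 : n * x ≡ n * x' [MOD m] := by
      simpa [Nat.ModEq] using hx
    have hy2 : m * y ≡ m * y' [MOD n] := by
      simpa [Nat.ModEq] using hy
    have hx3 := Nat.ModEq.cancel_left_of_coprime (by simpa using hmn) hx2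
    have hy3 := Nat.ModEq.cancel_left_of_coprime (by simpa using hmn.symm) hy2
    rw [Nat.ModEq, Nat.mod_eq_of_lt h.1, Nat.mod_eq_of_lt h'.1] at hx3
    rw [Nat.ModEq, Nat.mod_eq_of_lt h.2, Nat.mod_eq_of_lt h'.2] at hy3
    simp [hx3, hy3]
  refine Finset.sum_nbij _ hmaps hinj
    (Finset.surjOn_of_injOn_of_card_le _ hmaps hinj (by simp)) ?_
  rintro ⟨x, y⟩ -
  refine hf _ _ ?_
  push_cast
  exact (Int.mod_modEq _ _).symm

theorem exp_two_pi_eq_of_modEq {q : ℕ} (hq : q ≠ 0) {a b : ℤ} (h : a ≡ b [ZMOD q]) :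
    Complex.exp (2 * Real.pi * Complex.I * (a / q)) =
      Complex.exp (2 * Real.pi * Complex.I * (b / q)) := by
  obtain ⟨t, ht⟩ := h.symm.dvd
  rw [Complex.exp_eq_exp_iff_exists_int]
  refine ⟨t, ?_⟩
  have hqC : (q : ℂ) ≠ 0 := by exact_mod_cast hq
  have : (a : ℂ) = b + q * t := by
    have : a = b + q * t := by linarith
    rw [this]; push_cast; ring
  rw [this]
  field_simp

/-- The Gauss sum attached to the Jacobi symbol. -/
noncomputable def jacobiGaussSum (q : ℕ) (h : ℤ) : ℂ :=
  ∑ a ∈ Finset.range q, (jacobiSym a q : ℂ) *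
    Complex.exp (2 * Real.pi * Complex.I * ((a * h : ℤ) / q))

/-- The quadratic Gauss sum as an exponential sum over squares. -/
noncomputable def quadraticExpSum (q : ℕ) (h : ℤ) : ℂ :=
  ∑ x ∈ Finset.range q, Complex.exp (2 * Real.pi * Complex.I * ((x ^ 2 * h : ℤ) / q))

theorem exp_crt_split {m n : ℕ} (hm : m ≠ 0) (hn : n ≠ 0) (x y : ℤ) :
    Complex.exp (2 * Real.pi * Complex.I * ((n * x + m * y : ℤ) / (m * n : ℕ))) =
      Complex.exp (2 * Real.pi * Complex.I * (x / m)) *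
        Complex.exp (2 * Real.pi * Complex.I * (y / n)) := by
  have hm' : (m : ℂ) ≠ 0 := by exact_mod_cast hm
  have hn' : (n : ℂ) ≠ 0 := by exact_mod_cast hn
  rw [← Complex.exp_add]
  congr 1
  push_cast
  field_simp

theorem jacobiSym_eq_of_modEq {q : ℕ} {a b : ℤ} (h : a ≡ b [ZMOD q]) :
    jacobiSym a q = jacobiSym b q := jacobiSym.mod_left' h

theorem jacobiGaussSum_mul {m n : ℕ} (hm : m ≠ 0) (hn : n ≠ 0) (hmn : m.Coprime n) (h : ℤ) :
    jacobiGaussSum (m * n) h =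
      jacobiSym n m * jacobiSym m n * (jacobiGaussSum m h * jacobiGaussSum n h) := by
  have hm' : NeZero m := ⟨hm⟩
  have hn' : NeZero n := ⟨hn⟩
  unfold jacobiGaussSum
  rw [sum_range_mul_of_coprime hmn (fun a => (jacobiSym a (m * n) : ℂ) *
    Complex.exp (2 * Real.pi * Complex.I * ((a * h : ℤ) / (m * n : ℕ))))]
  · rw [Finset.sum_mul_sum, Finset.mul_sum]
    refine Finset.sum_congr rfl fun x _ => ?_
    rw [Finset.mul_sum]
    refine Finset.sum_congr rfl fun y _ => ?_
    have h1 : ((n * x + m * y : ℤ) * h) = n * (x * h) + m * (y * h) := by ring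
    have h2 : jacobiSym (n * x + m * y) m = jacobiSym n m * jacobiSym x m := by
      rw [← jacobiSym.mul_left]
      exact jacobiSym_eq_of_modEq (Int.modEq_iff_dvd.mpr ⟨-y, by ring⟩)
    have h3 : jacobiSym (n * x + m * y) n = jacobiSym m n * jacobiSym y n := by
      rw [← jacobiSym.mul_left]
      exact jacobiSym_eq_of_modEq (Int.modEq_iff_dvd.mpr ⟨-x, by ring⟩)
    rw [jacobiSym.mul_right, h2, h3, h1, exp_crt_split hm hn]
    push_cast
    ring
  · intro a b hab
    rw [jacobiSym_eq_of_modEq hab, exp_two_pi_eq_of_modEq (mul_ne_zero hm hn) (hab.mul_right h)]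

theorem quadraticExpSum_mul {m n : ℕ} (hm : m ≠ 0) (hn : n ≠ 0) (hmn : m.Coprime n) (h : ℤ) :
    quadraticExpSum (m * n) h = quadraticExpSum m (n * h) * quadraticExpSum n (m * h) := by
  unfold quadraticExpSum
  rw [sum_range_mul_of_coprime hmn (fun a =>
    Complex.exp (2 * Real.pi * Complex.I * ((a ^ 2 * h : ℤ) / (m * n : ℕ))))]
  · rw [Finset.sum_mul_sum]
    refine Finset.sum_congr rfl fun x _ => Finset.sum_congr rfl fun y _ => ?_
    rw [← exp_crt_split hm hn]
    refine exp_two_pi_eq_of_modEq (mul_ne_zero hm hn) (Int.modEq_iff_dvd.mpr ⟨-2 * x * y * h, ?_⟩)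
    push_cast
    ring
  · intro a b hab
    exact exp_two_pi_eq_of_modEq (mul_ne_zero hm hn) ((hab.pow 2).mul_right h)

/-- A periodic sum may be reindexed by multiplication with a unit. -/
theorem sum_range_mul_unit {q : ℕ} (hq : q ≠ 0) {c : ℤ} (hc : IsCoprime c q) (f : ℤ → ℂ)
    (hf : ∀ a b : ℤ, a ≡ b [ZMOD q] → f a = f b) :
    ∑ a ∈ Finset.range q, f (c * a) = ∑ a ∈ Finset.range q, f a := by
  have : NeZero q := ⟨hq⟩
  have hpos : (0 : ℤ) < q := by positivity
  have hmaps : Set.MapsTo (fun a : ℕ => ((c * a) % q : ℤ).toNat) (Finset.range q)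
      (Finset.range q) := by
    intro a _
    have := Int.emod_lt_of_pos (c * a) hpos
    have := Int.emod_nonneg (c * a) hpos.ne'
    simp only [Finset.coe_range, Set.mem_Iio]
    omega
  have hinj : Set.InjOn (fun a : ℕ => ((c * a) % q : ℤ).toNat) (Finset.range q) := by
    intro a ha b hb hab
    simp only [Finset.coe_range, Set.mem_Iio] at ha hb hab
    have h1 := Int.emod_nonneg (c * a) hpos.ne'
    have h2 := Int.emod_nonneg (c * b) hpos.ne'
    have h3 : (c * a) % q = (c * b) % q := by omega
    have h4 : c * (a : ℤ) ≡ c * b [ZMOD q] := h3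
    have h5 : (q : ℤ) ∣ b - a := by
      have := h4.dvd
      rw [← mul_sub] at this
      exact hc.symm.dvd_of_dvd_mul_left this
    have h6 : (a : ℤ) ≡ b [ZMOD q] := Int.modEq_iff_dvd.mpr h5
    have h7 : a ≡ b [MOD q] := Int.natCast_modEq_iff.mp h6
    rwa [Nat.ModEq, Nat.mod_eq_of_lt ha, Nat.mod_eq_of_lt hb] at h7
  refine Finset.sum_nbij _ hmaps hinj
    (Finset.surjOn_of_injOn_of_card_le _ hmaps hinj le_rfl) ?_
  intro a _
  refine hf _ _ ?_
  rw [Int.toNat_of_nonneg (Int.emod_nonneg _ hpos.ne')]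
  exact (Int.mod_modEq _ _).symm

theorem jacobiGaussSum_mul_right {q : ℕ} (hq : q ≠ 0) {c : ℤ} (hc : IsCoprime c q) (h : ℤ) :
    jacobiGaussSum q (c * h) = jacobiSym c q * jacobiGaussSum q h := by
  unfold jacobiGaussSum
  have := sum_range_mul_unit hq hc (fun a => (jacobiSym a q : ℂ) *
    Complex.exp (2 * Real.pi * Complex.I * ((a * h : ℤ) / q))) (fun a b hab => by
      rw [jacobiSym_eq_of_modEq hab, exp_two_pi_eq_of_modEq hq (hab.mul_right h)])
  rw [← this, Finset.mul_sum]
  refine Finset.sum_congr rfl fun a _ => ?_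
  have hsq : (jacobiSym c q : ℂ) * jacobiSym c q = 1 := by
    have := jacobiSym.sq_one (Int.isCoprime_iff_gcd_eq_one.mp hc)
    rw [sq] at this
    exact_mod_cast this
  rw [jacobiSym.mul_left, show (a : ℤ) * (c * h) = c * a * h by ring]
  push_cast
  linear_combination (-(jacobiSym a q : ℂ) *
    Complex.exp (2 * Real.pi * Complex.I * (c * a * h / q))) * hsq

theorem sum_range_eq_sum_zmod {q : ℕ} [NeZero q] (f : ZMod q → ℂ) :
    ∑ a ∈ Finset.range q, f a = ∑ x : ZMod q, f x := by
  refine Finset.sum_nbij (fun a : ℕ => (a : ZMod q))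
    (fun _ _ => Finset.mem_coe.mpr (Finset.mem_univ _)) ?_ ?_ fun _ _ => rfl
  · intro a ha b hb hab
    simp only [Finset.coe_range, Set.mem_Iio] at ha hb
    have := (ZMod.natCast_eq_natCast_iff' a b q).mp hab
    rwa [Nat.mod_eq_of_lt ha, Nat.mod_eq_of_lt hb] at this
  · intro x _
    exact ⟨x.val, by simpa using ZMod.val_lt x, by simp⟩

theorem sum_range_exp_eq_zero {q : ℕ} (hq : q ≠ 0) {h : ℤ} (hh : ¬ (q : ℤ) ∣ h) :
    ∑ a ∈ Finset.range q, Complex.exp (2 * Real.pi * Complex.I * ((a * h : ℤ) / q)) = 0 := by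
  have hqC : (q : ℂ) ≠ 0 := by exact_mod_cast hq
  set w := Complex.exp (2 * Real.pi * Complex.I * (h / q)) with hw
  have h1 : ∀ a : ℕ, Complex.exp (2 * Real.pi * Complex.I * ((a * h : ℤ) / q)) = w ^ a := by
    intro a
    rw [hw, ← Complex.exp_nat_mul]
    congr 1
    push_cast
    ring
  simp_rw [h1]
  have hw1 : w ≠ 1 := by
    intro h2
    rw [hw, Complex.exp_eq_one_iff] at h2
    obtain ⟨n, hn⟩ := h2
    have hpi : (2 * Real.pi * Complex.I : ℂ) ≠ 0 := Complex.two_pi_I_ne_zero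
    have h3 : (h : ℂ) / q = n := mul_left_cancel₀ hpi (by rw [hn]; ring)
    rw [div_eq_iff hqC] at h3
    exact hh ⟨n, by rw [mul_comm]; exact_mod_cast h3⟩
  rw [geom_sum_eq hw1]
  have : w ^ q = 1 := by
    rw [hw, ← Complex.exp_nat_mul, Complex.exp_eq_one_iff]
    exact ⟨h, by field_simp⟩
  rw [this, sub_self, zero_div]

theorem quadraticExpSum_prime {p : ℕ} (hp : p.Prime) (hp2 : p ≠ 2) {h : ℤ} (hh : ¬ (p : ℤ) ∣ h) :
    quadraticExpSum p h = jacobiGaussSum p h := by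
  have : Fact p.Prime := ⟨hp⟩
  let g : ZMod p → ℂ := fun x => Complex.exp (2 * Real.pi * Complex.I * ((x.val * h : ℤ) / p))
  have hg : ∀ a : ℤ, g a = Complex.exp (2 * Real.pi * Complex.I * ((a * h : ℤ) / p)) := by
    intro a
    refine exp_two_pi_eq_of_modEq hp.ne_zero (Int.ModEq.mul_right h ?_)
    rw [ZMod.val_intCast]
    exact Int.mod_modEq _ _
  have h1 : quadraticExpSum p h = ∑ x : ZMod p, g (x ^ 2) := by
    rw [← sum_range_eq_sum_zmod (fun x => g (x ^ 2))]
    refine Finset.sum_congr rfl fun a _ => ?_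
    rw [← hg]
    push_cast
    rfl
  have h2 : jacobiGaussSum p h = ∑ x : ZMod p, (quadraticChar (ZMod p) x : ℂ) * g x := by
    rw [← sum_range_eq_sum_zmod (fun x => (quadraticChar (ZMod p) x : ℂ) * g x)]
    refine Finset.sum_congr rfl fun a _ => ?_
    rw [← hg, ← jacobiSym.legendreSym.to_jacobiSym, legendreSym]
    push_cast
    rfl
  have h3 : ∑ x : ZMod p, g x = 0 := by
    rw [← sum_range_eq_sum_zmod, ← sum_range_exp_eq_zero hp.ne_zero hh]
    refine Finset.sum_congr rfl fun a _ => ?_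
    rw [← hg]; push_cast; rfl
  rw [h1, h2, ← add_zero (∑ x : ZMod p, (quadraticChar (ZMod p) x : ℂ) * g x), ← h3,
    ← Finset.sum_add_distrib, ← Finset.sum_fiberwise (Finset.univ : Finset (ZMod p))
      (fun x => x ^ 2)]
  refine Finset.sum_congr rfl fun a _ => ?_
  rw [Finset.sum_congr rfl (g := fun _ => g a) (fun x hx => by rw [(Finset.mem_filter.mp hx).2]),
    Finset.sum_const, nsmul_eq_mul]
  have h4 := quadraticChar_card_sqrts (F := ZMod p) (by rwa [ZMod.ringChar_zmod_n]) a
  have h5 : ((Finset.univ.filter fun x : ZMod p => x ^ 2 = a).card : ℤ) =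
      quadraticChar (ZMod p) a + 1 := by
    rw [← h4]; congr 2; ext; simp
  have h6 : ((Finset.univ.filter fun x : ZMod p => x ^ 2 = a).card : ℂ) =
      quadraticChar (ZMod p) a + 1 := by exact_mod_cast h5
  rw [h6]; ring

theorem jacobiGaussSum_prime_dvd {p : ℕ} (hp : p.Prime) (hp2 : p ≠ 2) {h : ℤ}
    (hh : (p : ℤ) ∣ h) : jacobiGaussSum p h = 0 := by
  have : Fact p.Prime := ⟨hp⟩
  have h1 := quadraticChar_sum_zero (F := ZMod p) (by rwa [ZMod.ringChar_zmod_n])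
  have h2 : ∑ x : ZMod p, (quadraticChar (ZMod p) x : ℂ) = 0 := by exact_mod_cast h1
  rw [← h2, ← sum_range_eq_sum_zmod]
  refine Finset.sum_congr rfl fun a _ => ?_
  have h3 : Complex.exp (2 * Real.pi * Complex.I * ((a * h : ℤ) / p)) = 1 := by
    rw [exp_two_pi_eq_of_modEq hp.ne_zero (b := 0)
      (Int.modEq_zero_iff_dvd.mpr (hh.mul_left _))]
    simp
  rw [h3, mul_one, ← jacobiSym.legendreSym.to_jacobiSym, legendreSym]
  push_cast
  rfl

theorem jacobiGaussSum_facts {q : ℕ} (hq : Squarefree q) (hodd : Odd q) :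
    (∀ h : ℤ, jacobiGaussSum q h = jacobiSym h q * jacobiGaussSum q 1) ∧
      ∀ h : ℤ, IsCoprime h q → quadraticExpSum q h = jacobiGaussSum q h := by
  induction q using Nat.recOnPosPrimePosCoprime with
  | zero => exact absurd hq not_squarefree_zero
  | one => simp [jacobiGaussSum, quadraticExpSum]
  | prime_pow p n hp hn =>
    have hn1 : n = 1 := by
      have := (Nat.squarefree_pow_iff hp.ne_one hn.ne').mp hq
      exact this.2
    subst hn1
    rw [pow_one] at *
    have hp2 : p ≠ 2 := by rintro rfl; exact absurd hodd (by decide)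
    have := Fact.mk hp
    refine ⟨fun h => ?_, fun h hh => quadraticExpSum_prime hp hp2 fun hd => ?_⟩
    · by_cases hd : (p : ℤ) ∣ h
      · rw [jacobiGaussSum_prime_dvd hp hp2 hd]
        have : jacobiSym h p = 0 := by
          rw [← jacobiSym.legendreSym.to_jacobiSym, legendreSym.eq_zero_iff]
          exact (ZMod.intCast_zmod_eq_zero_iff_dvd h p).mpr hd
        simp [this]
      · have hc : IsCoprime h p := ((Nat.prime_iff_prime_int.mp hp).coprime_iff_not_dvd.mpr hd).symm
        simpa using jacobiGaussSum_mul_right hp.ne_zero hc 1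
    · exact (Nat.prime_iff_prime_int.mp hp).not_isUnit (hh.isUnit_of_dvd' hd dvd_rfl)
  | coprime a b ha hb hab iha ihb =>
    have ha0 : a ≠ 0 := by omega
    have hb0 : b ≠ 0 := by omega
    have : NeZero a := ⟨ha0⟩
    have : NeZero b := ⟨hb0⟩
    obtain ⟨ha1, ha2⟩ := iha (hq.of_mul_left) (Nat.odd_mul.mp hodd).1
    obtain ⟨hb1, hb2⟩ := ihb (hq.of_mul_right) (Nat.odd_mul.mp hodd).2
    refine ⟨fun h => ?_, fun h hh => ?_⟩
    · rw [jacobiGaussSum_mul ha0 hb0 hab, jacobiGaussSum_mul ha0 hb0 hab, ha1 h, hb1 h,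
        jacobiSym.mul_right]
      push_cast; ring
    · have habZ : IsCoprime (a : ℤ) b := Nat.isCoprime_iff_coprime.mpr hab
      push_cast at hh
      have hha := hh.of_mul_right_left
      have hhb := hh.of_mul_right_right
      rw [quadraticExpSum_mul ha0 hb0 hab, ha2 _ (habZ.symm.mul_left hha),
        hb2 _ (habZ.mul_left hhb), jacobiGaussSum_mul ha0 hb0 hab,
        jacobiGaussSum_mul_right ha0 habZ.symm, jacobiGaussSum_mul_right hb0 habZ]
      ring

/-- Evaluation of the Gauss sum of the Jacobi symbol modulo squarefree `q ≡ 1 (mod 4)`. -/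
theorem jacobiGaussSum_eq {q : ℕ} (hq : Squarefree q) (h1 : q % 4 = 1) (h : ℤ) :
    jacobiGaussSum q h = √(q : ℝ) * jacobiSym h q := by
  obtain ⟨ha, hb⟩ := jacobiGaussSum_facts hq (Nat.odd_iff.mpr (by omega))
  have h2 := hb 1 isCoprime_one_left
  rw [ha, ← h2, mul_comm, ← sum_range_exp_sq h1]
  simp [quadraticExpSum]

/-- The Jacobi symbol `(m / n)` as a complex number, with the modulus as first argument. -/
noncomputable def jacobiChi (n m : ℕ) : ℂ := (jacobiSym m n : ℂ)

theorem jacobiChi_mul (n a b : ℕ) : jacobiChi n (a * b) = jacobiChi n a * jacobiChi n b := by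
  simp [jacobiChi, jacobiSym.mul_left]

theorem jacobiChi_mul_modulus {n₁ n₂ : ℕ} (h₁ : n₁ ≠ 0) (h₂ : n₂ ≠ 0) (a : ℕ) :
    jacobiChi (n₁ * n₂) a = jacobiChi n₁ a * jacobiChi n₂ a := by
  simp [jacobiChi, jacobiSym.mul_right' _ h₁ h₂]

theorem norm_jacobiChi_le_one (n m : ℕ) : ‖jacobiChi n m‖ ≤ 1 := by
  rcases jacobiSym.trichotomy m n with h | h | h <;> simp [jacobiChi, h]

theorem conj_jacobiChi (n m : ℕ) : (starRingEnd ℂ) (jacobiChi n m) = jacobiChi n m := by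
  simp [jacobiChi]

theorem jacobiChi_sq {n : ℕ} (hn : n ≠ 0) (m : ℕ) :
    jacobiChi n m ^ 2 = if m.Coprime n then 1 else 0 := by
  have : NeZero n := ⟨hn⟩
  split_ifs with h
  · have := jacobiSym.sq_one (a := (m : ℤ)) (b := n) (by simpa [Int.gcd_natCast_natCast] using h)
    rw [jacobiChi]; exact_mod_cast this
  · have : jacobiSym m n = 0 := by
      rw [jacobiSym.eq_zero_iff_not_coprime]
      simpa [Int.gcd_natCast_natCast] using h
    simp [jacobiChi, this]

theorem jacobiChi_zero {n : ℕ} (hn : 1 < n) : jacobiChi n 0 = 0 := by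
  simp [jacobiChi, jacobiSym.zero_left hn]

/-- The Gaussian weight `exp (-π x²)`. -/
noncomputable def gaussWeight (x : ℝ) : ℂ := ((Real.exp (-Real.pi * x ^ 2) : ℝ) : ℂ)

theorem norm_gaussWeight (x : ℝ) : ‖gaussWeight x‖ = Real.exp (-Real.pi * x ^ 2) := by
  rw [gaussWeight, Complex.norm_real, Real.norm_of_nonneg (Real.exp_pos _).le]

theorem summable_gauss_int {c : ℝ} (hc : 0 < c) :
    Summable fun m : ℤ => Real.exp (-Real.pi * (c * m) ^ 2) := by
  have := (HurwitzZeta.hasSum_int_evenKernel 0 (by positivity : 0 < c ^ 2)).summable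
  refine this.congr fun m => ?_
  congr 1
  ring

theorem summable_gauss_nat {c : ℝ} (hc : 0 < c) :
    Summable fun m : ℕ => Real.exp (-Real.pi * (c * m) ^ 2) := by
  have := (summable_gauss_int hc).comp_injective Nat.cast_injective
  simpa [Function.comp_def] using this

theorem summable_gaussWeight_mul {c : ℝ} (hc : 0 < c) {f : ℕ → ℂ} (hf : ∀ m, ‖f m‖ ≤ 1) :
    Summable fun m : ℕ => gaussWeight (c * m) * f m := by
  refine Summable.of_norm_bounded (summable_gauss_nat hc) fun m => ?_
  rw [norm_mul, norm_gaussWeight]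
  exact mul_le_of_le_one_right (Real.exp_pos _).le (hf m)

/-- Poisson summation for a periodic coefficient function. -/
theorem tsum_int_jacobi_gauss {q : ℕ} (hq : Squarefree q) (h1 : q % 4 = 1) {X : ℝ} (hX : 0 < X) :
    ∑' n : ℤ, gaussWeight (n / X) * jacobiSym n q =
      X / √(q : ℝ) * ∑' n : ℤ, gaussWeight (n * (X / q)) * jacobiSym n q := by
  have hq0 : q ≠ 0 := hq.ne_zero
  have hqR : (0 : ℝ) < q := by positivity
  have hqC : (q : ℂ) ≠ 0 := by exact_mod_cast hq0
  have hXC : (X : ℂ) ≠ 0 := by exact_mod_cast hX.ne'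
  have hnorm : ∀ n : ℤ, ‖(jacobiSym n q : ℂ)‖ ≤ 1 := fun n => by
    rcases jacobiSym.trichotomy n q with h | h | h <;> simp [h]
  have hs : Summable fun n : ℤ => gaussWeight (n / X) * jacobiSym n q := by
    refine Summable.of_norm_bounded (summable_gauss_int (inv_pos.mpr hX)) fun n => ?_
    rw [norm_mul, norm_gaussWeight, div_eq_inv_mul]
    exact mul_le_of_le_one_right (Real.exp_pos _).le (hnorm n)
  rw [tsum_int_eq_sum_range_tsum hq0 hs]
  have hA : (0 : ℝ) < (X / q) ^ 2 := by positivity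
  have hAC : 0 < (((X / q) ^ 2 : ℝ) : ℂ).re := by rwa [Complex.ofReal_re]
  have hroot : (((X / q) ^ 2 : ℝ) : ℂ) ^ (1 / 2 : ℂ) = X / q := by
    rw [one_div]
    push_cast
    refine Complex.sq_cpow_two_inv ?_
    rw [← Complex.ofReal_natCast, ← Complex.ofReal_div]
    simp only [Complex.ofReal_re]
    positivity
  have step : ∀ r ∈ Finset.range q,
      ∑' k : ℤ, gaussWeight ((r + q * k : ℤ) / X) * jacobiSym (r + q * k) q =
      X / q * ∑' k : ℤ, gaussWeight (k * (X / q)) * ((jacobiSym r q : ℂ) *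
        Complex.exp (2 * Real.pi * Complex.I * ((r * (-k) : ℤ) / q))) := by
    intro r _
    have h3 := tsum_exp_shift hAC (r / q)
    rw [hroot] at h3
    have hj : ∀ k : ℤ, jacobiSym (r + q * k) q = jacobiSym r q := fun k =>
      jacobiSym_eq_of_modEq (Int.modEq_iff_dvd.mpr ⟨-k, by ring⟩)
    simp_rw [hj]
    have e1 : ∀ k : ℤ, gaussWeight ((r + q * k : ℤ) / X) =
        Complex.exp (-Real.pi / ((X / q) ^ 2 : ℝ) * ((k : ℂ) + (r / q : ℝ)) ^ 2) := by
      intro k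
      rw [gaussWeight, Complex.ofReal_exp]
      congr 1
      push_cast
      field_simp
      ring
    simp_rw [e1]
    rw [tsum_mul_right, h3, mul_assoc, ← tsum_mul_right]
    congr 1
    refine tsum_congr fun k => ?_
    rw [gaussWeight, Complex.ofReal_exp, mul_left_comm (Complex.exp _) (jacobiSym r q : ℂ),
      ← Complex.exp_add, mul_comm (Complex.exp _)]
    congr 2
    push_cast
    field_simp
  rw [Finset.sum_congr rfl step, ← Finset.mul_sum, ← Summable.tsum_finsetSum]
  · have hgs : ∀ k : ℤ, ∑ r ∈ Finset.range q, gaussWeight (k * (X / q)) * ((jacobiSym r q : ℂ) *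
        Complex.exp (2 * Real.pi * Complex.I * ((r * (-k) : ℤ) / q))) =
        √(q : ℝ) * (gaussWeight (k * (X / q)) * jacobiSym k q) := by
      intro k
      have h4 := jacobiGaussSum_eq hq h1 (-k)
      have h5 : jacobiSym (-k) q = jacobiSym k q := by
        rw [jacobiSym.neg _ (Nat.odd_iff.mpr (by omega)), ZMod.χ₄_nat_one_mod_four h1, one_mul]
      rw [h5] at h4
      rw [← Finset.mul_sum]
      rw [jacobiGaussSum] at h4
      rw [h4]; ring
    simp_rw [hgs]
    rw [tsum_mul_left, ← mul_assoc]
    congr 1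
    have : ((√(q : ℝ) : ℝ) : ℂ) * √(q : ℝ) = q := by
      rw [← Complex.ofReal_mul, Real.mul_self_sqrt hqR.le]; simp
    have hsq : ((√(q : ℝ) : ℝ) : ℂ) ≠ 0 := fun h => hqC (by rw [← this, h, zero_mul])
    field_simp
    rw [sq, this]
  · intro r _
    refine Summable.of_norm_bounded (summable_gauss_int (by positivity : 0 < X / q)) fun n => ?_
    rw [norm_mul, norm_gaussWeight, norm_mul, mul_comm (n : ℝ)]
    refine mul_le_of_le_one_right (Real.exp_pos _).le ?_
    have : ‖Complex.exp (2 * Real.pi * Complex.I * ((r * (-n) : ℤ) / q))‖ = 1 := by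
      rw [show (2 * Real.pi * Complex.I * ((r * (-n) : ℤ) / q) : ℂ) =
        ((2 * Real.pi * ((r * (-n) : ℤ) / q) : ℝ) : ℂ) * Complex.I by push_cast; ring]
      exact Complex.norm_exp_ofReal_mul_I _
    rw [this, mul_one]
    exact hnorm r

theorem tsum_int_eq_two_mul_tsum_nat {f : ℤ → ℂ} (h0 : f 0 = 0) (heven : ∀ n, f (-n) = f n)
    (hf : Summable f) : ∑' n : ℤ, f n = 2 * ∑' n : ℕ, f n := by
  have hs : Summable fun n : ℕ => f n := hf.comp_injective Nat.cast_injective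
  have h1 : HasSum (fun n : ℕ => f n + f (-n)) (∑' n : ℤ, f n + f 0) := hf.hasSum.nat_add_neg
  rw [h0, add_zero] at h1
  rw [← h1.tsum_eq, ← tsum_mul_left]
  exact tsum_congr fun n => by rw [heven]; ring

theorem tsum_jacobi_gauss {q : ℕ} (hq : Squarefree q) (h1 : q % 4 = 1) (hq1 : 1 < q)
    {X : ℝ} (hX : 0 < X) :
    ∑' m : ℕ, gaussWeight (m / X) * jacobiChi q m =
      X / √(q : ℝ) * ∑' m : ℕ, gaussWeight (m * (X / q)) * jacobiChi q m := by
  have hq0 : (0 : ℝ) < q := by positivity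
  have key : ∀ c : ℝ, 0 < c → ∑' n : ℤ, gaussWeight (n * c) * jacobiSym n q =
      2 * ∑' m : ℕ, gaussWeight (m * c) * jacobiChi q m := by
    intro c hc
    rw [tsum_int_eq_two_mul_tsum_nat]
    · simp [jacobiChi]
    · simp [jacobiSym.zero_left hq1]
    · intro n
      rw [jacobiSym.neg _ (Nat.odd_iff.mpr (by omega)), ZMod.χ₄_nat_one_mod_four h1, one_mul]
      simp [gaussWeight]
    · refine Summable.of_norm_bounded (summable_gauss_int hc) fun n => ?_
      rw [norm_mul, norm_gaussWeight, mul_comm (n : ℝ)]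
      refine mul_le_of_le_one_right (Real.exp_pos _).le ?_
      rcases jacobiSym.trichotomy n q with h | h | h <;> simp [h]
  have h := tsum_int_jacobi_gauss hq h1 hX
  rw [key _ (by positivity)] at h
  simp_rw [div_eq_mul_inv (_ : ℝ) X] at h ⊢
  rw [key _ (by positivity), mul_left_comm] at h
  exact mul_left_cancel₀ two_ne_zero h

theorem tsum_ite_dvd {d : ℕ} (hd : d ≠ 0) (f : ℕ → ℂ) :
    ∑' m : ℕ, (if d ∣ m then f m else 0) = ∑' h : ℕ, f (d * h) := by
  have hinj : Function.Injective fun h : ℕ => d * h := fun a b h => by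
    simpa [hd] using h
  rw [← hinj.tsum_eq]
  · simp
  · intro m hm
    by_cases h : d ∣ m
    · obtain ⟨k, rfl⟩ := h; exact ⟨k, rfl⟩
    · simp [h] at hm

theorem sum_divisors_moebius_ite {g : ℕ} (hg : g ≠ 0) (m : ℕ) :
    ∑ d ∈ g.divisors, (if d ∣ m then (ArithmeticFunction.moebius d : ℂ) else 0) =
      if m.Coprime g then 1 else 0 := by
  rw [← Finset.sum_filter]
  have h1 : g.divisors.filter (· ∣ m) = (m.gcd g).divisors := by
    ext d
    simp only [Finset.mem_filter, Nat.mem_divisors, Nat.dvd_gcd_iff]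
    constructor
    · rintro ⟨⟨h1, -⟩, h2⟩; exact ⟨⟨h2, h1⟩, Nat.gcd_ne_zero_right hg⟩
    · rintro ⟨⟨h1, h2⟩, -⟩; exact ⟨⟨h2, hg⟩, h1⟩
  rw [h1]
  have h2 := congrArg (fun f => f (m.gcd g)) ArithmeticFunction.coe_zeta_mul_moebius
  simp only [ArithmeticFunction.coe_zeta_mul_apply, ArithmeticFunction.one_apply] at h2
  by_cases hc : m.Coprime g
  · rw [if_pos hc]
    rw [if_pos hc] at h2
    exact_mod_cast h2
  · rw [if_neg hc]
    rw [if_neg hc] at h2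
    exact_mod_cast h2

theorem tsum_gauss_coprime {q : ℕ} (hq : Squarefree q) (h1 : q % 4 = 1) (hq1 : 1 < q) {g : ℕ}
    (hg : g ≠ 0) {M : ℝ} (hM : 0 < M) :
    ∑' m : ℕ, gaussWeight (m / M) * (jacobiChi q m * if m.Coprime g then 1 else 0) =
      ∑' m : ℕ, M / √(q : ℝ) * ∑ d ∈ g.divisors, (if d ∣ m then
        (ArithmeticFunction.moebius d / d : ℂ) * (gaussWeight (m * (M / (d ^ 2 * q))) *
          jacobiChi q m) else 0) := by
  have hq0 : (0 : ℝ) < q := by positivity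
  have hL : ∀ m : ℕ, gaussWeight (m / M) * (jacobiChi q m * if m.Coprime g then 1 else 0) =
      ∑ d ∈ g.divisors, if d ∣ m then
        (ArithmeticFunction.moebius d : ℂ) * (gaussWeight (m / M) * jacobiChi q m) else 0 := by
    intro m
    rw [← sum_divisors_moebius_ite hg, ← mul_assoc, Finset.mul_sum]
    refine Finset.sum_congr rfl fun d _ => ?_
    split_ifs <;> ring
  have hbound : ∀ c : ℝ, 0 < c → ∀ a : ℂ, ∀ d : ℕ, Summable fun m : ℕ => if d ∣ m then
        a * (gaussWeight (c * m) * jacobiChi q m) else 0 := by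
    intro c hc a d
    refine Summable.of_norm_bounded ((summable_gauss_nat hc).mul_left ‖a‖) fun m => ?_
    split_ifs
    · rw [norm_mul, norm_mul, norm_gaussWeight]
      exact mul_le_mul_of_nonneg_left (mul_le_of_le_one_right (Real.exp_pos _).le
        (norm_jacobiChi_le_one _ _)) (norm_nonneg _)
    · rw [norm_zero]; positivity
  simp_rw [hL]
  rw [tsum_mul_left, Summable.tsum_finsetSum, Summable.tsum_finsetSum, Finset.mul_sum]
  · refine Finset.sum_congr rfl fun d hd => ?_
    have hd0 : d ≠ 0 := (Nat.pos_of_mem_divisors hd).ne'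
    have hdR : (0 : ℝ) < d := by positivity
    rw [tsum_ite_dvd hd0, tsum_ite_dvd hd0, tsum_mul_left, tsum_mul_left]
    have h2 := tsum_jacobi_gauss hq h1 hq1 (X := M / d) (by positivity)
    have e1 : ∀ m : ℕ, gaussWeight ((d * m : ℕ) / M) * jacobiChi q (d * m) =
        jacobiChi q d * (gaussWeight (m / (M / d)) * jacobiChi q m) := by
      intro m
      rw [jacobiChi_mul, show ((d * m : ℕ) / M : ℝ) = m / (M / d) by push_cast; field_simp]
      ring
    have e2 : ∀ m : ℕ, gaussWeight ((d * m : ℕ) * (M / (d ^ 2 * q))) * jacobiChi q (d * m) =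
        jacobiChi q d * (gaussWeight (m * (M / d / q)) * jacobiChi q m) := by
      intro m
      rw [jacobiChi_mul, show ((d * m : ℕ) * (M / (d ^ 2 * q)) : ℝ) = m * (M / d / q) by
        push_cast; field_simp]
      ring
    simp_rw [e1, e2]
    rw [tsum_mul_left, tsum_mul_left, h2]
    push_cast
    ring
  · intro d hd
    have hd0 : (0 : ℝ) < d := by exact_mod_cast Nat.pos_of_mem_divisors hd
    have := hbound (M / (d ^ 2 * q)) (by positivity) (ArithmeticFunction.moebius d / d) d
    simpa only [mul_comm (M / _)] using this
  · intro d hd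
    have := hbound (M⁻¹) (by positivity) (ArithmeticFunction.moebius d) d
    simpa only [inv_mul_eq_div] using this

/-- Pairs `(K, s)` with `K` squarefree and `s` positive, parametrising the positive integers
as `K s²`. -/
def SquarefreePair : Type := {p : ℕ × ℕ // Squarefree p.1 ∧ 0 < p.2}

namespace SquarefreePair

/-- The squarefree component. -/
def kernel (p : SquarefreePair) : ℕ := p.1.1

/-- The root of the square component. -/
def root (p : SquarefreePair) : ℕ := p.1.2

/-- The integer `K s²` represented by a pair. -/
def value (p : SquarefreePair) : ℕ := p.kernel * p.root ^ 2

theorem squarefree_kernel (p : SquarefreePair) : Squarefree p.kernel := p.2.1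

theorem root_pos (p : SquarefreePair) : 0 < p.root := p.2.2

theorem value_injective : Function.Injective value := by
  have key : ∀ {K L s t : ℕ}, Squarefree K → Squarefree L → 0 < s → 0 < t →
      K * s ^ 2 = L * t ^ 2 → s ∣ t := by
    intro K L s t hK hL hs ht h
    have hst : 0 < s.gcd t := Nat.gcd_pos_of_pos_left _ hs
    obtain ⟨s', hs'⟩ := Nat.gcd_dvd_left s t
    obtain ⟨t', ht'⟩ := Nat.gcd_dvd_right s t
    have hcop : s'.Coprime t' := by
      have h3 := Nat.gcd_mul_left (s.gcd t) s' t'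
      rw [← hs', ← ht'] at h3
      exact Nat.eq_of_mul_eq_mul_left hst (by rw [mul_one]; exact h3.symm)
    generalize s.gcd t = u at *
    subst hs' ht'
    have h2 : K * s' ^ 2 = L * t' ^ 2 := by
      have : u ^ 2 * (K * s' ^ 2) = u ^ 2 * (L * t' ^ 2) := by linarith [h]
      exact Nat.eq_of_mul_eq_mul_left (by positivity) this
    have h4 : s' ^ 2 ∣ L := (hcop.pow 2 2).dvd_of_dvd_mul_right (h2 ▸ Dvd.intro_left K rfl)
    have h5 : IsUnit s' := hL s' (by rwa [← sq])
    rw [Nat.isUnit_iff] at h5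
    subst h5
    simp
  rintro ⟨⟨K, s⟩, hK, hs⟩ ⟨⟨L, t⟩, hL, ht⟩ h
  change K * s ^ 2 = L * t ^ 2 at h
  have : s = t := Nat.dvd_antisymm (key hK hL hs ht h) (key hL hK ht hs h.symm)
  subst this
  have : K = L := Nat.eq_of_mul_eq_mul_right (by positivity) h
  subst this
  rfl

theorem exists_value_eq {m : ℕ} (hm : m ≠ 0) : ∃ p : SquarefreePair, p.value = m := by
  obtain ⟨a, b, ha, hb, h, hs⟩ := Nat.sq_mul_squarefree_of_pos (Nat.pos_of_ne_zero hm)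
  exact ⟨⟨(a, b), hs, hb⟩, by rw [← h, mul_comm]; rfl⟩

theorem tsum_value {f : ℕ → ℂ} (h0 : f 0 = 0) : ∑' p : SquarefreePair, f p.value = ∑' m, f m := by
  refine value_injective.tsum_eq fun m hm => ?_
  exact exists_value_eq fun h => hm (h ▸ h0)

/-- Splitting off the pairs with small kernel. -/
theorem tsum_split {f : ℕ → ℂ} (h0 : f 0 = 0) (hf : Summable f) (k : ℕ) :
    ∑' m, f m = ∑' p : SquarefreePair, (if k < p.kernel then f p.value else 0) +
      ∑ K ∈ (Finset.range (k + 1)).filter Squarefree, ∑' s : ℕ, f (K * (s + 1) ^ 2) := by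
  have hs : Summable fun p : SquarefreePair => f p.value := hf.comp_injective value_injective
  have hind : ∀ P : SquarefreePair → Prop, ∀ _ : DecidablePred P,
      Summable fun p : SquarefreePair => if P p then f p.value else 0 := by
    intro P _
    refine (hs.indicator {p | P p}).congr fun p => ?_
    simp [Set.indicator]
  have h1 : ∀ p : SquarefreePair, f p.value = (if k < p.kernel then f p.value else 0) +
      ∑ K ∈ (Finset.range (k + 1)).filter Squarefree,
        (if p.kernel = K then f p.value else 0) := by
    intro p
    rw [Finset.sum_ite_eq]
    have := p.squarefree_kernel
    simp only [Finset.mem_filter, Finset.mem_range, this, and_true]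
    split_ifs <;> first | omega | simp
  rw [← tsum_value h0, tsum_congr h1, Summable.tsum_add (hind _ _)
    (summable_sum fun K _ => hind _ _), Summable.tsum_finsetSum fun K _ => hind _ _]
  congr 1
  refine Finset.sum_congr rfl fun K hK => ?_
  have hKs : Squarefree K := (Finset.mem_filter.mp hK).2
  let i : ℕ → SquarefreePair := fun s => ⟨(K, s + 1), hKs, Nat.succ_pos s⟩
  have hi : Function.Injective i := fun a b h => by
    have := congrArg root h
    simpa [i, root] using this
  rw [← hi.tsum_eq]
  · exact tsum_congr fun s => if_pos rfl
  · intro p hp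
    have hpK : p.kernel = K := by
      by_contra h
      simp [h] at hp
    refine ⟨p.root - 1, ?_⟩
    have := p.root_pos
    refine Subtype.ext (Prod.ext hpK.symm ?_)
    change p.root - 1 + 1 = p.root
    omega

end SquarefreePair

theorem sum_divisors_mul_of_coprime {m n : ℕ} (hmn : m.Coprime n) (f : ℕ → ℂ) :
    ∑ e ∈ (m * n).divisors, f e = ∑ a ∈ m.divisors, ∑ b ∈ n.divisors, f (a * b) := by
  rw [Nat.divisors_mul, Finset.mul_def, Finset.sum_image, Finset.sum_product]
  exact hmn.mul_injOn_divisors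

theorem tsum_nat_succ_eq {f : ℕ → ℂ} (h0 : f 0 = 0) : ∑' s : ℕ, f (s + 1) = ∑' s, f s := by
  refine (add_left_injective 1).tsum_eq (f := f) fun m hm => ?_
  have : m ≠ 0 := fun h => hm (h ▸ h0)
  exact ⟨m - 1, by simp; omega⟩

theorem tsum_ite_dvd_succ {d : ℕ} (hd : d ≠ 0) (f : ℕ → ℂ) :
    ∑' s : ℕ, (if d ∣ s + 1 then f (s + 1) else 0) = ∑' s : ℕ, f (d * (s + 1)) := by
  have h1 := tsum_nat_succ_eq (f := fun m => if m = 0 then 0 else if d ∣ m then f m else 0)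
    (by simp)
  have h2 := tsum_nat_succ_eq (f := fun m => if d * m = 0 then 0 else f (d * m)) (by simp)
  have h3 := tsum_ite_dvd hd (fun m => if m = 0 then 0 else f m)
  have h4 : ∀ m : ℕ, (if d ∣ m then (fun m => if m = 0 then 0 else f m) m else 0) =
    if m = 0 then 0 else if d ∣ m then f m else 0 := fun m => by split_ifs <;> simp_all
  simp_rw [h4] at h3
  rw [← h1, ← h2] at h3
  simpa [hd] using h3

/-- The sum of the Gaussian weight over positive squares. -/
noncomputable def squareGaussSum (x : ℝ) : ℂ := ∑' s : ℕ, gaussWeight (x * ((s : ℝ) + 1) ^ 2)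

theorem summable_exp_neg_mul_sq_sq {x : ℝ} (hx : 0 < x) :
    Summable fun s : ℕ => Real.exp (-Real.pi * (x * ((s : ℝ) + 1) ^ 2) ^ 2) := by
  have h := (summable_nat_add_iff 1).mpr (summable_gauss_nat hx)
  refine Summable.of_nonneg_of_le (fun _ => (Real.exp_pos _).le) (fun s => ?_) h
  refine Real.exp_le_exp.mpr ?_
  push_cast
  have h1 : (1 : ℝ) ≤ (s : ℝ) + 1 := by linarith [Nat.cast_nonneg (α := ℝ) s]
  have h2 : x * ((s : ℝ) + 1) ≤ x * ((s : ℝ) + 1) ^ 2 := by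
    gcongr; nlinarith
  have h3 : (x * ((s : ℝ) + 1)) ^ 2 ≤ (x * ((s : ℝ) + 1) ^ 2) ^ 2 := by gcongr
  nlinarith [Real.pi_pos]

theorem summable_gaussWeight_sq {x : ℝ} (hx : 0 < x) (f : ℕ → ℂ) (C : ℝ) (hf : ∀ s, ‖f s‖ ≤ C) :
    Summable fun s : ℕ => gaussWeight (x * ((s : ℝ) + 1) ^ 2) * f s := by
  refine Summable.of_norm_bounded ((summable_exp_neg_mul_sq_sq hx).mul_right C) fun s => ?_
  rw [norm_mul, norm_gaussWeight]
  exact mul_le_mul_of_nonneg_left (hf s) (Real.exp_pos _).le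

theorem tsum_gaussWeight_sq_coprime {n : ℕ} (hn : n ≠ 0) {x : ℝ} (hx : 0 < x) :
    ∑' s : ℕ, gaussWeight (x * ((s : ℝ) + 1) ^ 2) * (if (s + 1).Coprime n then 1 else 0) =
      ∑ e ∈ n.divisors, (ArithmeticFunction.moebius e : ℂ) * squareGaussSum (x * e ^ 2) := by
  have h1 : ∀ s : ℕ, gaussWeight (x * ((s : ℝ) + 1) ^ 2) *
      (if (s + 1).Coprime n then 1 else 0) = ∑ e ∈ n.divisors, if e ∣ s + 1 then
        (ArithmeticFunction.moebius e : ℂ) * gaussWeight (x * ((s + 1 : ℕ) : ℝ) ^ 2) else 0 := by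
    intro s
    rw [← sum_divisors_moebius_ite hn, Finset.mul_sum]
    refine Finset.sum_congr rfl fun e _ => ?_
    push_cast
    split_ifs <;> ring
  simp_rw [h1]
  rw [Summable.tsum_finsetSum]
  · refine Finset.sum_congr rfl fun e he => ?_
    rw [tsum_ite_dvd_succ (Nat.pos_of_mem_divisors he).ne'
      (fun m => (ArithmeticFunction.moebius e : ℂ) * gaussWeight (x * (m : ℝ) ^ 2)), tsum_mul_left,
      squareGaussSum]
    congr 1
    refine tsum_congr fun s => ?_
    congr 1
    push_cast
    ring
  · intro e _
    have := summable_gaussWeight_sq hx (fun s => if e ∣ s + 1 then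
      (ArithmeticFunction.moebius e : ℂ) else 0) ‖(ArithmeticFunction.moebius e : ℂ)‖
      (fun s => by split_ifs <;> simp)
    refine this.congr fun s => ?_
    push_cast
    split_ifs <;> ring

theorem sum_divisors_moebius_gcd {g : ℕ} (hg : Squarefree g) (K : ℕ) :
    ∑ d ∈ g.divisors, (ArithmeticFunction.moebius d : ℂ) * ((d.gcd K : ℂ) / d) =
      (if K.Coprime g then 1 else 0) *
        ∑ d ∈ g.divisors, (ArithmeticFunction.moebius d : ℂ) * (1 / d) := by
  split_ifs with h
  · rw [one_mul]
    refine Finset.sum_congr rfl fun d hd => ?_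
    have : d.gcd K = 1 := (Nat.Coprime.coprime_dvd_right (Nat.dvd_of_mem_divisors hd) h).symm
    rw [this, Nat.cast_one]
  · rw [zero_mul]
    obtain ⟨p, hp, hpK, hpg⟩ := Nat.Prime.not_coprime_iff_dvd.mp h
    let f : ArithmeticFunction ℂ := ⟨fun d => (d.gcd K : ℂ) / d, by simp⟩
    have hf : f.IsMultiplicative := by
      refine ArithmeticFunction.IsMultiplicative.iff_ne_zero.mpr ⟨by simp [f], ?_⟩
      intro m n hm hn hmn
      simp only [f, ArithmeticFunction.coe_mk]
      rw [Nat.gcd_comm, Nat.Coprime.gcd_mul K hmn, Nat.gcd_comm K m, Nat.gcd_comm K n]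
      push_cast
      rw [mul_div_mul_comm]
    have := ArithmeticFunction.IsMultiplicative.prodPrimeFactors_one_sub_of_squarefree f hf hg
    rw [show ∑ d ∈ g.divisors, (ArithmeticFunction.moebius d : ℂ) * ((d.gcd K : ℂ) / d) =
      ∑ d ∈ g.divisors, (ArithmeticFunction.moebius d : ℂ) * f d from rfl, ← this]
    refine Finset.prod_eq_zero (Nat.mem_primeFactors.mpr ⟨hp, hpg, hg.ne_zero⟩) ?_
    have hp0 : (p : ℂ) ≠ 0 := by exact_mod_cast hp.ne_zero
    simp [f, Nat.gcd_eq_left hpK, hp0]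

theorem tsum_orig_kernel {q g K : ℕ} (hq : q ≠ 0) (hg : g ≠ 0) (hK : K ≠ 0) {M : ℝ} (hM : 0 < M) :
    ∑' s : ℕ, gaussWeight ((K * (s + 1) ^ 2 : ℕ) / M) * (jacobiChi q (K * (s + 1) ^ 2) *
      if (K * (s + 1) ^ 2).Coprime g then 1 else 0) =
    jacobiChi q K * ((if K.Coprime g then 1 else 0) * ∑ e ∈ (g * q).divisors,
      (ArithmeticFunction.moebius e : ℂ) * squareGaussSum (K / M * e ^ 2)) := by
  have hKR : (0 : ℝ) < K := by positivity
  rw [← tsum_gaussWeight_sq_coprime (mul_ne_zero hg hq) (by positivity), ← mul_assoc,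
    ← tsum_mul_left]
  refine tsum_congr fun s => ?_
  rw [jacobiChi_mul, sq (s + 1), jacobiChi_mul, ← sq (jacobiChi q (s + 1)), jacobiChi_sq hq]
  have h1 : ((K * ((s + 1) * (s + 1)) : ℕ) / M : ℝ) = K / M * ((s : ℝ) + 1) ^ 2 := by
    push_cast; ring
  rw [h1]
  have h5 : (K * ((s + 1) * (s + 1))).Coprime g ↔ K.Coprime g ∧ (s + 1).Coprime g := by
    rw [Nat.coprime_mul_iff_left, Nat.coprime_mul_iff_left, and_self_iff]
  have h6 : (s + 1).Coprime (g * q) ↔ (s + 1).Coprime g ∧ (s + 1).Coprime q :=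
    Nat.coprime_mul_iff_right
  split_ifs <;> first | ring1 | (exfalso; tauto)

theorem squarefree_dvd_mul_sq_iff {d K s : ℕ} (hd : Squarefree d) :
    d ∣ K * s ^ 2 ↔ d / d.gcd K ∣ s := by
  have hd0 : 0 < d := Nat.pos_of_ne_zero hd.ne_zero
  have hg0 : 0 < d.gcd K := Nat.gcd_pos_of_pos_left _ hd0
  obtain ⟨r, hr⟩ := Nat.gcd_dvd_left d K
  obtain ⟨K', hK'⟩ := Nat.gcd_dvd_right d K
  have hdiv : d / d.gcd K = r := by
    exact Nat.div_eq_of_eq_mul_right hg0 hr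
  have hcop : r.Coprime K' := by
    have h3 := Nat.gcd_mul_left (d.gcd K) r K'
    rw [← hr, ← hK'] at h3
    exact Nat.eq_of_mul_eq_mul_left hg0 (by rw [mul_one]; exact h3.symm)
  have hrs : Squarefree r := hd.squarefree_of_dvd (Dvd.intro_left _ hr.symm)
  rw [hdiv]
  generalize d.gcd K = u at *
  subst hr hK'
  rw [mul_assoc, Nat.mul_dvd_mul_iff_left hg0, hcop.dvd_mul_left,
    hrs.dvd_pow_iff_dvd two_ne_zero]

theorem tsum_dual_kernel {q g K d : ℕ} (hq : q ≠ 0) (hg : Squarefree g) (hgq : g.Coprime q)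
    (hd : d ∣ g) (hK : K ≠ 0) {M : ℝ} (hM : 0 < M) :
    ∑' s : ℕ, (if d ∣ K * (s + 1) ^ 2 then gaussWeight ((K * (s + 1) ^ 2 : ℕ) *
      (M / (d ^ 2 * q))) * jacobiChi q (K * (s + 1) ^ 2) else 0) =
    jacobiChi q K * ∑ e ∈ q.divisors, (ArithmeticFunction.moebius e : ℂ) *
      squareGaussSum (K * M / ((d.gcd K : ℝ) ^ 2 * q) * e ^ 2) := by
  have hdsq : Squarefree d := hg.squarefree_of_dvd hd
  have hd0 : d ≠ 0 := hdsq.ne_zero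
  have hKR : (0 : ℝ) < K := by positivity
  have hqR : (0 : ℝ) < q := by positivity
  have hdR : (0 : ℝ) < d := by positivity
  have hg0 : 0 < d.gcd K := Nat.gcd_pos_of_pos_left _ (Nat.pos_of_ne_zero hd0)
  have hgR : (0 : ℝ) < (d.gcd K : ℝ) := by exact_mod_cast hg0
  have hr0 : d / d.gcd K ≠ 0 :=
    (Nat.div_pos (Nat.le_of_dvd (Nat.pos_of_ne_zero hd0) (Nat.gcd_dvd_left _ _)) hg0).ne'
  have hrR : ((d / d.gcd K : ℕ) : ℝ) = d / d.gcd K :=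
    Nat.cast_div (Nat.gcd_dvd_left _ _) hgR.ne'
  have hrq : (d / d.gcd K).Coprime q :=
    (hgq.coprime_dvd_left hd).coprime_dvd_left (Nat.div_dvd_of_dvd (Nat.gcd_dvd_left _ _))
  simp_rw [squarefree_dvd_mul_sq_iff hdsq]
  rw [tsum_ite_dvd_succ hr0 (fun s => gaussWeight ((K * s ^ 2 : ℕ) *
      (M / (d ^ 2 * q))) * jacobiChi q (K * s ^ 2)),
    ← tsum_gaussWeight_sq_coprime hq (by positivity), ← tsum_mul_left]
  refine tsum_congr fun s => ?_
  rw [jacobiChi_mul, sq (_ * (s + 1)), jacobiChi_mul, ← sq (jacobiChi q _), jacobiChi_sq hq]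
  have h1 : ((K * (d / d.gcd K * (s + 1) * (d / d.gcd K * (s + 1))) : ℕ) : ℝ) *
      (M / (d ^ 2 * q)) = K * M / ((d.gcd K : ℝ) ^ 2 * q) * ((s : ℝ) + 1) ^ 2 := by
    push_cast [hrR]
    field_simp
  rw [h1]
  have h2 : (d / d.gcd K * (s + 1)).Coprime q ↔ (s + 1).Coprime q := by
    rw [Nat.coprime_mul_iff_left, and_iff_right hrq]
  split_ifs <;> first | ring1 | (exfalso; tauto)

/-- The error term in the comparison of `squareGaussSum` with its main term `c x ^ (-1/2)`. -/
noncomputable def squareGaussError (c : ℂ) (x : ℝ) : ℂ := squareGaussSum x - c / √x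

theorem sum_moebius_main_term {n : ℕ} (c : ℂ) {x : ℝ} (hx : 0 < x) :
    ∑ e ∈ n.divisors, (ArithmeticFunction.moebius e : ℂ) * squareGaussSum (x * e ^ 2) =
      ∑ e ∈ n.divisors, (ArithmeticFunction.moebius e : ℂ) * squareGaussError c (x * e ^ 2) +
      c / √x * ∑ e ∈ n.divisors, (ArithmeticFunction.moebius e : ℂ) * (1 / e) := by
  rw [Finset.mul_sum, ← Finset.sum_add_distrib]
  refine Finset.sum_congr rfl fun e _ => ?_
  rw [squareGaussError, Real.sqrt_mul hx.le, Real.sqrt_sq (Nat.cast_nonneg e)]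
  push_cast
  rw [← div_div]
  ring

/-- The pointwise identity behind the quadratic large sieve: sums over large kernels are dual to
sums over large kernels, up to error terms from the small kernels. -/
theorem orig_eq_dual {q g : ℕ} (hq : Squarefree q) (h1 : q % 4 = 1) (hq1 : 1 < q)
    (hg : Squarefree g) (hgq : g.Coprime q) {M : ℝ} (hM : 0 < M) (k : ℕ) (c : ℂ) :
    ∑' p : SquarefreePair, (if k < p.kernel then gaussWeight (p.value / M) *
        (jacobiChi q p.value * if p.value.Coprime g then 1 else 0) else 0) =
    ∑' p : SquarefreePair, (if k < p.kernel then M / √(q : ℝ) * ∑ d ∈ g.divisors,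
        (if d ∣ p.value then (ArithmeticFunction.moebius d / d : ℂ) *
        (gaussWeight (p.value * (M / (d ^ 2 * q))) * jacobiChi q p.value) else 0) else 0) +
    ∑ K ∈ (Finset.range (k + 1)).filter Squarefree, jacobiChi q K *
      (M / √(q : ℝ) * ∑ d ∈ g.divisors, (ArithmeticFunction.moebius d / d : ℂ) *
        ∑ e ∈ q.divisors, (ArithmeticFunction.moebius e : ℂ) *
          squareGaussError c (K * M / ((d.gcd K : ℝ) ^ 2 * q) * e ^ 2) -
      (if K.Coprime g then 1 else 0) * ∑ e ∈ (g * q).divisors,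
        (ArithmeticFunction.moebius e : ℂ) * squareGaussError c (K / M * e ^ 2)) := by
  have hq0 : q ≠ 0 := hq.ne_zero
  have hg0 : g ≠ 0 := hg.ne_zero
  have hqR : (0 : ℝ) < q := by positivity
  have hP := tsum_gauss_coprime hq h1 hq1 hg0 hM
  have hs1 : Summable fun m : ℕ => gaussWeight (m / M) *
      (jacobiChi q m * if m.Coprime g then 1 else 0) := by
    have := summable_gaussWeight_mul (inv_pos.mpr hM)
      (f := fun m => jacobiChi q m * if m.Coprime g then 1 else 0) (fun m => by
        have := norm_jacobiChi_le_one q m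
        split_ifs <;> simp [this])
    simpa only [inv_mul_eq_div] using this
  have hs2' : ∀ d ∈ g.divisors, Summable fun m : ℕ => (if d ∣ m then
        (ArithmeticFunction.moebius d / d : ℂ) * (gaussWeight (m * (M / (d ^ 2 * q))) *
          jacobiChi q m) else 0) := by
    intro d hd
    have hd0 : (0 : ℝ) < d := by exact_mod_cast Nat.pos_of_mem_divisors hd
    have := (summable_gaussWeight_mul (by positivity : 0 < M / (d ^ 2 * q))
      (f := fun m => if d ∣ m then jacobiChi q m else 0) (fun m => by
        have := norm_jacobiChi_le_one q m
        split_ifs <;> simp [this])).mul_left (ArithmeticFunction.moebius d / d : ℂ)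
    refine this.congr fun m => ?_
    rw [mul_comm (m : ℝ)]
    split_ifs <;> simp
  have hs2 : Summable fun m : ℕ => M / √(q : ℝ) * ∑ d ∈ g.divisors, (if d ∣ m then
        (ArithmeticFunction.moebius d / d : ℂ) * (gaussWeight (m * (M / (d ^ 2 * q))) *
          jacobiChi q m) else 0) :=
    (summable_sum hs2').mul_left _
  rw [SquarefreePair.tsum_split (by simp [jacobiChi_zero hq1]) hs1 k,
    SquarefreePair.tsum_split (by simp [jacobiChi_zero hq1]) hs2 k] at hP
  have hK1 : ∀ K ∈ (Finset.range (k + 1)).filter Squarefree,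
      (∑' s : ℕ, M / √(q : ℝ) * ∑ d ∈ g.divisors, (if d ∣ K * (s + 1) ^ 2 then
        (ArithmeticFunction.moebius d / d : ℂ) * (gaussWeight ((K * (s + 1) ^ 2 : ℕ) *
          (M / (d ^ 2 * q))) * jacobiChi q (K * (s + 1) ^ 2)) else 0)) -
      ∑' s : ℕ, gaussWeight ((K * (s + 1) ^ 2 : ℕ) / M) * (jacobiChi q (K * (s + 1) ^ 2) *
        if (K * (s + 1) ^ 2).Coprime g then 1 else 0) =
      jacobiChi q K * (M / √(q : ℝ) * ∑ d ∈ g.divisors, (ArithmeticFunction.moebius d / d : ℂ) *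
        ∑ e ∈ q.divisors, (ArithmeticFunction.moebius e : ℂ) *
          squareGaussError c (K * M / ((d.gcd K : ℝ) ^ 2 * q) * e ^ 2) -
      (if K.Coprime g then 1 else 0) * ∑ e ∈ (g * q).divisors,
        (ArithmeticFunction.moebius e : ℂ) * squareGaussError c (K / M * e ^ 2)) := by
    intro K hK
    have hKs : Squarefree K := (Finset.mem_filter.mp hK).2
    have hK0 : K ≠ 0 := hKs.ne_zero
    have hKR : (0 : ℝ) < K := by positivity
    rw [tsum_orig_kernel hq0 hg0 hK0 hM, tsum_mul_left, Summable.tsum_finsetSum]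
    swap
    · intro d hd
      exact (hs2' d hd).comp_injective (i := fun s : ℕ => K * (s + 1) ^ 2) fun a b hab => by
        simpa [hK0] using hab
    have hdual : ∀ d ∈ g.divisors, (∑' s : ℕ, if d ∣ K * (s + 1) ^ 2 then
        (ArithmeticFunction.moebius d / d : ℂ) * (gaussWeight ((K * (s + 1) ^ 2 : ℕ) *
          (M / (d ^ 2 * q))) * jacobiChi q (K * (s + 1) ^ 2)) else 0) =
        jacobiChi q K * ((ArithmeticFunction.moebius d / d : ℂ) *
          ∑ e ∈ q.divisors, (ArithmeticFunction.moebius e : ℂ) *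
            squareGaussError c (K * M / ((d.gcd K : ℝ) ^ 2 * q) * e ^ 2)) +
        (ArithmeticFunction.moebius d : ℂ) * ((d.gcd K : ℂ) / d) *
          (jacobiChi q K * (c * √(q : ℝ) / (√(K : ℝ) * √M) *
            ∑ e ∈ q.divisors, (ArithmeticFunction.moebius e : ℂ) * (1 / e))) := by
      intro d hd
      have hd0 : 0 < d := Nat.pos_of_mem_divisors hd
      have hgc : (0 : ℝ) < (d.gcd K : ℝ) := by exact_mod_cast Nat.gcd_pos_of_pos_left _ hd0
      have := tsum_dual_kernel hq0 hg hgq (Nat.dvd_of_mem_divisors hd) hK0 hM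
      rw [sum_moebius_main_term c (by positivity)] at this
      have hsq : √(K * M / ((d.gcd K : ℝ) ^ 2 * q)) = √(K : ℝ) * √M / (d.gcd K * √(q : ℝ)) := by
        rw [Real.sqrt_div (by positivity), Real.sqrt_mul (by positivity),
          Real.sqrt_mul (by positivity), Real.sqrt_sq hgc.le]
      rw [hsq] at this
      calc _ = (ArithmeticFunction.moebius d / d : ℂ) * ∑' s : ℕ, (if d ∣ K * (s + 1) ^ 2 then
            gaussWeight ((K * (s + 1) ^ 2 : ℕ) * (M / (d ^ 2 * q))) *
              jacobiChi q (K * (s + 1) ^ 2) else 0) := by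
            rw [← tsum_mul_left]
            exact tsum_congr fun s => by split_ifs <;> ring
        _ = _ := by
            rw [this]
            push_cast
            have h3 : ((d.gcd K : ℕ) : ℂ) ≠ 0 := by exact_mod_cast hgc.ne'
            rw [div_div_eq_mul_div]
            ring
    rw [Finset.sum_congr rfl hdual, Finset.sum_add_distrib, ← Finset.mul_sum, ← Finset.sum_mul,
      sum_divisors_moebius_gcd hg K, sum_moebius_main_term c (by positivity),
      sum_divisors_mul_of_coprime hgq (fun e => (ArithmeticFunction.moebius e : ℂ) * (1 / e))]
    have hmul : ∑ a ∈ g.divisors, ∑ b ∈ q.divisors,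
        (ArithmeticFunction.moebius (a * b) : ℂ) * (1 / (a * b : ℕ)) =
        (∑ a ∈ g.divisors, (ArithmeticFunction.moebius a : ℂ) * (1 / a)) *
          ∑ b ∈ q.divisors, (ArithmeticFunction.moebius b : ℂ) * (1 / b) := by
      rw [Finset.sum_mul_sum]
      refine Finset.sum_congr rfl fun a ha => Finset.sum_congr rfl fun b hb => ?_
      have hab : a.Coprime b := (hgq.coprime_dvd_left (Nat.dvd_of_mem_divisors ha)).coprime_dvd_right
        (Nat.dvd_of_mem_divisors hb)
      rw [ArithmeticFunction.isMultiplicative_moebius.map_mul_of_coprime hab]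
      push_cast
      rw [one_div, mul_inv, one_div, one_div]
      ring
    rw [hmul, Real.sqrt_div (by positivity)]
    have h4 : (√(q : ℝ) : ℂ) ≠ 0 := by exact_mod_cast (Real.sqrt_pos.mpr hqR).ne'
    have h5 : (√M : ℂ) ≠ 0 := by exact_mod_cast (Real.sqrt_pos.mpr hM).ne'
    have h6 : (√(K : ℝ) : ℂ) ≠ 0 := by exact_mod_cast (Real.sqrt_pos.mpr hKR).ne'
    have h7 : (M : ℂ) = √M * √M := by exact_mod_cast (Real.mul_self_sqrt hM.le).symm
    have h8 : (M : ℂ) / √(q : ℝ) * (c * √(q : ℝ) / (√(K : ℝ) * √M)) =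
        c / ((√(K : ℝ) / √M : ℝ) : ℂ) := by
      rw [h7]
      push_cast
      field_simp
    linear_combination ((if K.Coprime g then 1 else 0) * jacobiChi q K *
      (∑ a ∈ g.divisors, (ArithmeticFunction.moebius a : ℂ) * (1 / a)) *
      ∑ b ∈ q.divisors, (ArithmeticFunction.moebius b : ℂ) * (1 / b)) * h8
  rw [← Finset.sum_congr rfl hK1, Finset.sum_sub_distrib]
  linear_combination hP

/-- A multiplicative function on the positive reals of absolute value `x ^ (-σ)`. -/
structure IsQuasiChar (σ : ℝ) (ψ : ℝ → ℂ) : Prop where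
  map_mul : ∀ x y : ℝ, 0 < x → 0 < y → ψ (x * y) = ψ x * ψ y
  norm_eq : ∀ x : ℝ, 0 < x → ‖ψ x‖ = x ^ (-σ)

/-- A function `f` on the positive reals separates variables with exponent `σ` and constant `C` when
every bound for finite sums against quasi-characters of exponent `σ` transfers to `f`. -/
def SeparatesVars (f : ℝ → ℂ) (σ C : ℝ) : Prop :=
  ∀ (ι : Type) (s : Finset ι) (c : ι → ℂ) (x : ι → ℝ) (B : ℝ), (∀ i ∈ s, 0 < x i) →
    (∀ ψ, IsQuasiChar σ ψ → ‖∑ i ∈ s, c i * ψ (x i)‖ ≤ B) → ‖∑ i ∈ s, c i * f (x i)‖ ≤ C * B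

theorem isQuasiChar_cpow (σ τ : ℝ) :
    IsQuasiChar σ fun x => (x : ℂ) ^ (-(σ + τ * Complex.I) : ℂ) where
  map_mul x y hx hy := by
    push_cast
    exact Complex.mul_cpow_ofReal_nonneg hx.le hy.le _
  norm_eq x hx := by
    rw [Complex.norm_cpow_eq_rpow_re_of_pos hx]
    simp

theorem IsQuasiChar.comp_sq {σ : ℝ} {ψ : ℝ → ℂ} (h : IsQuasiChar σ ψ) :
    IsQuasiChar (2 * σ) fun x => ψ (x ^ 2) where
  map_mul x y hx hy := by
    rw [mul_pow, h.map_mul _ _ (by positivity) (by positivity)]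
  norm_eq x hx := by
    rw [h.norm_eq _ (by positivity), ← Real.rpow_natCast, ← Real.rpow_mul hx.le]
    congr 1
    push_cast
    ring

namespace SeparatesVars

variable {f : ℝ → ℂ} {σ C : ℝ}

theorem comp_sq (h : SeparatesVars f σ C) : SeparatesVars (fun x => f (x ^ 2)) (2 * σ) C := by
  intro ι s c x B hx hB
  exact h ι s c (fun i => x i ^ 2) B (fun i hi => pow_pos (hx i hi) 2)
    fun ψ hψ => hB _ hψ.comp_sq

theorem comp_mul (h : SeparatesVars f σ C) {a : ℝ} (ha : 0 < a) :
    SeparatesVars (fun x => f (a * x)) σ (C * a ^ (-σ)) := by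
  intro ι s c x B hx hB
  rw [mul_assoc]
  refine h ι s c (fun i => a * x i) _ (fun i hi => mul_pos ha (hx i hi)) fun ψ hψ => ?_
  have : ∑ i ∈ s, c i * ψ (a * x i) = ψ a * ∑ i ∈ s, c i * ψ (x i) := by
    rw [Finset.mul_sum]
    refine Finset.sum_congr rfl fun i hi => ?_
    rw [hψ.map_mul _ _ ha (hx i hi)]
    ring
  rw [this, norm_mul, hψ.norm_eq a ha]
  exact mul_le_mul_of_nonneg_left (hB ψ hψ) (Real.rpow_nonneg ha.le _)

theorem const_mul (h : SeparatesVars f σ C) (a : ℂ) :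
    SeparatesVars (fun x => a * f x) σ (‖a‖ * C) := by
  intro ι s c x B hx hB
  have : ∑ i ∈ s, c i * (a * f (x i)) = a * ∑ i ∈ s, c i * f (x i) := by
    rw [Finset.mul_sum]
    exact Finset.sum_congr rfl fun i _ => by ring
  rw [this, norm_mul, mul_assoc]
  exact mul_le_mul_of_nonneg_left (h ι s c x B hx hB) (norm_nonneg _)

theorem bound_nonneg {ι : Type} {s : Finset ι} {c : ι → ℂ} {x : ι → ℝ} {B : ℝ}
    (hB : ∀ ψ, IsQuasiChar σ ψ → ‖∑ i ∈ s, c i * ψ (x i)‖ ≤ B) : 0 ≤ B :=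
  (norm_nonneg _).trans (hB _ (isQuasiChar_cpow σ 0))

theorem mono (h : SeparatesVars f σ C) {C' : ℝ} (hC : C ≤ C') : SeparatesVars f σ C' :=
  fun ι s c x B hx hB =>
    (h ι s c x B hx hB).trans (mul_le_mul_of_nonneg_right hC (bound_nonneg hB))

theorem congr (h : SeparatesVars f σ C) {g : ℝ → ℂ} (hfg : ∀ x, 0 < x → f x = g x) :
    SeparatesVars g σ C := by
  intro ι s c x B hx hB
  have : ∑ i ∈ s, c i * g (x i) = ∑ i ∈ s, c i * f (x i) :=
    Finset.sum_congr rfl fun i hi => by rw [hfg _ (hx i hi)]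
  rw [this]
  exact h ι s c x B hx hB

theorem sum {κ : Type*} (t : Finset κ) {f : κ → ℝ → ℂ} {C : κ → ℝ}
    (h : ∀ k ∈ t, SeparatesVars (f k) σ (C k)) :
    SeparatesVars (fun x => ∑ k ∈ t, f k x) σ (∑ k ∈ t, C k) := by
  intro ι s c x B hx hB
  simp_rw [Finset.mul_sum]
  rw [Finset.sum_comm, Finset.sum_mul]
  exact norm_sum_le_of_le _ fun k hk => h k hk ι s c x B hx hB

theorem of_tendsto {f : ℕ → ℝ → ℂ} {g : ℝ → ℂ} (h : ∀ n, SeparatesVars (f n) σ C)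
    (hg : ∀ x, 0 < x → Filter.Tendsto (fun n => f n x) Filter.atTop (nhds (g x))) :
    SeparatesVars g σ C := by
  intro ι s c x B hx hB
  have : Filter.Tendsto (fun n => ∑ i ∈ s, c i * f n (x i)) Filter.atTop
      (nhds (∑ i ∈ s, c i * g (x i))) :=
    tendsto_finsetSum _ fun i hi => (hg _ (hx i hi)).const_mul _
  exact le_of_tendsto this.norm (Filter.Eventually.of_forall fun n => h n ι s c x B hx hB)

theorem of_intervalIntegral {F : ℝ → ℝ → ℂ} {D : ℝ → ℝ} {a b : ℝ} (hab : a ≤ b)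
    (h : ∀ u ∈ Set.Ioc a b, SeparatesVars (F u) σ (D u))
    (hD : IntervalIntegrable D MeasureTheory.volume a b)
    (hF : ∀ x, 0 < x → IntervalIntegrable (fun u => F u x) MeasureTheory.volume a b) :
    SeparatesVars (fun x => ∫ u in a..b, F u x) σ (∫ u in a..b, D u) := by
  intro ι s c x B hx hB
  have h1 : ∑ i ∈ s, c i * ∫ u in a..b, F u (x i) = ∫ u in a..b, ∑ i ∈ s, c i * F u (x i) := by
    rw [intervalIntegral.integral_finsetSum]
    · exact Finset.sum_congr rfl fun i _ => (intervalIntegral.integral_const_mul _ _).symm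
    · exact fun i hi => (hF _ (hx i hi)).const_mul _
  rw [h1, ← intervalIntegral.integral_mul_const]
  refine intervalIntegral.norm_integral_le_of_norm_le hab ?_ (hD.mul_const B)
  exact Filter.Eventually.of_forall fun u hu => h u hu ι s c x B hx hB

end SeparatesVars

theorem norm_Gamma_le_Gamma_re {s : ℂ} (hs : 0 < s.re) : ‖Complex.Gamma s‖ ≤ Real.Gamma s.re := by
  rw [Complex.Gamma_eq_integral hs, Real.Gamma_eq_integral hs, Complex.GammaIntegral]
  refine MeasureTheory.norm_integral_le_of_norm_le (Real.GammaIntegral_convergent hs) ?_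
  refine (MeasureTheory.ae_restrict_iff' measurableSet_Ioi).mpr (Filter.Eventually.of_forall ?_)
  intro x hx
  rw [norm_mul, Complex.norm_cpow_eq_rpow_re_of_pos hx, Complex.norm_real, Real.norm_eq_abs,
    abs_of_pos (Real.exp_pos _)]
  simp

theorem verticalIntegrable_Gamma {σ : ℝ} (hσ : 0 < σ) :
    Complex.VerticalIntegrable Complex.Gamma σ := by
  have hcont : Continuous fun y : ℝ => Complex.Gamma (σ + y * Complex.I) := by
    refine continuous_iff_continuousAt.mpr fun y => ?_
    refine ContinuousAt.comp (g := Complex.Gamma) (f := fun y : ℝ => (σ + y * Complex.I : ℂ)) ?_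
      (by fun_prop)
    refine (Complex.differentiableAt_Gamma _ fun m h => ?_).continuousAt
    have := congrArg Complex.re h
    simp at this
    have := Nat.cast_nonneg (α := ℝ) m
    linarith
  refine (integrable_inv_one_add_sq.const_mul (Real.Gamma (σ + 2) / min (σ ^ 2) 1)).mono'
    hcont.aestronglyMeasurable (Filter.Eventually.of_forall fun y => ?_)
  set s : ℂ := σ + y * Complex.I with hs
  have hre : s.re = σ := by simp [hs]
  have him : s.im = y := by simp [hs]
  have hs0 : s ≠ 0 := fun h => by rw [h] at hre; simp at hre; linarith
  have hs1 : s + 1 ≠ 0 := fun h => by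
    have := congrArg Complex.re h; simp [hre] at this; linarith
  have h2 : Complex.Gamma (s + 2) = (s + 1) * s * Complex.Gamma s := by
    rw [show s + 2 = (s + 1) + 1 by ring, Complex.Gamma_add_one _ hs1, Complex.Gamma_add_one _ hs0]
    ring
  have h3 : ‖Complex.Gamma (s + 2)‖ ≤ Real.Gamma (σ + 2) := by
    have := norm_Gamma_le_Gamma_re (s := s + 2) (by simp [hre]; linarith)
    simpa [hre] using this
  have h4 : min (σ ^ 2) 1 * (1 + y ^ 2) ≤ ‖(s + 1) * s‖ := by
    have h5 : ‖s‖ ^ 2 = σ ^ 2 + y ^ 2 := by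
      rw [← Complex.normSq_eq_norm_sq, Complex.normSq_apply, hre, him]; ring
    have h6 : ‖s + 1‖ ^ 2 = (σ + 1) ^ 2 + y ^ 2 := by
      rw [← Complex.normSq_eq_norm_sq, Complex.normSq_apply]; simp [hre, him]; ring
    have h7 : ‖s‖ ≤ ‖s + 1‖ := by
      refine (sq_le_sq₀ (norm_nonneg _) (norm_nonneg _)).mp ?_
      rw [h5, h6]; nlinarith
    rw [norm_mul]
    have h8 : ‖s‖ ^ 2 ≤ ‖s + 1‖ * ‖s‖ := by
      rw [sq]; exact mul_le_mul_of_nonneg_right h7 (norm_nonneg _)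
    rw [h5] at h8
    nlinarith [min_le_left (σ ^ 2) 1, min_le_right (σ ^ 2) 1, sq_nonneg y]
  have hm : 0 < min (σ ^ 2) 1 := lt_min (by positivity) one_pos
  have hy : 0 < 1 + y ^ 2 := by positivity
  rw [h2, norm_mul] at h3
  rw [← div_eq_mul_inv, div_div, le_div_iff₀ (by positivity), mul_comm]
  exact (mul_le_mul_of_nonneg_right h4 (norm_nonneg _)).trans h3

theorem exists_separatesVars_pow_mul_exp (k : ℕ) {σ : ℝ} (hσ : 0 < σ) :
    ∃ C, 0 ≤ C ∧ SeparatesVars (fun t => (t : ℂ) ^ k * ((Real.exp (-t) : ℝ) : ℂ)) σ C := by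
  let f : ℝ → ℂ := fun t => (t : ℂ) ^ k * ((Real.exp (-t) : ℝ) : ℂ)
  have hpow : ∀ t ∈ Set.Ioi (0 : ℝ), ∀ s : ℂ, (t : ℂ) ^ (s - 1) * f t =
      ((Real.exp (-t) : ℝ) : ℂ) * (t : ℂ) ^ (s + k - 1) := by
    intro t ht s
    have ht0 : (t : ℂ) ≠ 0 := by exact_mod_cast (ne_of_gt ht)
    rw [show s + k - 1 = (s - 1) + k by ring, Complex.cpow_add _ _ ht0, Complex.cpow_natCast]
    simp only [f]
    ring
  have hmel : ∀ s : ℂ, 0 < s.re → mellin f s = Complex.Gamma (s + k) := by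
    intro s hs
    rw [Complex.Gamma_eq_integral (by simp; positivity), Complex.GammaIntegral, mellin]
    refine MeasureTheory.setIntegral_congr_fun measurableSet_Ioi fun t ht => ?_
    simp only [smul_eq_mul]
    exact hpow t ht s
  have hconv : MellinConvergent f σ := by
    refine (Complex.GammaIntegral_convergent (s := σ + k) (by simp; positivity)).congr_fun
      (fun t ht => ?_) measurableSet_Ioi
    simp only [smul_eq_mul]
    exact (hpow t ht σ).symm
  have hG := verticalIntegrable_Gamma (σ := σ + k) (by positivity)
  have hG' : MeasureTheory.Integrable fun y : ℝ => Complex.Gamma (σ + y * Complex.I + k) := by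
    refine MeasureTheory.Integrable.congr hG (Filter.Eventually.of_forall fun y => ?_)
    simp only []
    push_cast
    ring_nf
  have hmel' : ∀ y : ℝ, mellin f (σ + y * Complex.I) = Complex.Gamma (σ + y * Complex.I + k) :=
    fun y => hmel _ (by simp [hσ])
  have hvert : Complex.VerticalIntegrable (mellin f) σ := by
    unfold Complex.VerticalIntegrable
    simp_rw [hmel']
    exact hG'
  refine ⟨1 / (2 * Real.pi) * ∫ y : ℝ, ‖Complex.Gamma (σ + y * Complex.I + k)‖, by positivity, ?_⟩
  intro ι s c x B hx hB
  have hinv : ∀ i ∈ s, f (x i) = 1 / (2 * Real.pi) * ∫ y : ℝ,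
      (x i : ℂ) ^ (-(σ + y * Complex.I) : ℂ) * Complex.Gamma (σ + y * Complex.I + k) := by
    intro i hi
    have := mellinInv_mellin_eq σ f (hx i hi) hconv hvert (by fun_prop)
    rw [← this, mellinInv]
    simp only [smul_eq_mul, hmel']
    simp
  have hint : ∀ i ∈ s, MeasureTheory.Integrable fun y : ℝ => c i * ((x i : ℂ) ^
      (-(σ + y * Complex.I) : ℂ) * Complex.Gamma (σ + y * Complex.I + k)) := by
    intro i hi
    have hx0 : (x i : ℂ) ≠ 0 := by exact_mod_cast (hx i hi).ne'
    refine (hG'.bdd_mul (c := x i ^ (-σ)) (Continuous.aestronglyMeasurable ?_)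
      (Filter.Eventually.of_forall fun y => ?_)).const_mul _
    · exact Continuous.const_cpow (by fun_prop) (Or.inl hx0)
    · exact ((isQuasiChar_cpow σ y).norm_eq _ (hx i hi)).le
  have hsum : ∑ i ∈ s, c i * f (x i) = 1 / (2 * Real.pi) * ∫ y : ℝ,
      (∑ i ∈ s, c i * (x i : ℂ) ^ (-(σ + y * Complex.I) : ℂ)) *
        Complex.Gamma (σ + y * Complex.I + k) := by
    simp_rw [Finset.sum_mul, mul_assoc (c _)]
    rw [MeasureTheory.integral_finsetSum _ hint, Finset.mul_sum]
    refine Finset.sum_congr rfl fun i hi => ?_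
    rw [hinv i hi, MeasureTheory.integral_const_mul]
    ring
  change ‖∑ i ∈ s, c i * f (x i)‖ ≤ _
  rw [hsum, norm_mul, mul_assoc, ← MeasureTheory.integral_mul_const]
  have hpi : ‖(1 / (2 * Real.pi) : ℂ)‖ = 1 / (2 * Real.pi) := by
    simp [abs_of_pos Real.pi_pos]
  rw [hpi]
  refine mul_le_mul_of_nonneg_left ?_ (by positivity)
  refine MeasureTheory.norm_integral_le_of_norm_le (hG'.norm.mul_const B)
    (Filter.Eventually.of_forall fun y => ?_)
  rw [norm_mul, mul_comm]
  exact mul_le_mul_of_nonneg_left (hB _ (isQuasiChar_cpow σ y)) (norm_nonneg _)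

theorem exists_separatesVars_gaussWeight {σ : ℝ} (hσ : 0 < σ) :
    ∃ C, 0 ≤ C ∧ SeparatesVars gaussWeight σ C := by
  obtain ⟨C, hC0, hC⟩ := exists_separatesVars_pow_mul_exp 0 (half_pos hσ)
  have h := (hC.comp_mul Real.pi_pos).comp_sq
  rw [mul_div_cancel₀ σ two_ne_zero] at h
  refine ⟨_, mul_nonneg hC0 (Real.rpow_nonneg Real.pi_pos.le _), h.congr fun x _ => ?_⟩
  simp only [gaussWeight, pow_zero, one_mul, neg_mul]

/-- A multiple of the logarithmic derivative of the Gaussian weight. -/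
noncomputable def gaussWeightLogDeriv (x : ℝ) : ℂ :=
  ((Real.pi * x ^ 2 * Real.exp (-Real.pi * x ^ 2) : ℝ) : ℂ)

theorem exists_separatesVars_gaussWeightLogDeriv {σ : ℝ} (hσ : 0 < σ) :
    ∃ C, 0 ≤ C ∧ SeparatesVars gaussWeightLogDeriv σ C := by
  obtain ⟨C, hC0, hC⟩ := exists_separatesVars_pow_mul_exp 1 (half_pos hσ)
  have h := (hC.comp_mul Real.pi_pos).comp_sq
  rw [mul_div_cancel₀ σ two_ne_zero] at h
  refine ⟨_, mul_nonneg hC0 (Real.rpow_nonneg Real.pi_pos.le _), h.congr fun x _ => ?_⟩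
  simp only [gaussWeightLogDeriv, pow_one, neg_mul]
  push_cast
  ring

theorem continuous_gaussWeight : Continuous gaussWeight := by
  unfold gaussWeight
  fun_prop

/-- The constant in the main term of `squareGaussSum`. -/
noncomputable def squareGaussConst : ℂ := ∫ u in Set.Ioi (0 : ℝ), gaussWeight (u ^ 2)

theorem hasDerivAt_gaussWeight_mul_sq (x u : ℝ) :
    HasDerivAt (fun u : ℝ => gaussWeight (x * u ^ 2))
      ((-4 * Real.pi * x ^ 2 * u ^ 3 * Real.exp (-Real.pi * (x * u ^ 2) ^ 2) : ℝ) : ℂ) u := by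
  unfold gaussWeight
  refine HasDerivAt.ofReal_comp ?_
  have h := (((((hasDerivAt_id u).pow 2).const_mul x).pow 2).const_mul (-Real.pi)).exp
  refine h.congr_deriv ?_
  simp
  ring

theorem gaussWeight_sub_integral (s x : ℝ) :
    gaussWeight (x * (s + 1) ^ 2) - ∫ u in s..(s + 1), gaussWeight (x * u ^ 2) =
      ∫ u in s..(s + 1), ((u - s : ℝ) : ℂ) *
        ((-4 * Real.pi * x ^ 2 * u ^ 3 * Real.exp (-Real.pi * (x * u ^ 2) ^ 2) : ℝ) : ℂ) := by
  rw [intervalIntegral.integral_mul_deriv_eq_deriv_mul (u := fun u : ℝ => ((u - s : ℝ) : ℂ))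
    (v := fun u => gaussWeight (x * u ^ 2)) (u' := fun _ => 1)]
  · simp
  · intro u _
    simpa using ((hasDerivAt_id u).sub_const s).ofReal_comp
  · exact fun u _ => hasDerivAt_gaussWeight_mul_sq x u
  · simp
  · exact Continuous.intervalIntegrable (by fun_prop) _ _

theorem integrableOn_gaussWeight_mul_sq {x : ℝ} (hx : 0 < x) :
    MeasureTheory.IntegrableOn (fun u => gaussWeight (x * u ^ 2)) (Set.Ioi 0) := by
  have hc : Continuous fun u : ℝ => gaussWeight (x * u ^ 2) :=
    continuous_gaussWeight.comp (by fun_prop)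
  rw [← Set.Ioc_union_Ioi_eq_Ioi zero_le_one]
  refine MeasureTheory.IntegrableOn.union
    ((hc.intervalIntegrable 0 1).1) ?_
  have h := (integrable_exp_neg_mul_sq (b := Real.pi * x ^ 2) (by positivity)).integrableOn
    (s := Set.Ioi 1)
  refine MeasureTheory.Integrable.mono' h hc.aestronglyMeasurable ?_
  refine (MeasureTheory.ae_restrict_iff' measurableSet_Ioi).mpr (Filter.Eventually.of_forall ?_)
  intro u hu
  rw [norm_gaussWeight]
  refine Real.exp_le_exp.mpr ?_
  have hu1 : 1 ≤ u ^ 2 := by nlinarith [Set.mem_Ioi.mp hu]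
  have : 0 ≤ Real.pi * x ^ 2 * (u ^ 2 * (u ^ 2 - 1)) := by
    have : 0 ≤ u ^ 2 - 1 := by linarith
    have := Real.pi_pos
    positivity
  nlinarith

theorem integral_Ioi_gaussWeight_mul_sq {x : ℝ} (hx : 0 < x) :
    ∫ u in Set.Ioi (0 : ℝ), gaussWeight (x * u ^ 2) = squareGaussConst / √x := by
  have hs : 0 < √x := Real.sqrt_pos.mpr hx
  have h := MeasureTheory.integral_comp_mul_left_Ioi (fun u => gaussWeight (u ^ 2)) 0 hs
  simp only [mul_pow, Real.sq_sqrt hx.le, mul_zero] at h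
  rw [h, squareGaussConst, Complex.real_smul, div_eq_mul_inv, mul_comm]
  push_cast
  rfl

theorem tendsto_sum_squareGaussError {x : ℝ} (hx : 0 < x) :
    Filter.Tendsto (fun n => ∑ s ∈ Finset.range n, ∫ u in (s : ℝ)..(s + 1), ((u - s : ℝ) : ℂ) *
      ((-4 * Real.pi * x ^ 2 * u ^ 3 * Real.exp (-Real.pi * (x * u ^ 2) ^ 2) : ℝ) : ℂ))
      Filter.atTop (nhds (squareGaussError squareGaussConst x)) := by
  simp_rw [← gaussWeight_sub_integral, Finset.sum_sub_distrib]
  have hc : Continuous fun u : ℝ => gaussWeight (x * u ^ 2) :=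
    continuous_gaussWeight.comp (by fun_prop)
  refine Filter.Tendsto.sub ?_ ?_
  · have := summable_gaussWeight_sq hx (fun _ => 1) 1 (by simp)
    simp only [mul_one] at this
    exact this.hasSum.tendsto_sum_nat
  · have h1 : ∀ n : ℕ, ∑ s ∈ Finset.range n, ∫ u in (s : ℝ)..(s + 1), gaussWeight (x * u ^ 2) =
        ∫ u in (0 : ℝ)..n, gaussWeight (x * u ^ 2) := by
      intro n
      have := intervalIntegral.sum_integral_adjacent_intervals (a := fun s : ℕ => (s : ℝ)) (n := n)
        (μ := MeasureTheory.volume) (f := fun u => gaussWeight (x * u ^ 2))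
        (fun k _ => hc.intervalIntegrable _ _)
      simpa using this
    simp_rw [h1]
    rw [← integral_Ioi_gaussWeight_mul_sq hx]
    exact MeasureTheory.intervalIntegral_tendsto_integral_Ioi 0
      (integrableOn_gaussWeight_mul_sq hx) tendsto_natCast_atTop_atTop

theorem exists_separatesVars_squareGaussError {σ : ℝ} (hσ : 0 < σ) (hσ' : σ < 1 / 2) :
    ∃ C, 0 ≤ C ∧ SeparatesVars (squareGaussError squareGaussConst) σ C := by
  obtain ⟨C₁, hC₁, hsep⟩ := exists_separatesVars_gaussWeightLogDeriv hσ
  let D : ℕ → ℝ := fun s => if s = 0 then 4 * C₁ * (1 / (1 - 2 * σ)) else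
    4 * C₁ * (s : ℝ) ^ (-1 - 2 * σ)
  have hD0 : ∀ s, 0 ≤ D s := by
    intro s
    have : 0 < 1 - 2 * σ := by linarith
    simp only [D]
    split_ifs <;> positivity
  have hDsum : Summable D := by
    have h := (Real.summable_nat_rpow.mpr (by linarith : -1 - 2 * σ < -1)).mul_left (4 * C₁)
    rw [← summable_nat_add_iff 1] at h ⊢
    exact h.congr fun s => by simp [D]
  have hker : ∀ s : ℕ, ∀ u : ℝ, 0 < u → (s : ℝ) ≤ u → u ≤ s + 1 → SeparatesVars
      (fun x => ((u - s : ℝ) : ℂ) * ((-4 * Real.pi * x ^ 2 * u ^ 3 *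
        Real.exp (-Real.pi * (x * u ^ 2) ^ 2) : ℝ) : ℂ)) σ
      (4 * C₁ * ((u - s) / u * u ^ (-2 * σ))) := by
    intro s u hu hsu hsu'
    have h := (hsep.comp_mul (pow_pos hu 2)).const_mul ((-4 * ((u - s) / u) : ℝ) : ℂ)
    have hnn : 0 ≤ (u - s) / u := div_nonneg (by linarith) hu.le
    refine (h.congr fun x _ => ?_).mono (le_of_eq ?_)
    · simp only [gaussWeightLogDeriv]
      rw [← Complex.ofReal_mul, ← Complex.ofReal_mul, mul_comm (u ^ 2) x]
      congr 1
      field_simp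
    · rw [Complex.norm_real, norm_mul, Real.norm_eq_abs, Real.norm_eq_abs, abs_of_nonneg hnn,
        ← Real.rpow_natCast u, ← Real.rpow_mul hu.le]
      norm_num
      ring
  have hterm : ∀ s : ℕ, SeparatesVars (fun x => ∫ u in (s : ℝ)..(s + 1), ((u - s : ℝ) : ℂ) *
      ((-4 * Real.pi * x ^ 2 * u ^ 3 * Real.exp (-Real.pi * (x * u ^ 2) ^ 2) : ℝ) : ℂ)) σ
      (D s) := by
    intro s
    have hint : ∀ x : ℝ, 0 < x → IntervalIntegrable (fun u : ℝ => ((u - s : ℝ) : ℂ) *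
      ((-4 * Real.pi * x ^ 2 * u ^ 3 * Real.exp (-Real.pi * (x * u ^ 2) ^ 2) : ℝ) : ℂ))
      MeasureTheory.volume (s : ℝ) (s + 1) :=
      fun x _ => Continuous.intervalIntegrable (by fun_prop) _ _
    rcases Nat.eq_zero_or_pos s with hs | hs
    · subst hs
      have hi : IntervalIntegrable (fun u : ℝ => 4 * C₁ * u ^ (-2 * σ)) MeasureTheory.volume 0 1 :=
        (intervalIntegral.intervalIntegrable_rpow' (by linarith)).const_mul _
      have h := SeparatesVars.of_intervalIntegral (σ := σ) (a := ((0 : ℕ) : ℝ))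
        (b := ((0 : ℕ) : ℝ) + 1)
        (by simp) (D := fun u : ℝ => 4 * C₁ * u ^ (-2 * σ)) (fun u hu => ?_) (by simpa using hi)
        hint
      · refine h.mono (le_of_eq ?_)
        rw [intervalIntegral.integral_const_mul]
        simp only [D, if_true]
        congr 1
        rw [integral_rpow (Or.inl (by linarith))]
        have : -2 * σ + 1 ≠ 0 := by linarith
        rw [Nat.cast_zero, Real.zero_rpow this, zero_add, Real.one_rpow]
        ring
      · simp only [Nat.cast_zero, zero_add, Set.mem_Ioc] at hu
        refine (hker 0 u hu.1 (by simpa using hu.1.le) (by simpa using hu.2)).mono (le_of_eq ?_)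
        have := hu.1.ne'
        simp [this]
    · have hs1 : (0 : ℝ) < s := by exact_mod_cast hs
      have h := SeparatesVars.of_intervalIntegral (σ := σ) (a := (s : ℝ)) (b := (s : ℝ) + 1)
        (by simp) (D := fun _ : ℝ => D s) (fun u hu => ?_) (by simp) hint
      · refine h.mono (le_of_eq ?_)
        simp
      · have hu0 : 0 < u := hs1.trans hu.1
        refine (hker s u hu0 hu.1.le hu.2).mono ?_
        simp only [D, hs.ne', if_false]
        refine mul_le_mul_of_nonneg_left ?_ (by positivity)
        have h1 : (u - s) / u ≤ 1 / u := by
          gcongr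
          linarith [hu.2]
        calc (u - s) / u * u ^ (-2 * σ) ≤ 1 / u * u ^ (-2 * σ) := by gcongr
          _ = u ^ (-1 - 2 * σ) := by
            rw [one_div, ← Real.rpow_neg_one, ← Real.rpow_add hu0]
            ring_nf
          _ ≤ (s : ℝ) ^ (-1 - 2 * σ) :=
            Real.rpow_le_rpow_of_nonpos hs1 hu.1.le (by linarith)
  refine ⟨∑' s, D s, tsum_nonneg hD0, ?_⟩
  refine SeparatesVars.of_tendsto (fun n => ?_) fun x hx => tendsto_sum_squareGaussError hx
  exact (SeparatesVars.sum (Finset.range n) fun s _ => hterm s).mono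
    (hDsum.sum_le_tsum _ fun s _ => hD0 s)

/-- A large sieve bound for real characters over squarefree `K`, weighted by the expected size. -/
def KernelSieveBound (ξ ε C : ℝ) : Prop :=
  ∀ (Y : ℝ) (S 𝒦 : Finset ℕ) (b : ℕ → ℂ), 1 ≤ Y →
    (∀ n ∈ S, Odd n ∧ Squarefree n ∧ (n : ℝ) ≤ Y) → (∀ K ∈ 𝒦, Squarefree K) →
    ∑ K ∈ 𝒦, ‖∑ n ∈ S, b n * jacobiChi n K‖ ^ 2 * ((K : ℝ) ^ ε * (Y + (K : ℝ) ^ ξ))⁻¹ ≤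
      C * Y ^ ε * ∑ n ∈ S, ‖b n‖ ^ 2

theorem sum_moebius_common_divisors {S F : Finset ℕ} (hS : ∀ n ∈ S, n ≠ 0)
    (hF : ∀ n ∈ S, n.divisors ⊆ F) (m : ℕ) {n : ℕ} (hn : n ∈ S) :
    (if m.Coprime n then (1 : ℂ) else 0) = ∑ f ∈ F, (ArithmeticFunction.moebius f : ℂ) *
      ((if f ∣ m then 1 else 0) * if f ∣ n then 1 else 0) := by
  rw [← sum_divisors_moebius_ite (hS n hn)]
  rw [← Finset.sum_subset (hF n hn)]
  · refine Finset.sum_congr rfl fun f hf => ?_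
    rw [if_pos (Nat.dvd_of_mem_divisors hf)]
    split_ifs <;> simp
  · intro f _ hf
    rw [if_neg fun h => hf (Nat.mem_divisors.mpr ⟨h, hS n hn⟩)]
    simp

/-- Bilinear forms over coprime pairs are controlled by the large sieve bound. -/
theorem KernelSieveBound.coprime_bilinear {ξ ε C : ℝ} (hP : KernelSieveBound ξ ε C) {Y : ℝ}
    (hY : 1 ≤ Y) {S 𝒦 : Finset ℕ} (hS : ∀ n ∈ S, Odd n ∧ Squarefree n ∧ (n : ℝ) ≤ Y)
    (h𝒦 : ∀ K ∈ 𝒦, Squarefree K) {ω : ℕ → ℂ} {Ω : ℝ}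
    (hω : ∀ K ∈ 𝒦, ‖ω K‖ * ((K : ℝ) ^ ε * (Y + (K : ℝ) ^ ξ)) ≤ Ω) (hΩ : 0 ≤ Ω) (hC : 0 ≤ C)
    {b₁ b₂ : ℕ → ℂ} {β : ℕ → ℝ} (hb₁ : ∀ n ∈ S, ‖b₁ n‖ ≤ β n) (hb₂ : ∀ n ∈ S, ‖b₂ n‖ ≤ β n) :
    ‖∑ K ∈ 𝒦, ω K * ∑ n₁ ∈ S, ∑ n₂ ∈ S, (if n₁.Coprime n₂ then 1 else 0) *
      ((b₁ n₁ * jacobiChi n₁ K) * (b₂ n₂ * jacobiChi n₂ K))‖ ≤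
    Ω * (C * Y ^ ε * ∑ n ∈ S, n.divisors.card * β n ^ 2) := by
  have hS0 : ∀ n ∈ S, n ≠ 0 := fun n hn => (hS n hn).2.1.ne_zero
  let F := S.biUnion Nat.divisors
  have hF : ∀ n ∈ S, n.divisors ⊆ F := fun n hn => Finset.subset_biUnion_of_mem Nat.divisors hn
  let A : (ℕ → ℂ) → ℕ → ℕ → ℂ := fun b f K => ∑ n ∈ S with f ∣ n, b n * jacobiChi n K
  have h1 : ∀ K, ∑ n₁ ∈ S, ∑ n₂ ∈ S, (if n₁.Coprime n₂ then 1 else 0) *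
      ((b₁ n₁ * jacobiChi n₁ K) * (b₂ n₂ * jacobiChi n₂ K)) =
      ∑ f ∈ F, (ArithmeticFunction.moebius f : ℂ) * (A b₁ f K * A b₂ f K) := by
    intro K
    have : ∀ n₁ ∈ S, ∀ n₂ ∈ S, (if n₁.Coprime n₂ then 1 else 0) *
        ((b₁ n₁ * jacobiChi n₁ K) * (b₂ n₂ * jacobiChi n₂ K)) =
        ∑ f ∈ F, (ArithmeticFunction.moebius f : ℂ) *
          ((if f ∣ n₁ then b₁ n₁ * jacobiChi n₁ K else 0) *
          (if f ∣ n₂ then b₂ n₂ * jacobiChi n₂ K else 0)) := by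
      intro n₁ _ n₂ h₂
      rw [sum_moebius_common_divisors hS0 hF n₁ h₂, Finset.sum_mul]
      refine Finset.sum_congr rfl fun f _ => ?_
      split_ifs <;> ring
    rw [Finset.sum_congr rfl fun n₁ h₁ => Finset.sum_congr rfl (this n₁ h₁)]
    simp_rw [A, Finset.sum_filter, Finset.sum_mul_sum, Finset.mul_sum]
    rw [Finset.sum_congr rfl fun n₁ _ => Finset.sum_comm, Finset.sum_comm]
  have hpos : ∀ K ∈ 𝒦, 0 < (K : ℝ) ^ ε * (Y + (K : ℝ) ^ ξ) := by
    intro K hK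
    have : (0 : ℝ) < K := by exact_mod_cast Nat.pos_of_ne_zero (h𝒦 K hK).ne_zero
    positivity
  have hsq : ∀ b : ℕ → ℂ, (∀ n ∈ S, ‖b n‖ ≤ β n) → ∀ f ∈ F,
      ∑ K ∈ 𝒦, ‖ω K‖ * ‖A b f K‖ ^ 2 ≤
        Ω * (C * Y ^ ε * ∑ n ∈ S with f ∣ n, β n ^ 2) := by
    intro b hb f _
    have h2 := hP Y (S.filter (f ∣ ·)) 𝒦 b hY (fun n hn => hS n (Finset.mem_filter.mp hn).1) h𝒦
    calc ∑ K ∈ 𝒦, ‖ω K‖ * ‖A b f K‖ ^ 2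
        ≤ ∑ K ∈ 𝒦, Ω * (‖A b f K‖ ^ 2 * ((K : ℝ) ^ ε * (Y + (K : ℝ) ^ ξ))⁻¹) := by
          refine Finset.sum_le_sum fun K hK => ?_
          have h3 : ‖ω K‖ ≤ Ω * ((K : ℝ) ^ ε * (Y + (K : ℝ) ^ ξ))⁻¹ := by
            rw [← div_eq_mul_inv, le_div_iff₀ (hpos K hK)]
            exact hω K hK
          calc _ ≤ Ω * ((K : ℝ) ^ ε * (Y + (K : ℝ) ^ ξ))⁻¹ * ‖A b f K‖ ^ 2 := by gcongr
            _ = _ := by ring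
      _ ≤ Ω * (C * Y ^ ε * ∑ n ∈ S with f ∣ n, ‖b n‖ ^ 2) := by
          rw [← Finset.mul_sum]
          exact mul_le_mul_of_nonneg_left h2 hΩ
      _ ≤ _ := by
          gcongr with n hn
          exact hb n (Finset.mem_filter.mp hn).1
  calc ‖∑ K ∈ 𝒦, ω K * ∑ n₁ ∈ S, ∑ n₂ ∈ S, (if n₁.Coprime n₂ then 1 else 0) *
      ((b₁ n₁ * jacobiChi n₁ K) * (b₂ n₂ * jacobiChi n₂ K))‖
      = ‖∑ f ∈ F, ∑ K ∈ 𝒦, ω K * ((ArithmeticFunction.moebius f : ℂ) *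
        (A b₁ f K * A b₂ f K))‖ := by
        rw [Finset.sum_comm]
        simp_rw [h1, Finset.mul_sum]
    _ ≤ ∑ f ∈ F, ∑ K ∈ 𝒦, (‖ω K‖ * ‖A b₁ f K‖ ^ 2 + ‖ω K‖ * ‖A b₂ f K‖ ^ 2) / 2 := by
        refine norm_sum_le_of_le _ fun f _ => norm_sum_le_of_le _ fun K _ => ?_
        rw [norm_mul, norm_mul, norm_mul]
        have h3 : ‖(ArithmeticFunction.moebius f : ℂ)‖ ≤ 1 := by
          rw [Complex.norm_intCast]
          exact_mod_cast ArithmeticFunction.abs_moebius_le_one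
        have h4 : ‖A b₁ f K‖ * ‖A b₂ f K‖ ≤ (‖A b₁ f K‖ ^ 2 + ‖A b₂ f K‖ ^ 2) / 2 := by
          linarith [two_mul_le_add_sq ‖A b₁ f K‖ ‖A b₂ f K‖]
        calc _ ≤ ‖ω K‖ * (1 * ((‖A b₁ f K‖ ^ 2 + ‖A b₂ f K‖ ^ 2) / 2)) := by gcongr
          _ = _ := by ring
    _ ≤ ∑ f ∈ F, Ω * (C * Y ^ ε * ∑ n ∈ S with f ∣ n, β n ^ 2) := by
        refine Finset.sum_le_sum fun f hf => ?_
        rw [← Finset.sum_div, Finset.sum_add_distrib]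
        linarith [hsq b₁ hb₁ f hf, hsq b₂ hb₂ f hf]
    _ = _ := by
        rw [← Finset.mul_sum, ← Finset.mul_sum]
        congr 2
        simp_rw [Finset.sum_filter]
        rw [Finset.sum_comm]
        refine Finset.sum_congr rfl fun n hn => ?_
        rw [← Finset.sum_filter, Finset.sum_const, nsmul_eq_mul]
        congr 3
        ext f
        simp only [Finset.mem_filter, Nat.mem_divisors]
        exact ⟨fun h => ⟨h.2, hS0 n hn⟩,
          fun h => ⟨hF n hn (Nat.mem_divisors.mpr h), h.1⟩⟩

theorem SeparatesVars.nested {f : ℝ → ℂ} {σ C : ℝ} (h : SeparatesVars f σ C) {α : Type}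
    {A : Finset α} {E : α → Finset ℕ} {c : α → ℕ → ℂ} {x : α → ℕ → ℝ} {B : ℝ}
    (hx : ∀ a ∈ A, ∀ e ∈ E a, 0 < x a e)
    (hB : ∀ ψ, IsQuasiChar σ ψ → ‖∑ a ∈ A, ∑ e ∈ E a, c a e * ψ (x a e)‖ ≤ B) :
    ‖∑ a ∈ A, ∑ e ∈ E a, c a e * f (x a e)‖ ≤ C * B := by
  have := h (Σ _ : α, ℕ) (A.sigma E) (fun i => c i.1 i.2) (fun i => x i.1 i.2) B
    (fun i hi => hx _ (Finset.mem_sigma.mp hi).1 _ (Finset.mem_sigma.mp hi).2)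
    (fun ψ hψ => by rw [Finset.sum_sigma]; exact hB ψ hψ)
  rwa [Finset.sum_sigma] at this

/-- The multiplicative function attached to a quasi-character by summing over squares of
divisors. -/
noncomputable def moebiusSquareSum (ψ : ℝ → ℂ) (n : ℕ) : ℂ :=
  ∑ e ∈ n.divisors, (ArithmeticFunction.moebius e : ℂ) * ψ ((e : ℝ) ^ 2)

theorem norm_moebius_le_one (n : ℕ) : ‖(ArithmeticFunction.moebius n : ℂ)‖ ≤ 1 := by
  rw [Complex.norm_intCast]
  exact_mod_cast ArithmeticFunction.abs_moebius_le_one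

theorem moebiusSquareSum_mul {σ : ℝ} {ψ : ℝ → ℂ} (hψ : IsQuasiChar σ ψ) {m n : ℕ}
    (hmn : m.Coprime n) :
    moebiusSquareSum ψ (m * n) = moebiusSquareSum ψ m * moebiusSquareSum ψ n := by
  unfold moebiusSquareSum
  rw [sum_divisors_mul_of_coprime hmn
    (fun e => (ArithmeticFunction.moebius e : ℂ) * ψ ((e : ℝ) ^ 2)), Finset.sum_mul_sum]
  refine Finset.sum_congr rfl fun a ha => Finset.sum_congr rfl fun b hb => ?_
  have hab : a.Coprime b := (hmn.coprime_dvd_left (Nat.dvd_of_mem_divisors ha)).coprime_dvd_right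
    (Nat.dvd_of_mem_divisors hb)
  have ha0 : (0 : ℝ) < a := by exact_mod_cast Nat.pos_of_mem_divisors ha
  have hb0 : (0 : ℝ) < b := by exact_mod_cast Nat.pos_of_mem_divisors hb
  rw [ArithmeticFunction.isMultiplicative_moebius.map_mul_of_coprime hab, Nat.cast_mul, mul_pow,
    hψ.map_mul _ _ (by positivity) (by positivity)]
  push_cast
  ring

theorem norm_moebiusSquareSum_le {σ : ℝ} (hσ : 0 ≤ σ) {ψ : ℝ → ℂ} (hψ : IsQuasiChar σ ψ) (n : ℕ) :
    ‖moebiusSquareSum ψ n‖ ≤ n.divisors.card := by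
  have : ∀ e ∈ n.divisors, ‖(ArithmeticFunction.moebius e : ℂ) * ψ ((e : ℝ) ^ 2)‖ ≤ 1 := by
    intro e he
    have he1 : (1 : ℝ) ≤ e := by exact_mod_cast Nat.pos_of_mem_divisors he
    rw [norm_mul, hψ.norm_eq _ (by positivity)]
    exact mul_le_one₀ (norm_moebius_le_one e) (by positivity)
      (Real.rpow_le_one_of_one_le_of_nonpos (one_le_pow₀ he1) (by linarith))
  exact (norm_sum_le_of_le _ this).trans (by simp)

section Bilinear

variable {ξ ε C : ℝ} (hP : KernelSieveBound ξ ε C) (hC : 0 ≤ C) {Y : ℝ} (hY : 1 ≤ Y)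
  {S 𝒦 : Finset ℕ} (hS : ∀ n ∈ S, Odd n ∧ Squarefree n ∧ (n : ℝ) ≤ Y)
  (h𝒦 : ∀ K ∈ 𝒦, Squarefree K) {f : ℝ → ℂ} {σ Cσ : ℝ} (hsep : SeparatesVars f σ Cσ)
  {b₁ b₂ : ℕ → ℂ} {y β : ℕ → ℝ} (hy : ∀ n ∈ S, 0 < y n)

include hP hC hY hS h𝒦 hsep hy

theorem bilinear_divisor_sum_le (hσ : 0 ≤ σ) {h : ℕ} (hcop : ∀ n ∈ S, h.Coprime n) {w : ℕ → ℂ}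
    {X : ℕ → ℝ} {Ω : ℝ} (hΩ : 0 ≤ Ω) (hX : ∀ K ∈ 𝒦, 0 < X K)
    (hw : ∀ K ∈ 𝒦, ‖w K‖ * X K ^ (-σ) * h.divisors.card *
      ((K : ℝ) ^ ε * (Y + (K : ℝ) ^ ξ)) ≤ Ω)
    (hb₁ : ∀ n ∈ S, ‖b₁ n‖ * y n ^ (-σ) * n.divisors.card ≤ β n)
    (hb₂ : ∀ n ∈ S, ‖b₂ n‖ * y n ^ (-σ) * n.divisors.card ≤ β n) :
    ‖∑ K ∈ 𝒦, w K * ∑ n₁ ∈ S, ∑ n₂ ∈ S, (if n₁.Coprime n₂ then 1 else 0) *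
      ((b₁ n₁ * jacobiChi n₁ K) * (b₂ n₂ * jacobiChi n₂ K) *
        ∑ e ∈ (h * (n₁ * n₂)).divisors, (ArithmeticFunction.moebius e : ℂ) *
          f (X K * (y n₁ * y n₂) * (e : ℝ) ^ 2))‖ ≤
    Cσ * (Ω * (C * Y ^ ε * ∑ n ∈ S, n.divisors.card * β n ^ 2)) := by
  have hform : ∀ φ : ℝ → ℂ, ∑ K ∈ 𝒦, w K * ∑ n₁ ∈ S, ∑ n₂ ∈ S, (if n₁.Coprime n₂ then 1 else 0) *
      ((b₁ n₁ * jacobiChi n₁ K) * (b₂ n₂ * jacobiChi n₂ K) *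
        ∑ e ∈ (h * (n₁ * n₂)).divisors, (ArithmeticFunction.moebius e : ℂ) *
          φ (X K * (y n₁ * y n₂) * (e : ℝ) ^ 2)) =
      ∑ p ∈ 𝒦 ×ˢ S ×ˢ S, ∑ e ∈ (h * (p.2.1 * p.2.2)).divisors,
        (w p.1 * (if p.2.1.Coprime p.2.2 then 1 else 0) * ((b₁ p.2.1 * jacobiChi p.2.1 p.1) *
          (b₂ p.2.2 * jacobiChi p.2.2 p.1)) * (ArithmeticFunction.moebius e : ℂ)) *
          φ (X p.1 * (y p.2.1 * y p.2.2) * (e : ℝ) ^ 2) := by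
    intro φ
    rw [Finset.sum_product]
    refine Finset.sum_congr rfl fun K _ => ?_
    rw [Finset.sum_product, Finset.mul_sum]
    refine Finset.sum_congr rfl fun n₁ _ => ?_
    rw [Finset.mul_sum]
    refine Finset.sum_congr rfl fun n₂ _ => ?_
    simp_rw [Finset.mul_sum]
    exact Finset.sum_congr rfl fun e _ => by ring
  rw [hform]
  refine hsep.nested ?_ ?_
  · intro p hp e he
    simp only [Finset.mem_product] at hp
    have he0 : (0 : ℝ) < e := by exact_mod_cast Nat.pos_of_mem_divisors he
    have := hX _ hp.1
    have := hy _ hp.2.1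
    have := hy _ hp.2.2
    positivity
  · intro ψ hψ
    rw [← hform]
    have key : ∀ K ∈ 𝒦, ∀ n₁ ∈ S, ∀ n₂ ∈ S, w K * ((if n₁.Coprime n₂ then 1 else 0) *
        ((b₁ n₁ * jacobiChi n₁ K) * (b₂ n₂ * jacobiChi n₂ K) *
        ∑ e ∈ (h * (n₁ * n₂)).divisors, (ArithmeticFunction.moebius e : ℂ) *
          ψ (X K * (y n₁ * y n₂) * (e : ℝ) ^ 2))) =
        (w K * ψ (X K) * moebiusSquareSum ψ h) * ((if n₁.Coprime n₂ then 1 else 0) *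
        ((b₁ n₁ * ψ (y n₁) * moebiusSquareSum ψ n₁ * jacobiChi n₁ K) *
        (b₂ n₂ * ψ (y n₂) * moebiusSquareSum ψ n₂ * jacobiChi n₂ K))) := by
      intro K hK n₁ h₁ n₂ h₂
      split_ifs with hc
      · have h1 : ∑ e ∈ (h * (n₁ * n₂)).divisors, (ArithmeticFunction.moebius e : ℂ) *
            ψ (X K * (y n₁ * y n₂) * (e : ℝ) ^ 2) =
            ψ (X K) * (ψ (y n₁) * ψ (y n₂)) * moebiusSquareSum ψ (h * (n₁ * n₂)) := by
          rw [moebiusSquareSum, Finset.mul_sum]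
          refine Finset.sum_congr rfl fun e he => ?_
          have he0 : (0 : ℝ) < e := by exact_mod_cast Nat.pos_of_mem_divisors he
          have h3 := mul_pos (hy _ h₁) (hy _ h₂)
          rw [hψ.map_mul _ _ (mul_pos (hX _ hK) h3) (by positivity), hψ.map_mul _ _ (hX _ hK) h3,
            hψ.map_mul _ _ (hy _ h₁) (hy _ h₂)]
          ring
        rw [h1, moebiusSquareSum_mul hψ ((hcop _ h₁).mul_right (hcop _ h₂)),
          moebiusSquareSum_mul hψ hc]
        ring
      · ring
    simp_rw [Finset.mul_sum]
    rw [Finset.sum_congr rfl fun K hK => Finset.sum_congr rfl fun n₁ h₁ =>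
      Finset.sum_congr rfl fun n₂ h₂ => by simpa only [Finset.mul_sum] using key K hK n₁ h₁ n₂ h₂]
    simp_rw [← Finset.mul_sum]
    have hcoef : ∀ b : ℕ → ℂ, (∀ n ∈ S, ‖b n‖ * y n ^ (-σ) * n.divisors.card ≤ β n) →
        ∀ n ∈ S, ‖b n * ψ (y n) * moebiusSquareSum ψ n‖ ≤ β n := by
      intro b hb n hn
      rw [norm_mul, norm_mul, hψ.norm_eq _ (hy n hn)]
      refine le_trans ?_ (hb n hn)
      have := Real.rpow_nonneg (hy n hn).le (-σ)
      gcongr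
      exact norm_moebiusSquareSum_le hσ hψ n
    refine hP.coprime_bilinear hY hS h𝒦 (fun K hK => ?_) hΩ hC (hcoef b₁ hb₁) (hcoef b₂ hb₂)
    have hK0 : (0 : ℝ) < K := by exact_mod_cast Nat.pos_of_ne_zero (h𝒦 K hK).ne_zero
    refine le_trans ?_ (hw K hK)
    rw [norm_mul, norm_mul, hψ.norm_eq _ (hX K hK)]
    have := Real.rpow_nonneg (hX K hK).le (-σ)
    gcongr
    exact norm_moebiusSquareSum_le hσ hψ h

theorem bilinear_square_sum_le {𝒯 : Finset ℕ} {w : ℕ → ℕ → ℂ} {X : ℕ → ℕ → ℝ} {Ω : ℕ → ℝ}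
    (hΩ : ∀ s ∈ 𝒯, 0 ≤ Ω s) (hX : ∀ s ∈ 𝒯, ∀ K ∈ 𝒦, 0 < X K s)
    (hw : ∀ s ∈ 𝒯, ∀ K ∈ 𝒦, ‖w K s‖ * X K s ^ (-σ) * ((K : ℝ) ^ ε * (Y + (K : ℝ) ^ ξ)) ≤ Ω s)
    (hb₁ : ∀ n ∈ S, ‖b₁ n‖ * y n ^ (-σ) ≤ β n) (hb₂ : ∀ n ∈ S, ‖b₂ n‖ * y n ^ (-σ) ≤ β n) :
    ‖∑ s ∈ 𝒯, ∑ K ∈ 𝒦, w K s * ∑ n₁ ∈ S, ∑ n₂ ∈ S, (if n₁.Coprime n₂ then 1 else 0) *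
      ((b₁ n₁ * (if s.Coprime n₁ then 1 else 0) * jacobiChi n₁ K) *
        (b₂ n₂ * (if s.Coprime n₂ then 1 else 0) * jacobiChi n₂ K) *
          f (X K s * (y n₁ * y n₂)))‖ ≤
    Cσ * ((∑ s ∈ 𝒯, Ω s) * (C * Y ^ ε * ∑ n ∈ S, n.divisors.card * β n ^ 2)) := by
  have hform : ∀ φ : ℝ → ℂ, ∑ s ∈ 𝒯, ∑ K ∈ 𝒦, w K s * ∑ n₁ ∈ S, ∑ n₂ ∈ S,
      (if n₁.Coprime n₂ then 1 else 0) *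
      ((b₁ n₁ * (if s.Coprime n₁ then 1 else 0) * jacobiChi n₁ K) *
        (b₂ n₂ * (if s.Coprime n₂ then 1 else 0) * jacobiChi n₂ K) *
          φ (X K s * (y n₁ * y n₂))) =
      ∑ p ∈ (𝒯 ×ˢ 𝒦 ×ˢ S), ∑ n ∈ S, (w p.2.1 p.1 * (if p.2.2.Coprime n then 1 else 0) *
        ((b₁ p.2.2 * (if p.1.Coprime p.2.2 then 1 else 0) * jacobiChi p.2.2 p.2.1) *
        (b₂ n * (if p.1.Coprime n then 1 else 0) * jacobiChi n p.2.1))) *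
          φ (X p.2.1 p.1 * (y p.2.2 * y n)) := by
    intro φ
    rw [Finset.sum_product]
    refine Finset.sum_congr rfl fun s _ => ?_
    rw [Finset.sum_product]
    refine Finset.sum_congr rfl fun K _ => ?_
    simp_rw [Finset.mul_sum]
    exact Finset.sum_congr rfl fun n₁ _ => Finset.sum_congr rfl fun n₂ _ => by ring
  rw [hform]
  refine hsep.nested ?_ ?_
  · intro p hp n hn
    simp only [Finset.mem_product] at hp
    exact mul_pos (hX _ hp.1 _ hp.2.1) (mul_pos (hy _ hp.2.2) (hy _ hn))
  · intro ψ hψ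
    rw [← hform, Finset.sum_mul]
    refine norm_sum_le_of_le _ fun s hs => ?_
    have key : ∀ K ∈ 𝒦, ∀ n₁ ∈ S, ∀ n₂ ∈ S, w K s * ((if n₁.Coprime n₂ then 1 else 0) *
        ((b₁ n₁ * (if s.Coprime n₁ then 1 else 0) * jacobiChi n₁ K) *
          (b₂ n₂ * (if s.Coprime n₂ then 1 else 0) * jacobiChi n₂ K) *
            ψ (X K s * (y n₁ * y n₂)))) =
        (w K s * ψ (X K s)) * ((if n₁.Coprime n₂ then 1 else 0) *
        ((b₁ n₁ * (if s.Coprime n₁ then 1 else 0) * ψ (y n₁) * jacobiChi n₁ K) *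
        (b₂ n₂ * (if s.Coprime n₂ then 1 else 0) * ψ (y n₂) * jacobiChi n₂ K))) := by
      intro K hK n₁ h₁ n₂ h₂
      rw [hψ.map_mul _ _ (hX _ hs _ hK) (mul_pos (hy _ h₁) (hy _ h₂)),
        hψ.map_mul _ _ (hy _ h₁) (hy _ h₂)]
      ring
    simp_rw [Finset.mul_sum]
    rw [Finset.sum_congr rfl fun K hK => Finset.sum_congr rfl fun n₁ h₁ =>
      Finset.sum_congr rfl (key K hK n₁ h₁)]
    simp_rw [← Finset.mul_sum]
    have hcoef : ∀ b : ℕ → ℂ, (∀ n ∈ S, ‖b n‖ * y n ^ (-σ) ≤ β n) →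
        ∀ n ∈ S, ‖b n * (if s.Coprime n then 1 else 0) * ψ (y n)‖ ≤ β n := by
      intro b hb n hn
      rw [norm_mul, norm_mul, hψ.norm_eq _ (hy n hn)]
      refine le_trans ?_ (hb n hn)
      have := Real.rpow_nonneg (hy n hn).le (-σ)
      gcongr
      refine mul_le_of_le_one_right (norm_nonneg _) ?_
      split_ifs <;> simp
    refine hP.coprime_bilinear hY hS h𝒦 (fun K hK => ?_) (hΩ s hs) hC (hcoef b₁ hb₁) (hcoef b₂ hb₂)
    rw [norm_mul, hψ.norm_eq _ (hX s hs K hK)]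
    exact hw s hs K hK

end Bilinear

section WeightEstimates

variable {N M ξ η κ g d K : ℝ} (hN : 1 ≤ N) (hM : 0 < M) (hκ : 0 < κ) (hκN : κ ≤ N)
  (hκξ : κ ^ ξ ≤ N) (hξ : 1 ≤ ξ) (hη : 0 < η) (hd : 1 ≤ d) (hdg : d ≤ g) (hK : 1 ≤ K)

include hN hM hκ hκN hκξ hξ hη hd hdg hK

theorem dual_weight_le_of_small (hKκ : K ≤ κ / g ^ 2) :
    M / d * (g / N) * (κ / K * (d / g) ^ 2) ^ η * (K ^ η * (N / g + K ^ ξ)) ≤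
      2 * M * N ^ (3 * η) := by
  have hg1 : 1 ≤ g := hd.trans hdg
  have h1 : (κ / K * (d / g) ^ 2) ^ η * K ^ η ≤ N ^ η := by
    rw [← Real.mul_rpow (by positivity) (by positivity)]
    refine Real.rpow_le_rpow (by positivity) ?_ hη.le
    have : (d / g) ^ 2 ≤ 1 := pow_le_one₀ (by positivity) ((div_le_one (by positivity)).mpr hdg)
    calc κ / K * (d / g) ^ 2 * K = κ * (d / g) ^ 2 := by field_simp
      _ ≤ κ * 1 := by gcongr
      _ ≤ N := by linarith
  have h2 : K ^ ξ ≤ N / g := by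
    calc K ^ ξ ≤ (κ / g) ^ ξ := by
          refine Real.rpow_le_rpow (by positivity) (hKκ.trans ?_) (by linarith)
          gcongr
          nlinarith
      _ = κ ^ ξ / g ^ ξ := Real.div_rpow hκ.le (by positivity) _
      _ ≤ N / g := by
          gcongr
          exact Real.self_le_rpow_of_one_le hg1 hξ
  have h3 : N ^ η ≤ N ^ (3 * η) := Real.rpow_le_rpow_of_exponent_le hN (by linarith)
  calc M / d * (g / N) * (κ / K * (d / g) ^ 2) ^ η * (K ^ η * (N / g + K ^ ξ))
      = M / d * (g / N) * ((κ / K * (d / g) ^ 2) ^ η * K ^ η) * (N / g + K ^ ξ) := by ring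
    _ ≤ M / 1 * (g / N) * N ^ (3 * η) * (N / g + N / g) := by
        gcongr
        exact h1.trans h3
    _ = _ := by field_simp; ring

theorem dual_weight_le_of_medium (hg : g ≤ N) (hKκ : κ / g ^ 2 ≤ K) (hKκ' : K ≤ κ) :
    M / d * (g / N) * (κ / K * (d / g) ^ 2) ^ (1 / 2 - η) * (K ^ η * (N / g + K ^ ξ)) ≤
      2 * M * N ^ (3 * η) := by
  have hg1 : 1 ≤ g := hd.trans hdg
  have hr : 1 ≤ κ / K := (one_le_div (by positivity)).mpr hKκ'
  have hs : (κ / K) ^ (1 / 2 : ℝ) ≤ g := by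
    rw [← Real.sqrt_eq_rpow]
    refine Real.sqrt_le_left (by positivity) |>.mpr ?_ |>.trans le_rfl
    rw [div_le_iff₀ (by positivity)] at hKκ ⊢
    linarith
  have h1 : (κ / K * (d / g) ^ 2) ^ (1 / 2 - η) ≤
      (κ / K) ^ (1 / 2 : ℝ) * (d / g) * N ^ (2 * η) := by
    rw [sub_eq_add_neg, Real.rpow_add (by positivity)]
    refine mul_le_mul (le_of_eq ?_) ?_ (by positivity) (by positivity)
    · rw [Real.mul_rpow (by positivity) (by positivity), ← Real.sqrt_eq_rpow ((d / g) ^ 2),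
        Real.sqrt_sq (by positivity)]
    · calc (κ / K * (d / g) ^ 2) ^ (-η) ≤ ((1 / N) ^ 2) ^ (-η) := by
            refine Real.rpow_le_rpow_of_nonpos (by positivity) ?_ (by linarith)
            calc (1 / N) ^ 2 ≤ (d / g) ^ 2 := by gcongr
              _ ≤ _ := le_mul_of_one_le_left (by positivity) hr
        _ = N ^ (2 * η) := by
            rw [one_div, inv_pow, Real.inv_rpow (by positivity), Real.rpow_neg (by positivity),
              inv_inv, ← Real.rpow_natCast, ← Real.rpow_mul (by positivity)]
            norm_num
  have h2 : (κ / K) ^ (1 / 2 : ℝ) * (N / g + K ^ ξ) ≤ 2 * N := by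
    have h3 : (κ / K) ^ (1 / 2 : ℝ) * (N / g) ≤ N := by
      calc _ ≤ g * (N / g) := by gcongr
        _ = N := by field_simp
    have h4 : (κ / K) ^ (1 / 2 : ℝ) * K ^ ξ ≤ N := by
      calc _ ≤ (κ / K) ^ ξ * K ^ ξ := by
            gcongr ?_ * _
            exact Real.rpow_le_rpow_of_exponent_le hr (by linarith)
        _ = κ ^ ξ := by
            rw [← Real.mul_rpow (by positivity) (by positivity)]
            congr 1
            field_simp
        _ ≤ N := hκξ
    linarith
  have h5 : K ^ η ≤ N ^ η := Real.rpow_le_rpow (by positivity) (hKκ'.trans hκN) hη.le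
  calc M / d * (g / N) * (κ / K * (d / g) ^ 2) ^ (1 / 2 - η) * (K ^ η * (N / g + K ^ ξ))
      ≤ M / d * (g / N) * ((κ / K) ^ (1 / 2 : ℝ) * (d / g) * N ^ (2 * η)) *
        (N ^ η * (N / g + K ^ ξ)) := by gcongr
    _ = M / N * (N ^ (2 * η) * N ^ η) * ((κ / K) ^ (1 / 2 : ℝ) * (N / g + K ^ ξ)) := by
        field_simp
    _ ≤ M / N * (N ^ (2 * η) * N ^ η) * (2 * N) := by gcongr
    _ = _ := by
        rw [← Real.rpow_add (by positivity)]
        ring_nf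
        field_simp

theorem dual_weight_le_of_large (hξη : ξ + η ≤ 4) (hKκ : κ ≤ K) :
    M / d * (g / N) * (κ / K * (d / g) ^ 2) ^ (4 : ℝ) * (K ^ η * (N / g + K ^ ξ)) ≤
      2 * M * N ^ (3 * η) := by
  have hg1 : 1 ≤ g := hd.trans hdg
  have hK0 : 0 < K := by linarith
  have hr : κ / K ≤ 1 := (div_le_one hK0).mpr hKκ
  have h1 : ∀ t : ℝ, t ≤ 4 → 0 ≤ t → (κ / K) ^ (4 : ℝ) * K ^ t ≤ κ ^ t := by
    intro t ht ht0
    calc (κ / K) ^ (4 : ℝ) * K ^ t ≤ (κ / K) ^ t * K ^ t := by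
          gcongr ?_ * _
          exact Real.rpow_le_rpow_of_exponent_ge (by positivity) hr ht
      _ = κ ^ t := by
          rw [← Real.mul_rpow (by positivity) (by positivity)]
          congr 1
          field_simp
  have h2 : (κ / K) ^ (4 : ℝ) * (K ^ η * (N / g + K ^ ξ)) ≤ 2 * N * N ^ (3 * η) := by
    have h0 : κ ^ η ≤ N ^ (3 * η) := (Real.rpow_le_rpow hκ.le hκN hη.le).trans
      (Real.rpow_le_rpow_of_exponent_le hN (by linarith))
    have h3 : (κ / K) ^ (4 : ℝ) * K ^ η * (N / g) ≤ N ^ (3 * η) * N := by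
      have := (h1 η (by linarith) hη.le).trans h0
      gcongr
      exact div_le_self (by linarith) hg1
    have h4 : (κ / K) ^ (4 : ℝ) * K ^ (ξ + η) ≤ N * N ^ (3 * η) := by
      refine (h1 _ hξη (by linarith)).trans ?_
      rw [Real.rpow_add hκ]
      gcongr
    rw [Real.rpow_add hK0] at h4
    linarith
  have h5 : (κ / K * (d / g) ^ 2) ^ (4 : ℝ) ≤ (κ / K) ^ (4 : ℝ) * (d / g) := by
    rw [Real.mul_rpow (by positivity) (by positivity)]
    gcongr
    rw [← Real.rpow_natCast, ← Real.rpow_mul (by positivity)]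
    have h6 : d / g ≤ 1 := (div_le_one (by positivity)).mpr hdg
    calc (d / g) ^ ((2 : ℕ) * 4 : ℝ) ≤ (d / g) ^ (1 : ℝ) :=
          Real.rpow_le_rpow_of_exponent_ge (by positivity) h6 (by norm_num)
      _ = _ := Real.rpow_one _
  calc M / d * (g / N) * (κ / K * (d / g) ^ 2) ^ (4 : ℝ) * (K ^ η * (N / g + K ^ ξ))
      ≤ M / d * (g / N) * ((κ / K) ^ (4 : ℝ) * (d / g)) * (K ^ η * (N / g + K ^ ξ)) := by gcongr
    _ = M / N * ((κ / K) ^ (4 : ℝ) * (K ^ η * (N / g + K ^ ξ))) := by field_simp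
    _ ≤ M / N * (2 * N * N ^ (3 * η)) := by gcongr
    _ = _ := by field_simp

end WeightEstimates

/-- Passing from the dual weights in terms of `N`, `M`, `g` to those in
`bilinear_divisor_sum_le`. -/
theorem dual_weight_transfer {N M g d K γ s σ W Ω : ℝ} (hN : 0 < N) (hM : 0 < M) (hg : 0 < g)
    (hd : 0 < d) (hK : 0 < K) (hγ : 0 < γ) (hγd : γ ≤ d) (hσ : 0 ≤ σ) (hs : 0 < s) (hW : 0 ≤ W)
    (h : M / d * (g / N) * (N ^ 2 / M / K * (d / g) ^ 2) ^ σ * W ≤ Ω) :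
    M / d * (K * s ^ 2 * M / γ ^ 2) ^ (-σ) * W ≤ Ω * (N / g) ^ (1 - 2 * σ) * s ^ (-2 * σ) := by
  have h1 : (K * s ^ 2 * M / γ ^ 2) ^ (-σ) ≤
      (N ^ 2 / M / K * (d / g) ^ 2) ^ σ * (N / g) ^ (-2 * σ) * s ^ (-2 * σ) := by
    calc (K * s ^ 2 * M / γ ^ 2) ^ (-σ) ≤ (K * s ^ 2 * M / d ^ 2) ^ (-σ) := by
          refine Real.rpow_le_rpow_of_nonpos (by positivity) ?_ (by linarith)
          gcongr
      _ = (N ^ 2 / M / K * (d / g) ^ 2 * (((N / g) ^ 2)⁻¹ * (s ^ 2)⁻¹)) ^ σ := by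
          rw [Real.rpow_neg (by positivity), ← Real.inv_rpow (by positivity)]
          congr 1
          field_simp
      _ = _ := by
          have h2 : ∀ x : ℝ, 0 < x → ((x ^ 2)⁻¹) ^ σ = x ^ (-2 * σ) := by
            intro x hx
            rw [← Real.rpow_natCast, ← Real.rpow_neg hx.le, ← Real.rpow_mul hx.le]
            norm_num
          rw [Real.mul_rpow (x := _ * _) (by positivity) (by positivity),
            Real.mul_rpow (x := (_)⁻¹) (by positivity) (by positivity), h2 _ (by positivity),
            h2 _ hs]
          ring
  calc M / d * (K * s ^ 2 * M / γ ^ 2) ^ (-σ) * W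
      ≤ M / d * ((N ^ 2 / M / K * (d / g) ^ 2) ^ σ * (N / g) ^ (-2 * σ) * s ^ (-2 * σ)) * W := by
        gcongr
    _ = (M / d * (g / N) * (N ^ 2 / M / K * (d / g) ^ 2) ^ σ * W) *
        ((N / g) * (N / g) ^ (-2 * σ)) * s ^ (-2 * σ) := by field_simp
    _ ≤ Ω * ((N / g) * (N / g) ^ (-2 * σ)) * s ^ (-2 * σ) := by gcongr
    _ = _ := by
        rw [sub_eq_add_neg, Real.rpow_add (by positivity), Real.rpow_one]
        ring_nf

/-- Weights `n ^ (-1/2)` on a dyadic interval. -/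
theorem dyadic_weight_le {Y n t σ : ℝ} (hn : Y / 2 < n) (hnY : n ≤ Y) (hY : 0 < Y) (hσ : 0 ≤ σ)
    (ht : 0 ≤ t) : t / √n * (1 / n) ^ (-σ) ≤ √2 * Y ^ (σ - 1 / 2) * t := by
  have hn0 : 0 < n := by linarith
  have h1 : (1 / n) ^ (-σ) ≤ Y ^ σ := by
    rw [one_div, Real.inv_rpow hn0.le, Real.rpow_neg hn0.le, inv_inv]
    exact Real.rpow_le_rpow hn0.le hnY hσ
  have h2 : 1 / √n ≤ √2 * Y ^ (-(1 / 2) : ℝ) := by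
    rw [Real.rpow_neg hY.le, ← Real.sqrt_eq_rpow, ← div_eq_mul_inv, div_le_div_iff₀ (by positivity)
      (by positivity), one_mul, ← Real.sqrt_mul (by norm_num)]
    exact Real.sqrt_le_sqrt (by linarith)
  calc t / √n * (1 / n) ^ (-σ) = (1 / √n) * (1 / n) ^ (-σ) * t := by ring
    _ ≤ √2 * Y ^ (-(1 / 2) : ℝ) * Y ^ σ * t := by gcongr
    _ = _ := by
      rw [mul_assoc √2, ← Real.rpow_add hY]
      ring_nf

/-- The bilinear form over coprime pairs with kernel depending on the product. -/
noncomputable def coprimeForm (S : Finset ℕ) (b₁ b₂ : ℕ → ℂ) (F : ℕ → ℂ) : ℂ :=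
  ∑ n₁ ∈ S, ∑ n₂ ∈ S, (if n₁.Coprime n₂ then 1 else 0) * (b₁ n₁ * b₂ n₂ * F (n₁ * n₂))

section CoprimeForm

variable {S : Finset ℕ} {b₁ b₂ : ℕ → ℂ}

theorem coprimeForm_congr {F G : ℕ → ℂ}
    (h : ∀ n₁ ∈ S, ∀ n₂ ∈ S, n₁.Coprime n₂ → F (n₁ * n₂) = G (n₁ * n₂)) :
    coprimeForm S b₁ b₂ F = coprimeForm S b₁ b₂ G := by
  refine Finset.sum_congr rfl fun n₁ h₁ => Finset.sum_congr rfl fun n₂ h₂ => ?_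
  split_ifs with hc
  · rw [h n₁ h₁ n₂ h₂ hc]
  · simp

theorem coprimeForm_sub (F G : ℕ → ℂ) :
    coprimeForm S b₁ b₂ (fun q => F q - G q) = coprimeForm S b₁ b₂ F - coprimeForm S b₁ b₂ G := by
  simp_rw [coprimeForm, ← Finset.sum_sub_distrib]
  exact Finset.sum_congr rfl fun n₁ _ => Finset.sum_congr rfl fun n₂ _ => by ring

theorem coprimeForm_add (F G : ℕ → ℂ) :
    coprimeForm S b₁ b₂ (fun q => F q + G q) = coprimeForm S b₁ b₂ F + coprimeForm S b₁ b₂ G := by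
  simp_rw [coprimeForm, ← Finset.sum_add_distrib]
  exact Finset.sum_congr rfl fun n₁ _ => Finset.sum_congr rfl fun n₂ _ => by ring

theorem coprimeForm_sum {ι : Type*} (A : Finset ι) (F : ι → ℕ → ℂ) :
    coprimeForm S b₁ b₂ (fun q => ∑ i ∈ A, F i q) = ∑ i ∈ A, coprimeForm S b₁ b₂ (F i) := by
  simp_rw [coprimeForm, Finset.mul_sum]
  rw [Finset.sum_congr rfl fun n₁ _ => Finset.sum_comm, Finset.sum_comm]

theorem coprimeForm_hasSum {ι : Type*} {F : ι → ℕ → ℂ} {G : ℕ → ℂ}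
    (h : ∀ n₁ ∈ S, ∀ n₂ ∈ S, HasSum (fun i => F i (n₁ * n₂)) (G (n₁ * n₂))) :
    HasSum (fun i => coprimeForm S b₁ b₂ (F i)) (coprimeForm S b₁ b₂ G) :=
  hasSum_sum fun n₁ h₁ => hasSum_sum fun n₂ h₂ => ((h n₁ h₁ n₂ h₂).mul_left _).mul_left _

end CoprimeForm

theorem rpow_mul_sum_sq_eq {Y : ℝ} (hY : 0 < Y) (σ : ℝ) (S : Finset ℕ) (t : ℕ → ℝ) :
    Y ^ (1 - 2 * σ) * ∑ n ∈ S, n.divisors.card * (√2 * Y ^ (σ - 1 / 2) * t n) ^ 2 =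
      2 * ∑ n ∈ S, n.divisors.card * t n ^ 2 := by
  have h2 : Y ^ (1 - 2 * σ) * (Y ^ (σ - 1 / 2)) ^ 2 = 1 := by
    rw [← Real.rpow_natCast, ← Real.rpow_mul hY.le, ← Real.rpow_add hY]
    ring_nf
    simp
  rw [Finset.mul_sum, Finset.mul_sum]
  refine Finset.sum_congr rfl fun n _ => ?_
  rw [mul_pow, mul_pow, Real.sq_sqrt (by norm_num)]
  linear_combination (2 * n.divisors.card * t n ^ 2) * h2

open scoped Classical in
theorem SquarefreePair.sum_image (Φ : Finset SquarefreePair) (G : ℕ → ℕ → ℂ) :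
    ∑ s ∈ Φ.image root, ∑ K ∈ Φ.image kernel,
      (if ∃ p ∈ Φ, p.kernel = K ∧ p.root = s then G K s else 0) = ∑ p ∈ Φ, G p.kernel p.root := by
  rw [← Finset.sum_product', ← Finset.sum_filter]
  symm
  refine Finset.sum_nbij (fun p => (p.root, p.kernel)) ?_ ?_ ?_ fun _ _ => rfl
  · intro p hp
    simp only [Finset.mem_filter, Finset.mem_product]
    exact ⟨⟨Finset.mem_image_of_mem _ hp, Finset.mem_image_of_mem _ hp⟩, p, hp, rfl, rfl⟩
  · intro p _ p' _ h
    have := Prod.ext_iff.mp h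
    exact Subtype.ext (Prod.ext this.2 this.1)
  · rintro ⟨s, K⟩ h
    obtain ⟨-, p, hp, rfl, rfl⟩ := Finset.mem_filter.mp (Finset.mem_coe.mp h)
    exact ⟨p, hp, rfl⟩

section PairBounds

variable {ξ η C : ℝ} (hP : KernelSieveBound ξ η C) (hC : 0 ≤ C) {N M : ℝ} (hN : 1 ≤ N) (hM : 0 < M)
  (hη : 0 < η)
  {g : ℕ} (hg0 : g ≠ 0) (hg : (g : ℝ) ≤ N) {S : Finset ℕ}
  (hS : ∀ n ∈ S, Odd n ∧ Squarefree n ∧ (n : ℝ) ≤ N / g)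
  {b₁ b₂ : ℕ → ℂ} {β : ℕ → ℝ} (hb₁ : ∀ n ∈ S, ‖b₁ n‖ ≤ β n) (hb₂ : ∀ n ∈ S, ‖b₂ n‖ ≤ β n)

include hP hC hN hM hη hg0 hg hS hb₁ hb₂

theorem norm_coprimeForm_origin_le (hκξ : (N ^ 2 / M) ^ ξ ≤ N) (hξ : 1 ≤ ξ) {Cδ : ℝ} {c : ℂ}
    (hδ : SeparatesVars (squareGaussError c) η Cδ) (hCδ : 0 ≤ Cδ) (hcop : ∀ n ∈ S, g.Coprime n)
    {𝒦 : Finset ℕ} (h𝒦 : ∀ K ∈ 𝒦, Squarefree K ∧ (K : ℝ) ≤ N ^ 2 / M) :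
    ‖coprimeForm S b₁ b₂ fun q => ∑ K ∈ 𝒦, jacobiChi q K * ((if K.Coprime g then 1 else 0) *
      ∑ e ∈ (g * q).divisors, (ArithmeticFunction.moebius e : ℂ) *
        squareGaussError c (K / M * e ^ 2))‖ ≤
    2 * Cδ * C * N * M ^ η * N ^ η * g.divisors.card * ∑ n ∈ S, n.divisors.card ^ 3 * β n ^ 2 := by
  have hg0' : (0 : ℝ) < g := by positivity
  have hg1 : (1 : ℝ) ≤ g := by exact_mod_cast Nat.pos_of_ne_zero hg0
  have hK0 : ∀ K ∈ 𝒦, (0 : ℝ) < K := fun K hK => by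
    exact_mod_cast Nat.pos_of_ne_zero (h𝒦 K hK).1.ne_zero
  have key := bilinear_divisor_sum_le hP hC ((one_le_div hg0').mpr hg) hS (fun K hK => (h𝒦 K hK).1)
    hδ (y := 1) (fun _ _ => one_pos) (b₁ := b₁) (b₂ := b₂) (β := fun n => β n * n.divisors.card)
    hη.le hcop (w := fun K => if K.Coprime g then 1 else 0) (X := fun K => K / M)
    (Ω := M ^ η * g.divisors.card * (2 * N)) (by positivity)
    (fun K hK => div_pos (hK0 K hK) hM) ?_ ?_ ?_
  · refine (le_of_eq (congrArg norm ?_)).trans (key.trans ?_)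
    · rw [coprimeForm_sum]
      refine Finset.sum_congr rfl fun K _ => ?_
      rw [coprimeForm]
      refine Eq.trans ?_ (Finset.mul_sum _ _ _).symm
      refine Finset.sum_congr rfl fun n₁ h₁ => ?_
      refine Eq.trans ?_ (Finset.mul_sum _ _ _).symm
      refine Finset.sum_congr rfl fun n₂ h₂ => ?_
      rw [jacobiChi_mul_modulus (hS _ h₁).2.1.ne_zero (hS _ h₂).2.1.ne_zero]
      simp only [Pi.one_apply, mul_one]
      ring
    · have h1 : (N / g) ^ η ≤ N ^ η :=
        Real.rpow_le_rpow (by positivity) (div_le_self (by positivity) hg1) hη.le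
      calc _ ≤ Cδ * (M ^ η * g.divisors.card * (2 * N) * (C * N ^ η *
            ∑ n ∈ S, (n.divisors.card : ℝ) * (β n * n.divisors.card) ^ 2)) := by gcongr
        _ = 2 * Cδ * C * N * M ^ η * N ^ η * g.divisors.card *
            ∑ n ∈ S, (n.divisors.card : ℝ) * (β n * n.divisors.card) ^ 2 := by ring
        _ = _ := by
          congr 1
          exact Finset.sum_congr rfl fun n _ => by ring
  · intro K hK
    have h1 : ‖(if K.Coprime g then 1 else 0 : ℂ)‖ ≤ 1 := by split_ifs <;> simp
    have h2 : (K / M : ℝ) ^ (-η) * (K : ℝ) ^ η = M ^ η := by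
      rw [Real.div_rpow (hK0 K hK).le hM.le, Real.rpow_neg (hK0 K hK).le, Real.rpow_neg hM.le]
      have := Real.rpow_pos_of_pos (hK0 K hK) η
      field_simp
    have h3 : (K : ℝ) ^ ξ ≤ N :=
      (Real.rpow_le_rpow (hK0 K hK).le (h𝒦 K hK).2 (by linarith)).trans hκξ
    have := hK0 K hK
    calc _ ≤ 1 * (K / M : ℝ) ^ (-η) * g.divisors.card * ((K : ℝ) ^ η * (N + N)) := by
          gcongr
          exact div_le_self (by positivity) hg1
      _ = (K / M : ℝ) ^ (-η) * (K : ℝ) ^ η * g.divisors.card * (2 * N) := by ring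
      _ = _ := by rw [h2]
  · intro n hn
    simpa using mul_le_mul_of_nonneg_right (hb₁ n hn) (Nat.cast_nonneg n.divisors.card)
  · intro n hn
    simpa using mul_le_mul_of_nonneg_right (hb₂ n hn) (Nat.cast_nonneg n.divisors.card)

variable (hdy : ∀ n ∈ S, N / g / 2 < n) {d : ℕ} (hd : d ∈ g.divisors)

include hdy hd

theorem norm_coprimeForm_dual_le {σ Cδ Ω : ℝ} (hσ : 0 ≤ σ) {c : ℂ}
    (hδ : SeparatesVars (squareGaussError c) σ Cδ) (hCδ : 0 ≤ Cδ) (hΩ : 0 ≤ Ω)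
    {𝒦 : Finset ℕ} (h𝒦 : ∀ K ∈ 𝒦, Squarefree K) (hW : ∀ K ∈ 𝒦,
      M / d * (g / N) * (N ^ 2 / M / K * (d / g) ^ 2) ^ σ * ((K : ℝ) ^ η * (N / g + (K : ℝ) ^ ξ)) ≤
        Ω) :
    ‖coprimeForm S b₁ b₂ fun q => ∑ K ∈ 𝒦, jacobiChi q K * (M / √(q : ℝ) *
      ((ArithmeticFunction.moebius d / d : ℂ) * ∑ e ∈ q.divisors,
        (ArithmeticFunction.moebius e : ℂ) *
          squareGaussError c (K * M / ((d.gcd K : ℝ) ^ 2 * q) * e ^ 2)))‖ ≤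
    2 * Cδ * C * Ω * N ^ η * ∑ n ∈ S, n.divisors.card ^ 3 * β n ^ 2 := by
  have hg0' : (0 : ℝ) < g := by positivity
  have hg1 : (1 : ℝ) ≤ g := by exact_mod_cast Nat.pos_of_ne_zero hg0
  have hd0 : (0 : ℝ) < d := by exact_mod_cast Nat.pos_of_mem_divisors hd
  have hK0 : ∀ K ∈ 𝒦, (0 : ℝ) < K := fun K hK => by
    exact_mod_cast Nat.pos_of_ne_zero (h𝒦 K hK).ne_zero
  have hγ : ∀ K, (0 : ℝ) < d.gcd K := fun K => by
    exact_mod_cast Nat.gcd_pos_of_pos_left _ (Nat.pos_of_mem_divisors hd)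
  have hn0 : ∀ n ∈ S, (0 : ℝ) < n := fun n hn => by
    exact_mod_cast Nat.pos_of_ne_zero (hS n hn).2.1.ne_zero
  have hb : ∀ b : ℕ → ℂ, (∀ n ∈ S, ‖b n‖ ≤ β n) → ∀ n ∈ S, ‖b n / √(n : ℝ)‖ *
      (1 / n : ℝ) ^ (-σ) * n.divisors.card ≤
        √2 * (N / g) ^ (σ - 1 / 2) * (β n * n.divisors.card) := by
    intro b hb n hn
    have h1 := dyadic_weight_le (hdy n hn) (hS n hn).2.2 (by positivity) hσ (norm_nonneg (b n))
    rw [norm_div, Complex.norm_real, Real.norm_of_nonneg (Real.sqrt_nonneg _)]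
    calc _ ≤ √2 * (N / g) ^ (σ - 1 / 2) * ‖b n‖ * n.divisors.card := by gcongr
      _ = √2 * (N / g) ^ (σ - 1 / 2) * (‖b n‖ * n.divisors.card) := by ring
      _ ≤ _ := by gcongr; exact hb n hn
  have key := bilinear_divisor_sum_le hP hC ((one_le_div hg0').mpr hg) hS h𝒦
    hδ (y := fun n => 1 / n) (fun n hn => one_div_pos.mpr (hn0 n hn))
    (b₁ := fun n => b₁ n / √(n : ℝ)) (b₂ := fun n => b₂ n / √(n : ℝ))
    (β := fun n => √2 * (N / g) ^ (σ - 1 / 2) * (β n * n.divisors.card))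
    hσ (h := 1) (fun _ _ => Nat.coprime_one_left _)
    (w := fun _ => M * (ArithmeticFunction.moebius d / d : ℂ))
    (X := fun K => K * M / (d.gcd K : ℝ) ^ 2)
    (Ω := Ω * (N / g) ^ (1 - 2 * σ)) (by positivity)
    (fun K hK => by have := hK0 K hK; have := hγ K; positivity) ?_ (hb b₁ hb₁) (hb b₂ hb₂)
  · refine (le_of_eq (congrArg norm ?_)).trans (key.trans ?_)
    · rw [coprimeForm_sum]
      refine Finset.sum_congr rfl fun K _ => ?_
      rw [coprimeForm]
      refine Eq.trans ?_ (Finset.mul_sum _ _ _).symm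
      refine Finset.sum_congr rfl fun n₁ h₁ => ?_
      refine Eq.trans ?_ (Finset.mul_sum _ _ _).symm
      refine Finset.sum_congr rfl fun n₂ h₂ => ?_
      have h3 : ∀ e : ℕ, (K : ℝ) * M / (d.gcd K : ℝ) ^ 2 * (1 / n₁ * (1 / n₂)) * (e : ℝ) ^ 2 =
          K * M / ((d.gcd K : ℝ) ^ 2 * (n₁ * n₂ : ℕ)) * e ^ 2 := by
        intro e
        push_cast
        field_simp
      simp_rw [h3, one_mul]
      rw [jacobiChi_mul_modulus (hS _ h₁).2.1.ne_zero (hS _ h₂).2.1.ne_zero, Nat.cast_mul,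
        Real.sqrt_mul (by positivity)]
      push_cast
      ring
    · have h1 : (N / g) ^ η ≤ N ^ η :=
        Real.rpow_le_rpow (by positivity) (div_le_self (by positivity) hg1) hη.le
      have h2 := rpow_mul_sum_sq_eq (Y := N / g) (by positivity) σ S fun n => β n * n.divisors.card
      have h4 : ∑ n ∈ S, (n.divisors.card : ℝ) * (β n * n.divisors.card) ^ 2 =
          ∑ n ∈ S, n.divisors.card ^ 3 * β n ^ 2 := Finset.sum_congr rfl fun n _ => by ring
      have h5 : 0 ≤ ∑ n ∈ S, (n.divisors.card : ℝ) ^ 3 * β n ^ 2 :=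
        Finset.sum_nonneg fun n _ => by positivity
      rw [h4] at h2
      generalize ∑ n ∈ S, (n.divisors.card : ℝ) ^ 3 * β n ^ 2 = B at h2 h5 ⊢
      rw [show ∀ x z : ℝ, Cδ * (Ω * x * (C * (N / g) ^ η * z)) =
        Cδ * C * Ω * (N / g) ^ η * (x * z) by intros; ring, h2]
      calc _ ≤ Cδ * C * Ω * N ^ η * (2 * B) := by gcongr
        _ = _ := by ring
  · intro K hK
    have h6 := dual_weight_transfer (by positivity) hM hg0' hd0 (hK0 K hK) (hγ K)
      (by exact_mod_cast Nat.gcd_le_left _ (Nat.pos_of_mem_divisors hd)) hσ one_pos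
      (by have := hK0 K hK; positivity) (hW K hK)
    simp only [one_pow, mul_one, Real.one_rpow] at h6
    refine le_trans ?_ h6
    have h7 : ‖(M * (ArithmeticFunction.moebius d / d : ℂ))‖ ≤ M / d := by
      rw [norm_mul, norm_div, Complex.norm_natCast, Complex.norm_real, Real.norm_of_nonneg hM.le,
        mul_div_assoc']
      gcongr
      exact mul_le_of_le_one_right hM.le (norm_moebius_le_one d)
    have := hK0 K hK
    have := hγ K
    simp only [Nat.divisors_one, Finset.card_singleton, Nat.cast_one, mul_one]
    gcongr

theorem norm_coprimeForm_tail_finset_le {CV Ω : ℝ} (hV : SeparatesVars gaussWeight 4 CV)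
    (hCV : 0 ≤ CV) (hΩ : 0 ≤ Ω) (Φ : Finset SquarefreePair) (hW : ∀ p ∈ Φ,
      M / d * (g / N) * (N ^ 2 / M / p.kernel * (d / g) ^ 2) ^ (4 : ℝ) *
        ((p.kernel : ℝ) ^ η * (N / g + (p.kernel : ℝ) ^ ξ)) ≤ Ω) :
    ‖coprimeForm S b₁ b₂ fun q => ∑ p ∈ Φ, M / √(q : ℝ) * (if d ∣ p.value then
        (ArithmeticFunction.moebius d / d : ℂ) * (gaussWeight (p.value * (M / (d ^ 2 * q))) *
          jacobiChi q p.value) else 0)‖ ≤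
    2 * (∑' s : ℕ, (s : ℝ) ^ (-2 * 4 : ℝ)) * CV * C * Ω * N ^ η *
      ∑ n ∈ S, n.divisors.card ^ 3 * β n ^ 2 := by
  have hg0' : (0 : ℝ) < g := by positivity
  have hg1 : (1 : ℝ) ≤ g := by exact_mod_cast Nat.pos_of_ne_zero hg0
  have hd0 : (0 : ℝ) < d := by exact_mod_cast Nat.pos_of_mem_divisors hd
  have hn0 : ∀ n ∈ S, (0 : ℝ) < n := fun n hn => by
    exact_mod_cast Nat.pos_of_ne_zero (hS n hn).2.1.ne_zero
  have hb : ∀ b : ℕ → ℂ, (∀ n ∈ S, ‖b n‖ ≤ β n) → ∀ n ∈ S, ‖b n / √(n : ℝ)‖ *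
      (1 / n : ℝ) ^ (-4 : ℝ) ≤ √2 * (N / g) ^ (4 - 1 / 2 : ℝ) * β n := by
    intro b hb n hn
    have h1 := dyadic_weight_le (hdy n hn) (hS n hn).2.2 (by positivity) (by norm_num : (0 : ℝ) ≤ 4)
      (norm_nonneg (b n))
    rw [norm_div, Complex.norm_real, Real.norm_of_nonneg (Real.sqrt_nonneg _)]
    refine h1.trans ?_
    gcongr
    exact hb n hn
  classical
  let w : ℕ → ℕ → ℂ := fun K s => if ∃ p ∈ Φ, p.kernel = K ∧ p.root = s then
    if d ∣ K * s ^ 2 then M * (ArithmeticFunction.moebius d / d : ℂ) else 0 else 0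
  have hw1 : ∀ K s, ‖w K s‖ ≤ M / d := by
    intro K s
    have h7 : ‖(M * (ArithmeticFunction.moebius d / d : ℂ))‖ ≤ M / d := by
      rw [norm_mul, norm_div, Complex.norm_natCast, Complex.norm_real, Real.norm_of_nonneg hM.le,
        mul_div_assoc']
      gcongr
      exact mul_le_of_le_one_right hM.le (norm_moebius_le_one d)
    simp only [w]
    split_ifs
    · exact h7
    · rw [norm_zero]; positivity
    · rw [norm_zero]; positivity
  have hs0 : ∀ s ∈ Φ.image SquarefreePair.root, (0 : ℝ) < s := by
    intro s hs
    obtain ⟨p, -, rfl⟩ := Finset.mem_image.mp hs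
    exact_mod_cast p.root_pos
  have h𝒦 : ∀ K ∈ Φ.image SquarefreePair.kernel, Squarefree K := by
    intro K hK
    obtain ⟨p, -, rfl⟩ := Finset.mem_image.mp hK
    exact p.squarefree_kernel
  have hK0 : ∀ K ∈ Φ.image SquarefreePair.kernel, (0 : ℝ) < K := fun K hK => by
    exact_mod_cast Nat.pos_of_ne_zero (h𝒦 K hK).ne_zero
  have key := bilinear_square_sum_le hP hC ((one_le_div hg0').mpr hg) hS h𝒦
    hV (y := fun n => 1 / n) (fun n hn => one_div_pos.mpr (hn0 n hn))
    (b₁ := fun n => b₁ n / √(n : ℝ)) (b₂ := fun n => b₂ n / √(n : ℝ))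
    (β := fun n => √2 * (N / g) ^ (4 - 1 / 2 : ℝ) * β n)
    (𝒯 := Φ.image SquarefreePair.root) (w := w) (X := fun K s => K * s ^ 2 * M / (d : ℝ) ^ 2)
    (Ω := fun s => Ω * (N / g) ^ (1 - 2 * 4 : ℝ) * s ^ (-2 * 4 : ℝ))
    (fun s hs => by positivity)
    (fun s hs K hK => by have := hK0 K hK; have := hs0 s hs; positivity) ?_ (hb b₁ hb₁) (hb b₂ hb₂)
  · refine (le_of_eq (congrArg norm ?_)).trans (key.trans ?_)
    · rw [coprimeForm_sum]
      have hw2 : ∀ K s z, w K s * z = if ∃ p ∈ Φ, p.kernel = K ∧ p.root = s then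
          (if d ∣ K * s ^ 2 then M * (ArithmeticFunction.moebius d / d : ℂ) else 0) * z else 0 :=
        fun K s z => by rw [ite_mul, zero_mul]
      simp_rw [hw2]
      rw [SquarefreePair.sum_image Φ]
      refine Finset.sum_congr rfl fun p _ => ?_
      rw [coprimeForm]
      by_cases hdv : d ∣ p.value
      · rw [if_pos (show d ∣ p.kernel * p.root ^ 2 from hdv)]
        simp only [if_pos hdv]
        refine Eq.trans ?_ (Finset.mul_sum _ _ _).symm
        refine Finset.sum_congr rfl fun n₁ h₁ => ?_
        refine Eq.trans ?_ (Finset.mul_sum _ _ _).symm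
        refine Finset.sum_congr rfl fun n₂ h₂ => ?_
        have hχ : ∀ n ∈ S, jacobiChi n p.value =
            (if p.root.Coprime n then 1 else 0) * jacobiChi n p.kernel := by
          intro n hn
          rw [SquarefreePair.value, jacobiChi_mul, sq, jacobiChi_mul, ← sq,
            jacobiChi_sq (hS n hn).2.1.ne_zero, mul_comm]
        have harg : (p.value : ℝ) * (M / (d ^ 2 * (n₁ * n₂ : ℕ))) =
            p.kernel * p.root ^ 2 * M / d ^ 2 * (1 / n₁ * (1 / n₂)) := by
          rw [SquarefreePair.value]
          push_cast
          field_simp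
        rw [jacobiChi_mul_modulus (hS _ h₁).2.1.ne_zero (hS _ h₂).2.1.ne_zero, hχ _ h₁, hχ _ h₂,
          harg, Nat.cast_mul, Real.sqrt_mul (by positivity)]
        push_cast
        ring
      · rw [if_neg (show ¬d ∣ p.kernel * p.root ^ 2 from hdv)]
        simp [if_neg hdv]
    · have h1 : (N / g) ^ η ≤ N ^ η :=
        Real.rpow_le_rpow (by positivity) (div_le_self (by positivity) hg1) hη.le
      have h2 := rpow_mul_sum_sq_eq (Y := N / g) (by positivity) 4 S β
      have h4 : ∑ n ∈ S, (n.divisors.card : ℝ) * β n ^ 2 ≤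
          ∑ n ∈ S, n.divisors.card ^ 3 * β n ^ 2 := by
        refine Finset.sum_le_sum fun n hn => ?_
        gcongr
        refine le_self_pow₀ ?_ (by norm_num)
        exact_mod_cast Finset.card_pos.mpr (Nat.nonempty_divisors.mpr (hS n hn).2.1.ne_zero)
      have h5 : ∑ s ∈ Φ.image SquarefreePair.root, (s : ℝ) ^ (-2 * 4 : ℝ) ≤
          ∑' s : ℕ, (s : ℝ) ^ (-2 * 4 : ℝ) :=
        (Real.summable_nat_rpow.mpr (by norm_num)).sum_le_tsum _ fun s _ => by positivity
      have h6 : 0 ≤ ∑ n ∈ S, (n.divisors.card : ℝ) * β n ^ 2 :=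
        Finset.sum_nonneg fun n _ => by positivity
      rw [← Finset.mul_sum]
      generalize ∑ n ∈ S, (n.divisors.card : ℝ) ^ 3 * β n ^ 2 = B at h4 ⊢
      generalize ∑ n ∈ S, (n.divisors.card : ℝ) * β n ^ 2 = B' at h2 h4 h6
      generalize ∑' s : ℕ, (s : ℝ) ^ (-2 * 4 : ℝ) = Z at h5 ⊢
      rw [show ∀ x y z : ℝ, CV * (Ω * x * y * (C * (N / g) ^ η * z)) =
        y * CV * C * Ω * (N / g) ^ η * (x * z) by intros; ring, h2]
      have h8 : 0 ≤ Z := le_trans (Finset.sum_nonneg fun s _ => by positivity) h5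
      calc _ ≤ Z * CV * C * Ω * N ^ η * (2 * B) := by gcongr
        _ = _ := by ring
  · intro s hs K hK
    by_cases hp : ∃ p ∈ Φ, p.kernel = K ∧ p.root = s
    · obtain ⟨p, hp, rfl, rfl⟩ := hp
      have h6 := dual_weight_transfer (by positivity) hM hg0' hd0 (hK0 _ hK) hd0 le_rfl
        (by norm_num) (hs0 _ hs) (by have := hK0 _ hK; positivity) (hW p hp)
      refine le_trans ?_ h6
      have := hK0 _ hK
      gcongr
      exact hw1 _ _
    · simp only [w, if_neg hp, norm_zero, zero_mul]
      have := hs0 s hs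
      positivity

end PairBounds

theorem norm_coprimeForm_tsum_le {ι : Type*} {S : Finset ℕ} {b₁ b₂ : ℕ → ℂ} {F : ι → ℕ → ℂ} {B : ℝ}
    (hF : ∀ n₁ ∈ S, ∀ n₂ ∈ S, Summable fun i => F i (n₁ * n₂))
    (h : ∀ Φ : Finset ι, ‖coprimeForm S b₁ b₂ fun q => ∑ i ∈ Φ, F i q‖ ≤ B) :
    ‖coprimeForm S b₁ b₂ fun q => ∑' i, F i q‖ ≤ B := by
  have hsum : HasSum (fun i => coprimeForm S b₁ b₂ (F i))
      (coprimeForm S b₁ b₂ fun q => ∑' i, F i q) :=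
    coprimeForm_hasSum fun n₁ h₁ n₂ h₂ => (hF n₁ h₁ n₂ h₂).hasSum
  refine le_of_tendsto hsum.norm (Filter.Eventually.of_forall fun Φ => ?_)
  rw [← coprimeForm_sum]
  exact h Φ

theorem summable_dual_term {M : ℝ} (hM : 0 < M) (g k : ℕ) {q : ℕ} (hq : q ≠ 0) :
    Summable fun p : SquarefreePair => if k < p.kernel then M / √(q : ℝ) * ∑ d ∈ g.divisors,
      (if d ∣ p.value then (ArithmeticFunction.moebius d / d : ℂ) *
        (gaussWeight (p.value * (M / (d ^ 2 * q))) * jacobiChi q p.value) else 0) else 0 := by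
  suffices h : Summable fun m : ℕ => (M / √(q : ℝ) * ∑ d ∈ g.divisors,
      (if d ∣ m then (ArithmeticFunction.moebius d / d : ℂ) *
        (gaussWeight (m * (M / (d ^ 2 * q))) * jacobiChi q m) else 0) : ℂ) by
    refine ((h.comp_injective SquarefreePair.value_injective).indicator
      {p | k < p.kernel}).congr fun p => ?_
    rw [Set.indicator_apply]
    rfl
  refine Summable.mul_left _ (summable_sum fun d hd => ?_)
  have hd1 : (1 : ℝ) ≤ d := by exact_mod_cast Nat.pos_of_mem_divisors hd
  have h1 := summable_gaussWeight_mul (c := M / (d ^ 2 * q)) (by positivity)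
    (f := fun m => if d ∣ m then (ArithmeticFunction.moebius d / d : ℂ) * jacobiChi q m else 0) ?_
  · refine h1.congr fun m => ?_
    split_ifs
    · rw [mul_comm (m : ℝ)]
      ring
    · simp
  · intro m
    split_ifs
    · rw [norm_mul, norm_div, Complex.norm_natCast]
      exact mul_le_one₀ ((div_le_one (by positivity)).mpr ((norm_moebius_le_one d).trans hd1))
        (norm_nonneg _) (norm_jacobiChi_le_one q m)
    · simp

section PairBounds

variable {ξ η C : ℝ} (hP : KernelSieveBound ξ η C) (hC : 0 ≤ C) {N M : ℝ} (hN : 1 ≤ N)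
  (hNM : N ≤ M) (hκξ : (N ^ 2 / M) ^ ξ ≤ N) (hξ : 1 ≤ ξ) (hη : 0 < η) (hξη : ξ + η ≤ 4)
  {g : ℕ} (hg0 : g ≠ 0) (hg : (g : ℝ) ≤ N) {S : Finset ℕ}
  (hS : ∀ n ∈ S, Odd n ∧ Squarefree n ∧ (n : ℝ) ≤ N / g) (hdy : ∀ n ∈ S, N / g / 2 < n)
  {b₁ b₂ : ℕ → ℂ} {β : ℕ → ℝ} (hb₁ : ∀ n ∈ S, ‖b₁ n‖ ≤ β n) (hb₂ : ∀ n ∈ S, ‖b₂ n‖ ≤ β n)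

include hP hC hN hNM hκξ hξ hη hξη hg0 hg hS hdy hb₁ hb₂

theorem norm_coprimeForm_tail_le {CV : ℝ} (hV : SeparatesVars gaussWeight 4 CV) (hCV : 0 ≤ CV) :
    ‖coprimeForm S b₁ b₂ fun q => ∑' p : SquarefreePair, if ⌊N ^ 2 / M⌋₊ < p.kernel then
      M / √(q : ℝ) * ∑ d ∈ g.divisors, (if d ∣ p.value then
        (ArithmeticFunction.moebius d / d : ℂ) * (gaussWeight (p.value * (M / (d ^ 2 * q))) *
          jacobiChi q p.value) else 0) else 0‖ ≤
    g.divisors.card * (2 * (∑' s : ℕ, (s : ℝ) ^ (-2 * 4 : ℝ)) * CV * C * (2 * M * N ^ (3 * η)) *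
      N ^ η * ∑ n ∈ S, n.divisors.card ^ 3 * β n ^ 2) := by
  have hM : 0 < M := by linarith
  have hκ : 0 < N ^ 2 / M := by positivity
  have hκN : N ^ 2 / M ≤ N := by rw [div_le_iff₀ hM]; nlinarith
  refine norm_coprimeForm_tsum_le (fun n₁ h₁ n₂ h₂ => summable_dual_term hM g ⌊N ^ 2 / M⌋₊
    (mul_ne_zero (hS n₁ h₁).2.1.ne_zero (hS n₂ h₂).2.1.ne_zero)) fun Φ => ?_
  have h1 : (fun q : ℕ => ∑ p ∈ Φ, if ⌊N ^ 2 / M⌋₊ < p.kernel then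
      M / √(q : ℝ) * ∑ d ∈ g.divisors, (if d ∣ p.value then
        (ArithmeticFunction.moebius d / d : ℂ) * (gaussWeight (p.value * (M / (d ^ 2 * q))) *
          jacobiChi q p.value) else 0) else 0) = fun q : ℕ =>
      ∑ d ∈ g.divisors, ∑ p ∈ Φ.filter (⌊N ^ 2 / M⌋₊ < ·.kernel),
        M / √(q : ℝ) * (if d ∣ p.value then
          (ArithmeticFunction.moebius d / d : ℂ) * (gaussWeight (p.value * (M / (d ^ 2 * q))) *
            jacobiChi q p.value) else 0) := by
    ext q
    rw [Finset.sum_comm, Finset.sum_filter]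
    refine Finset.sum_congr rfl fun p _ => ?_
    rw [Finset.mul_sum]
  rw [h1, coprimeForm_sum, ← nsmul_eq_mul]
  refine (norm_sum_le _ _).trans (Finset.sum_le_card_nsmul _ _ _ fun d hd => ?_)
  refine norm_coprimeForm_tail_finset_le hP hC hN hM hη hg0 hg hS hb₁ hb₂ hdy hd hV hCV
    (by positivity) _ fun p hp => ?_
  refine dual_weight_le_of_large hN hM hκ hκN hκξ hξ hη ?_ ?_ ?_ hξη ?_
  · exact_mod_cast Nat.pos_of_mem_divisors hd
  · exact_mod_cast Nat.divisor_le hd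
  · exact_mod_cast Nat.pos_of_ne_zero p.squarefree_kernel.ne_zero
  · exact (Nat.lt_of_floor_lt (Finset.mem_filter.mp hp).2).le

omit hξη in
theorem norm_coprimeForm_error_le (hη' : η < 1 / 2) {c : ℂ} {Cδ Cδ' : ℝ}
    (hδ : SeparatesVars (squareGaussError c) η Cδ) (hCδ : 0 ≤ Cδ)
    (hδ' : SeparatesVars (squareGaussError c) (1 / 2 - η) Cδ') (hCδ' : 0 ≤ Cδ') :
    ‖coprimeForm S b₁ b₂ fun q => ∑ K ∈ (Finset.range (⌊N ^ 2 / M⌋₊ + 1)).filter Squarefree,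
      jacobiChi q K * (M / √(q : ℝ) * ∑ d ∈ g.divisors, (ArithmeticFunction.moebius d / d : ℂ) *
        ∑ e ∈ q.divisors, (ArithmeticFunction.moebius e : ℂ) *
          squareGaussError c (K * M / ((d.gcd K : ℝ) ^ 2 * q) * e ^ 2))‖ ≤
    g.divisors.card * (2 * (Cδ + Cδ') * C * (2 * M * N ^ (3 * η)) * N ^ η *
      ∑ n ∈ S, n.divisors.card ^ 3 * β n ^ 2) := by
  have hM : 0 < M := by linarith
  have hκ : 0 < N ^ 2 / M := by positivity
  have hκN : N ^ 2 / M ≤ N := by rw [div_le_iff₀ hM]; nlinarith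
  set 𝒦 := (Finset.range (⌊N ^ 2 / M⌋₊ + 1)).filter Squarefree with h𝒦
  have hmem : ∀ K ∈ 𝒦, Squarefree K ∧ (1 : ℝ) ≤ K ∧ (K : ℝ) ≤ N ^ 2 / M := by
    intro K hK
    rw [h𝒦, Finset.mem_filter, Finset.mem_range, Nat.lt_succ_iff, Nat.le_floor_iff hκ.le] at hK
    exact ⟨hK.2, by exact_mod_cast Nat.pos_of_ne_zero hK.2.ne_zero, hK.1⟩
  let P : ℕ → Prop := fun K => (K : ℝ) ≤ N ^ 2 / M / g ^ 2
  have hPdec : DecidablePred P := Classical.decPred P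
  let F : ℕ → ℕ → ℕ → ℂ := fun d K q => jacobiChi q K * (M / √(q : ℝ) *
    ((ArithmeticFunction.moebius d / d : ℂ) * ∑ e ∈ q.divisors,
      (ArithmeticFunction.moebius e : ℂ) *
        squareGaussError c (K * M / ((d.gcd K : ℝ) ^ 2 * q) * e ^ 2)))
  have h1 : (fun q : ℕ => ∑ K ∈ 𝒦, jacobiChi q K * (M / √(q : ℝ) * ∑ d ∈ g.divisors,
      (ArithmeticFunction.moebius d / d : ℂ) * ∑ e ∈ q.divisors,
        (ArithmeticFunction.moebius e : ℂ) *
          squareGaussError c (K * M / ((d.gcd K : ℝ) ^ 2 * q) * e ^ 2))) = fun q =>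
      ∑ d ∈ g.divisors, (∑ K ∈ 𝒦.filter P, F d K q + ∑ K ∈ 𝒦.filter (¬P ·), F d K q) := by
    ext q
    simp_rw [Finset.sum_filter_add_sum_filter_not]
    rw [Finset.sum_comm]
    refine Finset.sum_congr rfl fun K _ => ?_
    rw [Finset.mul_sum, Finset.mul_sum]
  rw [h1, coprimeForm_sum, ← nsmul_eq_mul]
  refine (norm_sum_le _ _).trans (Finset.sum_le_card_nsmul _ _ _ fun d hd => ?_)
  have hd1 : (1 : ℝ) ≤ d := by exact_mod_cast Nat.pos_of_mem_divisors hd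
  have hdg : (d : ℝ) ≤ g := by exact_mod_cast Nat.divisor_le hd
  rw [coprimeForm_add]
  have h2 := norm_coprimeForm_dual_le hP hC hN hM hη hg0 hg hS hb₁ hb₂ hdy hd hη.le hδ hCδ
    (Ω := 2 * M * N ^ (3 * η)) (by positivity) (𝒦 := 𝒦.filter P)
    (fun K hK => (hmem K (Finset.mem_filter.mp hK).1).1) fun K hK => by
      obtain ⟨hK, hKP⟩ := Finset.mem_filter.mp hK
      exact dual_weight_le_of_small hN hM hκ hκN hκξ hξ hη hd1 hdg (hmem K hK).2.1 hKP
  have h3 := norm_coprimeForm_dual_le hP hC hN hM hη hg0 hg hS hb₁ hb₂ hdy hd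
    (by linarith) hδ' hCδ'
    (Ω := 2 * M * N ^ (3 * η)) (by positivity) (𝒦 := 𝒦.filter (¬P ·))
    (fun K hK => (hmem K (Finset.mem_filter.mp hK).1).1) fun K hK => by
      obtain ⟨hK, hKP⟩ := Finset.mem_filter.mp hK
      exact dual_weight_le_of_medium hN hM hκ hκN hκξ hξ hη hd1 hdg (hmem K hK).2.1 hg
        (not_le.mp hKP).le (hmem K hK).2.2
  refine (norm_add_le _ _).trans ((add_le_add h2 h3).trans (le_of_eq ?_))
  ring

/-- The contribution of pairs with a fixed greatest common divisor `g`. -/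
theorem norm_coprimeForm_gauss_le (hη' : η < 1 / 2) {c : ℂ} {Cδ Cδ' CV : ℝ}
    (hδ : SeparatesVars (squareGaussError c) η Cδ) (hCδ : 0 ≤ Cδ)
    (hδ' : SeparatesVars (squareGaussError c) (1 / 2 - η) Cδ') (hCδ' : 0 ≤ Cδ')
    (hV : SeparatesVars gaussWeight 4 CV) (hCV : 0 ≤ CV) (hgsq : Squarefree g)
    (hcop : ∀ n ∈ S, g.Coprime n) (h4 : ∀ n₁ ∈ S, ∀ n₂ ∈ S, n₁ * n₂ % 4 = 1)
    (hS1 : ∀ n ∈ S, 1 < n) :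
    ‖coprimeForm S b₁ b₂ fun q => ∑' p : SquarefreePair, if ⌊N ^ 2 / M⌋₊ < p.kernel then
      gaussWeight (p.value / M) * (jacobiChi q p.value * if p.value.Coprime g then 1 else 0)
        else 0‖ ≤
    (6 * Cδ + 4 * Cδ' + 4 * (∑' s : ℕ, (s : ℝ) ^ (-2 * 4 : ℝ)) * CV) * C * (M * M ^ (4 * η)) *
      g.divisors.card * ∑ n ∈ S, n.divisors.card ^ 3 * β n ^ 2 := by
  have hM : 0 < M := by linarith
  have hκ : 0 < N ^ 2 / M := by positivity
  have h1 := norm_coprimeForm_tail_le hP hC hN hNM hκξ hξ hη hξη hg0 hg hS hdy hb₁ hb₂ hV hCV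
  have h2 := norm_coprimeForm_error_le hP hC hN hNM hκξ hξ hη hg0 hg hS hdy hb₁ hb₂ hη' hδ hCδ
    hδ' hCδ'
  have h3 := norm_coprimeForm_origin_le hP hC hN hM hη hg0 hg hS hb₁ hb₂ hκξ hξ hδ hCδ hcop
    (𝒦 := (Finset.range (⌊N ^ 2 / M⌋₊ + 1)).filter Squarefree) (fun K hK => by
      rw [Finset.mem_filter, Finset.mem_range, Nat.lt_succ_iff, Nat.le_floor_iff hκ.le] at hK
      exact ⟨hK.2, hK.1⟩)
  rw [coprimeForm_congr (G := fun q => (∑' p : SquarefreePair, if ⌊N ^ 2 / M⌋₊ < p.kernel then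
      M / √(q : ℝ) * ∑ d ∈ g.divisors, (if d ∣ p.value then
        (ArithmeticFunction.moebius d / d : ℂ) * (gaussWeight (p.value * (M / (d ^ 2 * q))) *
          jacobiChi q p.value) else 0) else 0) +
    ∑ K ∈ (Finset.range (⌊N ^ 2 / M⌋₊ + 1)).filter Squarefree, jacobiChi q K *
      (M / √(q : ℝ) * ∑ d ∈ g.divisors, (ArithmeticFunction.moebius d / d : ℂ) *
        ∑ e ∈ q.divisors, (ArithmeticFunction.moebius e : ℂ) *
          squareGaussError c (K * M / ((d.gcd K : ℝ) ^ 2 * q) * e ^ 2) -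
      (if K.Coprime g then 1 else 0) * ∑ e ∈ (g * q).divisors,
        (ArithmeticFunction.moebius e : ℂ) * squareGaussError c (K / M * e ^ 2)))
    fun n₁ h₁ n₂ h₂ hc => orig_eq_dual
      ((Nat.squarefree_mul hc).mpr ⟨(hS n₁ h₁).2.1, (hS n₂ h₂).2.1⟩) (h4 n₁ h₁ n₂ h₂)
      (Nat.one_lt_mul_iff.mpr ⟨by have := hS1 _ h₁; omega, by have := hS1 _ h₂; omega,
        Or.inl (hS1 _ h₁)⟩) hgsq ((hcop n₁ h₁).mul_right (hcop n₂ h₂)) hM ⌊N ^ 2 / M⌋₊ c]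
  rw [coprimeForm_add]
  simp_rw [mul_sub, Finset.sum_sub_distrib]
  rw [coprimeForm_sub]
  refine (norm_add_le _ _).trans ((add_le_add h1 ((norm_sub_le _ _).trans
    (add_le_add h2 h3))).trans ?_)
  have hB : 0 ≤ ∑ n ∈ S, (n.divisors.card : ℝ) ^ 3 * β n ^ 2 :=
    Finset.sum_nonneg fun n _ => by positivity
  have hZ : 0 ≤ ∑' s : ℕ, (s : ℝ) ^ (-2 * 4 : ℝ) := tsum_nonneg fun s => by positivity
  generalize ∑ n ∈ S, (n.divisors.card : ℝ) ^ 3 * β n ^ 2 = B at hB ⊢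
  generalize ∑' s : ℕ, (s : ℝ) ^ (-2 * 4 : ℝ) = Z at hZ ⊢
  have e1 : N ^ (3 * η) * N ^ η ≤ M ^ (4 * η) := by
    rw [← Real.rpow_add (by positivity), show 3 * η + η = 4 * η by ring]
    gcongr
  have e2 : N * M ^ η * N ^ η ≤ M * M ^ (4 * η) := by
    have : M ^ η * N ^ η ≤ M ^ (4 * η) := by
      calc M ^ η * N ^ η ≤ M ^ η * M ^ η := by gcongr
        _ = M ^ (η + η) := (Real.rpow_add hM _ _).symm
        _ ≤ _ := Real.rpow_le_rpow_of_exponent_le (hN.trans hNM) (by linarith)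
    rw [mul_assoc]
    gcongr
  calc _ = (4 * (Cδ + Cδ') + 4 * Z * CV) * C * (M * (N ^ (3 * η) * N ^ η)) * g.divisors.card * B +
        2 * Cδ * C * (N * M ^ η * N ^ η) * g.divisors.card * B := by ring
    _ ≤ (4 * (Cδ + Cδ') + 4 * Z * CV) * C * (M * M ^ (4 * η)) * g.divisors.card * B +
        2 * Cδ * C * (M * M ^ (4 * η)) * g.divisors.card * B := by gcongr
    _ = _ := by ring

end PairBounds

/-- The cofactors `n > 1` of `g` with `g * n ∈ S`. -/
def cofactors (S : Finset ℕ) (g : ℕ) : Finset ℕ :=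
  ((S.filter (g ∣ ·)).image (· / g)).filter (1 < ·)

theorem mem_cofactors {S : Finset ℕ} {g n : ℕ} (hg : 0 < g) :
    n ∈ cofactors S g ↔ g * n ∈ S ∧ 1 < n := by
  rw [cofactors, Finset.mem_filter, Finset.mem_image]
  refine and_congr_left fun _ => ⟨?_, fun h => ⟨g * n, Finset.mem_filter.mpr
    ⟨h, dvd_mul_right _ _⟩, Nat.mul_div_cancel_left _ hg⟩⟩
  rintro ⟨m, hm, rfl⟩
  obtain ⟨hm, hgm⟩ := Finset.mem_filter.mp hm
  rwa [Nat.mul_div_cancel' hgm]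

theorem sum_cofactors_le {S G : Finset ℕ} (hS : ∀ n ∈ S, n ≠ 0) (hG : ∀ g ∈ G, 0 < g) {h : ℕ → ℝ}
    (h0 : ∀ n, 0 ≤ h n) :
    ∑ g ∈ G, ∑ n ∈ cofactors S g, h (g * n) ≤ ∑ m ∈ S, m.divisors.card * h m := by
  calc ∑ g ∈ G, ∑ n ∈ cofactors S g, h (g * n)
      ≤ ∑ g ∈ G, ∑ m ∈ S, if g ∣ m then h m else 0 := by
        refine Finset.sum_le_sum fun g hg => ?_
        rw [← Finset.sum_filter, ← Finset.sum_image (f := h) (g := (g * ·))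
          fun x _ y _ hxy => Nat.eq_of_mul_eq_mul_left (hG g hg) hxy]
        refine Finset.sum_le_sum_of_subset_of_nonneg ?_ fun _ _ _ => h0 _
        intro m hm
        obtain ⟨n, hn, rfl⟩ := Finset.mem_image.mp hm
        exact Finset.mem_filter.mpr ⟨((mem_cofactors (hG g hg)).mp hn).1, dvd_mul_right _ _⟩
    _ ≤ _ := by
        rw [Finset.sum_comm]
        refine Finset.sum_le_sum fun m hm => ?_
        rw [← Finset.sum_filter, Finset.sum_const, nsmul_eq_mul]
        refine mul_le_mul_of_nonneg_right ?_ (h0 m)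
        exact_mod_cast Finset.card_le_card fun g hg =>
          Nat.mem_divisors.mpr ⟨(Finset.mem_filter.mp hg).2, hS m hm⟩

/-- Pairs of distinct elements of a dyadic interval, arranged by their greatest common divisor. -/
theorem sum_sum_eq_diag_add_gcd {N : ℝ} {S : Finset ℕ}
    (hS : ∀ n ∈ S, Squarefree n ∧ N / 2 < n ∧ (n : ℝ) ≤ N) (f : ℕ → ℕ → ℂ) :
    ∑ n₁ ∈ S, ∑ n₂ ∈ S, f n₁ n₂ = ∑ n ∈ S, f n n +
      ∑ g ∈ (Finset.Icc 1 ⌊N⌋₊).filter Squarefree, ∑ n₁ ∈ cofactors S g, ∑ n₂ ∈ cofactors S g,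
        (if n₁.Coprime n₂ then 1 else 0) * f (g * n₁) (g * n₂) := by
  rw [← Finset.sum_product', ← Finset.diag_union_offDiag,
    Finset.sum_union (Finset.disjoint_diag_offDiag S), Finset.sum_diag]
  congr 1
  have hmaps : ∀ p ∈ S.offDiag, p.1.gcd p.2 ∈ (Finset.Icc 1 ⌊N⌋₊).filter Squarefree := by
    intro p hp
    obtain ⟨h₁, -, -⟩ := Finset.mem_offDiag.mp hp
    have h0 := (hS _ h₁).1.ne_zero
    refine Finset.mem_filter.mpr ⟨Finset.mem_Icc.mpr ⟨Nat.gcd_pos_of_pos_left _ (by omega), ?_⟩,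
      (hS _ h₁).1.squarefree_of_dvd (Nat.gcd_dvd_left _ _)⟩
    exact (Nat.gcd_le_left _ (by omega)).trans (Nat.le_floor (hS _ h₁).2.2)
  rw [← Finset.sum_fiberwise_of_maps_to hmaps]
  refine Finset.sum_congr rfl fun g hg => ?_
  have hg0 : 0 < g := (Finset.mem_Icc.mp (Finset.mem_filter.mp hg).1).1
  rw [← Finset.sum_product']
  simp_rw [ite_mul, one_mul, zero_mul]
  rw [← Finset.sum_filter]
  symm
  refine Finset.sum_bij (fun p _ => (g * p.1, g * p.2)) ?_ ?_ ?_ fun _ _ => rfl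
  · intro p hp
    obtain ⟨hp, hc⟩ := Finset.mem_filter.mp hp
    obtain ⟨h₁, h₂⟩ := Finset.mem_product.mp hp
    rw [mem_cofactors hg0] at h₁ h₂
    refine Finset.mem_filter.mpr ⟨Finset.mem_offDiag.mpr ⟨h₁.1, h₂.1, fun h => ?_⟩, ?_⟩
    · have h := Nat.eq_of_mul_eq_mul_left hg0 h
      rw [h, Nat.coprime_self] at hc
      omega
    · simp only [Nat.gcd_mul_left, hc.gcd_eq_one, mul_one]
  · intro p _ p' _ h
    have h := Prod.ext_iff.mp h
    exact Prod.ext (Nat.eq_of_mul_eq_mul_left hg0 h.1) (Nat.eq_of_mul_eq_mul_left hg0 h.2)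
  · intro p hp
    obtain ⟨hp, hgcd⟩ := Finset.mem_filter.mp hp
    obtain ⟨h₁, h₂, hne⟩ := Finset.mem_offDiag.mp hp
    obtain ⟨m, hm⟩ : g ∣ p.1 := hgcd ▸ Nat.gcd_dvd_left _ _
    obtain ⟨n, hn⟩ : g ∣ p.2 := hgcd ▸ Nat.gcd_dvd_right _ _
    have hc : m.Coprime n := by
      rw [hm, hn, Nat.gcd_mul_left] at hgcd
      exact Nat.eq_of_mul_eq_mul_left hg0 (by rw [hgcd, mul_one])
    have haux : ∀ x y, g * x ∈ S → g * y ∈ S → x ≠ y → 1 < x := by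
      intro x y hx hy hxy
      have hx0 : x ≠ 0 := by rintro rfl; exact (hS _ hx).1.ne_zero (mul_zero g)
      have hy0 : y ≠ 0 := by rintro rfl; exact (hS _ hy).1.ne_zero (mul_zero g)
      by_contra hx1
      have hx1 : x = 1 := by omega
      have hy2 : 2 ≤ y := by omega
      have h3 : (g * x * 2 : ℕ) ≤ g * y := by subst hx1; nlinarith
      have h4 := (hS _ hx).2.1
      have h5 := (hS _ hy).2.2
      have h3 : ((g * x : ℕ) : ℝ) * 2 ≤ (g * y : ℕ) := by exact_mod_cast h3
      linarith
    have hmn : m ≠ n := by rintro rfl; exact hne (hm.trans hn.symm)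
    rw [hm] at h₁
    rw [hn] at h₂
    refine ⟨(m, n), Finset.mem_filter.mpr ⟨Finset.mem_product.mpr
      ⟨(mem_cofactors hg0).mpr ⟨h₁, haux m n h₁ h₂ hmn⟩,
        (mem_cofactors hg0).mpr ⟨h₂, haux n m h₂ h₁ hmn.symm⟩⟩, hc⟩, ?_⟩
    exact Prod.ext hm.symm hn.symm

theorem jacobiChi_mul_jacobiChi {g n₁ n₂ : ℕ} (hg : g ≠ 0) (h₁ : n₁ ≠ 0) (h₂ : n₂ ≠ 0) (m : ℕ) :
    jacobiChi (g * n₁) m * jacobiChi (g * n₂) m =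
      jacobiChi (n₁ * n₂) m * if m.Coprime g then 1 else 0 := by
  rw [jacobiChi_mul_modulus hg h₁, jacobiChi_mul_modulus hg h₂, jacobiChi_mul_modulus h₁ h₂,
    ← jacobiChi_sq hg]
  ring

theorem norm_sq_sum_jacobiChi (S : Finset ℕ) (a : ℕ → ℂ) (m : ℕ) :
    ((‖∑ n ∈ S, a n * jacobiChi n m‖ ^ 2 : ℝ) : ℂ) = ∑ n₁ ∈ S, ∑ n₂ ∈ S,
      a n₁ * (starRingEnd ℂ) (a n₂) * (jacobiChi n₁ m * jacobiChi n₂ m) := by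
  rw [Complex.ofReal_pow, ← Complex.mul_conj', map_sum, Finset.sum_mul_sum]
  refine Finset.sum_congr rfl fun n₁ _ => Finset.sum_congr rfl fun n₂ _ => ?_
  rw [map_mul, conj_jacobiChi]
  ring

theorem tsum_gauss_le {M : ℝ} (hM : 1 ≤ M) :
    ∑' m : ℕ, Real.exp (-Real.pi * (M⁻¹ * m) ^ 2) ≤ 6 * M := by
  have hM0 : 0 < M := by linarith
  have hr : Real.exp (-M⁻¹) < 1 := by
    rw [← Real.exp_zero, Real.exp_lt_exp]
    simpa using hM0
  have hsum := summable_geometric_of_lt_one (Real.exp_pos _).le hr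
  have h1 : ∀ m : ℕ, Real.exp (-Real.pi * (M⁻¹ * m) ^ 2) ≤
      Real.exp 1 * Real.exp (-M⁻¹) ^ m := by
    intro m
    rw [← Real.exp_nat_mul, ← Real.exp_add, Real.exp_le_exp]
    have := Real.pi_gt_three
    nlinarith [sq_nonneg (M⁻¹ * m - 1 / 2), sq_nonneg (M⁻¹ * m)]
  have hs : Summable fun m : ℕ => Real.exp (-Real.pi * (M⁻¹ * m) ^ 2) :=
    Summable.of_nonneg_of_le (fun _ => (Real.exp_pos _).le) h1 (hsum.mul_left _)
  refine (hs.tsum_le_tsum h1 (hsum.mul_left _)).trans ?_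
  rw [tsum_mul_left, tsum_geometric_of_lt_one (Real.exp_pos _).le hr]
  have h2 : (1 - Real.exp (-M⁻¹))⁻¹ ≤ 1 + M := by
    rw [inv_le_comm₀ (by linarith) (by linarith), Real.exp_neg]
    have h3 : M⁻¹ + 1 ≤ Real.exp M⁻¹ := Real.add_one_le_exp _
    have h4 : (Real.exp M⁻¹)⁻¹ ≤ (M⁻¹ + 1)⁻¹ := inv_anti₀ (by positivity) h3
    have h5 : (1 + M)⁻¹ = 1 - (M⁻¹ + 1)⁻¹ := by field_simp; ring
    linarith
  have h3 := Real.exp_one_lt_d9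
  calc _ ≤ 3 * (M + M) := by
        gcongr
        · linarith
        · exact h2.trans (by linarith)
    _ = _ := by ring

/-- The Gaussian sum of `f` over integers whose squarefree kernel exceeds `k`. -/
noncomputable def kernelGaussSum (M : ℝ) (k : ℕ) (f : ℕ → ℂ) : ℂ :=
  ∑' p : SquarefreePair, if k < p.kernel then gaussWeight (p.value / M) * f p.value else 0

section KernelGaussSum

variable {M : ℝ} (k : ℕ) {f : ℕ → ℂ}

theorem norm_kernelGaussSum_term_le (hf : ∀ m, ‖f m‖ ≤ 1) (p : SquarefreePair) :
    ‖if k < p.kernel then gaussWeight (p.value / M) * f p.value else 0‖ ≤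
      Real.exp (-Real.pi * (M⁻¹ * p.value) ^ 2) := by
  split_ifs
  · rw [norm_mul, norm_gaussWeight, div_eq_inv_mul]
    exact mul_le_of_le_one_right (Real.exp_pos _).le (hf _)
  · simpa using (Real.exp_pos _).le

theorem summable_gauss_value (hM : 0 < M) :
    Summable fun p : SquarefreePair => Real.exp (-Real.pi * (M⁻¹ * p.value) ^ 2) :=
  (summable_gauss_nat (inv_pos.mpr hM)).comp_injective SquarefreePair.value_injective

theorem summable_kernelGaussSum (hM : 0 < M) (hf : ∀ m, ‖f m‖ ≤ 1) :
    Summable fun p : SquarefreePair =>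
      if k < p.kernel then gaussWeight (p.value / M) * f p.value else 0 :=
  Summable.of_norm_bounded (summable_gauss_value hM) (norm_kernelGaussSum_term_le k hf)

theorem norm_kernelGaussSum_le (hM : 1 ≤ M) (hf : ∀ m, ‖f m‖ ≤ 1) :
    ‖kernelGaussSum M k f‖ ≤ 6 * M := by
  have hM0 : 0 < M := by linarith
  refine (tsum_of_norm_bounded (summable_gauss_value hM0).hasSum
    (norm_kernelGaussSum_term_le k hf)).trans (le_trans ?_ (tsum_gauss_le hM))
  exact Summable.tsum_le_tsum_of_inj _ SquarefreePair.value_injective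
    (fun _ _ => (Real.exp_pos _).le) (fun _ => le_rfl) (summable_gauss_value hM0)
    (summable_gauss_nat (inv_pos.mpr hM0))

theorem kernelGaussSum_sum_sum (hM : 0 < M) (S : Finset ℕ) (w : ℕ → ℕ → ℂ) {F : ℕ → ℕ → ℕ → ℂ}
    (hF : ∀ n₁ n₂ m, ‖F n₁ n₂ m‖ ≤ 1) :
    HasSum (fun p : SquarefreePair => if k < p.kernel then gaussWeight (p.value / M) *
      ∑ n₁ ∈ S, ∑ n₂ ∈ S, w n₁ n₂ * F n₁ n₂ p.value else 0)
    (∑ n₁ ∈ S, ∑ n₂ ∈ S, w n₁ n₂ * kernelGaussSum M k (F n₁ n₂)) := by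
  have h := hasSum_sum fun n₁ (_ : n₁ ∈ S) => hasSum_sum fun n₂ (_ : n₂ ∈ S) =>
    ((summable_kernelGaussSum k hM (hF n₁ n₂)).hasSum.mul_left (w n₁ n₂))
  refine h.congr_fun fun p => ?_
  split_ifs
  · rw [Finset.mul_sum]
    refine Finset.sum_congr rfl fun n₁ _ => ?_
    rw [Finset.mul_sum]
    exact Finset.sum_congr rfl fun n₂ _ => by ring
  · simp

end KernelGaussSum

theorem sum_le_tsum_kernel {k : ℕ} {𝒦 : Finset ℕ} (h𝒦 : ∀ K ∈ 𝒦, Squarefree K ∧ k < K)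
    {h : ℕ → ℝ} (h0 : ∀ m, 0 ≤ h m)
    (hs : Summable fun p : SquarefreePair => if k < p.kernel then h p.value else 0) :
    ∑ K ∈ 𝒦, h K ≤ ∑' p : SquarefreePair, if k < p.kernel then h p.value else 0 := by
  classical
  let φ : ℕ → SquarefreePair := fun K =>
    if hK : Squarefree K then ⟨(K, 1), hK, one_pos⟩ else ⟨(1, 1), squarefree_one, one_pos⟩
  have hφ : ∀ K ∈ 𝒦, (φ K).kernel = K ∧ (φ K).value = K := by
    intro K hK
    simp [φ, (h𝒦 K hK).1, SquarefreePair.kernel, SquarefreePair.value, SquarefreePair.root]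
  have hinj : Set.InjOn φ 𝒦 := by
    intro K hK L hL hKL
    rw [← (hφ K hK).1, hKL, (hφ L hL).1]
  calc ∑ K ∈ 𝒦, h K = ∑ K ∈ 𝒦, if k < (φ K).kernel then h (φ K).value else 0 :=
        Finset.sum_congr rfl fun K hK => by
          rw [(hφ K hK).1, (hφ K hK).2, if_pos (h𝒦 K hK).2]
    _ = ∑ p ∈ 𝒦.image φ, if k < p.kernel then h p.value else 0 :=
        (Finset.sum_image (f := fun p : SquarefreePair => if k < p.kernel then h p.value else 0)
          hinj).symm
    _ ≤ _ := hs.sum_le_tsum _ fun p _ => by split_ifs; exacts [h0 _, le_rfl]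

/-- Large values of the character argument, detected by a Gaussian. -/
theorem sum_norm_sq_le_kernelGaussSum {M : ℝ} (hM : 0 < M) {k : ℕ} {𝒦 : Finset ℕ}
    (h𝒦 : ∀ K ∈ 𝒦, Squarefree K ∧ k < K ∧ (K : ℝ) ≤ M) (S : Finset ℕ) (a : ℕ → ℂ) :
    ∑ K ∈ 𝒦, ‖∑ n ∈ S, a n * jacobiChi n K‖ ^ 2 ≤ Real.exp Real.pi *
      ‖∑ n₁ ∈ S, ∑ n₂ ∈ S, a n₁ * (starRingEnd ℂ) (a n₂) *
        kernelGaussSum M k fun m => jacobiChi n₁ m * jacobiChi n₂ m‖ := by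
  let G : ℕ → ℝ := fun m => ‖∑ n ∈ S, a n * jacobiChi n m‖ ^ 2
  let h : ℕ → ℝ := fun m => Real.exp (-Real.pi * (m / M) ^ 2) * G m
  have hG : ∀ m, 0 ≤ G m := fun m => sq_nonneg _
  have hsum := kernelGaussSum_sum_sum k hM S (fun n₁ n₂ => a n₁ * (starRingEnd ℂ) (a n₂))
    (F := fun n₁ n₂ m => jacobiChi n₁ m * jacobiChi n₂ m) fun n₁ n₂ m => by
      rw [norm_mul]
      exact mul_le_one₀ (norm_jacobiChi_le_one _ _) (norm_nonneg _) (norm_jacobiChi_le_one _ _)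
  have hcast : ∀ p : SquarefreePair, (((if k < p.kernel then h p.value else 0 : ℝ)) : ℂ) =
      if k < p.kernel then gaussWeight (p.value / M) * ∑ n₁ ∈ S, ∑ n₂ ∈ S,
        a n₁ * (starRingEnd ℂ) (a n₂) * (jacobiChi n₁ p.value * jacobiChi n₂ p.value) else 0 := by
    intro p
    split_ifs
    · rw [← norm_sq_sum_jacobiChi, gaussWeight, Complex.ofReal_mul]
    · simp
  simp_rw [← hcast] at hsum
  have hs : Summable fun p : SquarefreePair => if k < p.kernel then h p.value else 0 :=
    Complex.summable_ofReal.mp hsum.summable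
  rw [← hsum.tsum_eq, ← Complex.ofReal_tsum, Complex.norm_real, Real.norm_of_nonneg
    (tsum_nonneg fun p => by split_ifs; exacts [mul_nonneg (Real.exp_pos _).le (hG _), le_rfl])]
  refine le_trans ?_ (mul_le_mul_of_nonneg_left (sum_le_tsum_kernel
    (fun K hK => ⟨(h𝒦 K hK).1, (h𝒦 K hK).2.1⟩)
    (fun m => mul_nonneg (Real.exp_pos _).le (hG _)) hs) (Real.exp_pos _).le)
  rw [Finset.mul_sum]
  refine Finset.sum_le_sum fun K hK => ?_
  change G K ≤ Real.exp Real.pi * (Real.exp (-Real.pi * (K / M) ^ 2) * G K)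
  rw [← mul_assoc, ← Real.exp_add]
  refine le_mul_of_one_le_left (hG K) (Real.one_le_exp ?_)
  have h1 : ((K : ℝ) / M) ^ 2 ≤ 1 := pow_le_one₀ (by positivity)
    ((div_le_one hM).mpr (h𝒦 K hK).2.2)
  nlinarith [Real.pi_pos]

theorem mul_mod_four_eq_one {g n₁ n₂ r : ℕ} (hg : Odd g) (h₁ : Odd n₁) (h₂ : Odd n₂)
    (hr₁ : g * n₁ % 4 = r) (hr₂ : g * n₂ % 4 = r) : n₁ * n₂ % 4 = 1 := by
  rw [← hr₂] at hr₁
  rw [Nat.mul_mod, Nat.mul_mod g n₂] at hr₁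
  rw [Nat.mul_mod]
  rw [Nat.odd_iff] at hg h₁ h₂
  have hg : g % 4 = 1 ∨ g % 4 = 3 := by omega
  have h₁ : n₁ % 4 = 1 ∨ n₁ % 4 = 3 := by omega
  have h₂ : n₂ % 4 = 1 ∨ n₂ % 4 = 3 := by omega
  rcases hg with hg | hg <;> rcases h₁ with h₁ | h₁ <;> rcases h₂ with h₂ | h₂ <;>
    simp [hg, h₁, h₂] at hr₁ ⊢

section Dyadic

variable {ξ η C : ℝ} (hP : KernelSieveBound ξ η C) (hC : 0 ≤ C) {N M : ℝ} (hN : 1 ≤ N)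
  (hNM : N ≤ M) (hκξ : (N ^ 2 / M) ^ ξ ≤ N) (hξ : 1 ≤ ξ) (hη : 0 < η)
  {S : Finset ℕ} {r : ℕ}
  (hS : ∀ n ∈ S, Odd n ∧ Squarefree n ∧ N / 2 < n ∧ (n : ℝ) ≤ N ∧ n % 4 = r) (a : ℕ → ℂ)

include hP hN hNM hκξ hξ hη hS

include hC in
theorem norm_sum_cofactors_le (hη' : η < 1 / 2) (hξη : ξ + η ≤ 4) {c : ℂ} {Cδ Cδ' CV : ℝ}
    (hδ : SeparatesVars (squareGaussError c) η Cδ) (hCδ : 0 ≤ Cδ)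
    (hδ' : SeparatesVars (squareGaussError c) (1 / 2 - η) Cδ') (hCδ' : 0 ≤ Cδ')
    (hV : SeparatesVars gaussWeight 4 CV) (hCV : 0 ≤ CV) {g : ℕ}
    (hg : g ∈ (Finset.Icc 1 ⌊N⌋₊).filter Squarefree) :
    ‖∑ n₁ ∈ cofactors S g, ∑ n₂ ∈ cofactors S g, (if n₁.Coprime n₂ then 1 else 0) *
      (a (g * n₁) * (starRingEnd ℂ) (a (g * n₂)) * kernelGaussSum M ⌊N ^ 2 / M⌋₊ fun m =>
        jacobiChi (g * n₁) m * jacobiChi (g * n₂) m)‖ ≤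
    (6 * Cδ + 4 * Cδ' + 4 * (∑' s : ℕ, (s : ℝ) ^ (-2 * 4 : ℝ)) * CV) * C * (M * M ^ (4 * η)) *
      g.divisors.card * ∑ n ∈ cofactors S g, n.divisors.card ^ 3 * ‖a (g * n)‖ ^ 2 := by
  obtain ⟨hg, hgsq⟩ := Finset.mem_filter.mp hg
  obtain ⟨hg1, hgN⟩ := Finset.mem_Icc.mp hg
  have hgN : (g : ℝ) ≤ N := (Nat.le_floor_iff (by linarith)).mp hgN
  have hgR : (0 : ℝ) < g := by exact_mod_cast hg1
  have hmem : ∀ n ∈ cofactors S g, Odd g ∧ Odd n ∧ Squarefree n ∧ g.Coprime n ∧ (n : ℝ) ≤ N / g ∧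
      N / g / 2 < n ∧ g * n % 4 = r ∧ 1 < n := by
    intro n hn
    obtain ⟨hn, hn1⟩ := (mem_cofactors hg1).mp hn
    obtain ⟨ho, hsq, hlo, hhi, h4⟩ := hS _ hn
    have hsq' := Nat.squarefree_mul_iff.mp hsq
    push_cast at hlo hhi
    refine ⟨(Nat.odd_mul.mp ho).1, (Nat.odd_mul.mp ho).2, hsq'.2.2, hsq'.1, ?_, ?_, h4, hn1⟩
    · rw [le_div_iff₀ hgR]
      linarith
    · rw [div_div, div_lt_iff₀ (by positivity)]
      linarith
  have key := norm_coprimeForm_gauss_le hP hC hN hNM hκξ hξ hη hξη (by omega) hgN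
    (S := cofactors S g) (fun n hn => ⟨(hmem n hn).2.1, (hmem n hn).2.2.1, (hmem n hn).2.2.2.2.1⟩)
    (fun n hn => (hmem n hn).2.2.2.2.2.1) (b₁ := fun n => a (g * n))
    (b₂ := fun n => (starRingEnd ℂ) (a (g * n))) (β := fun n => ‖a (g * n)‖) (fun _ _ => le_rfl)
    (fun _ _ => (Complex.norm_conj _).le) hη' hδ hCδ hδ' hCδ' hV hCV hgsq
    (fun n hn => (hmem n hn).2.2.2.1)
    (fun n₁ h₁ n₂ h₂ => mul_mod_four_eq_one (hmem _ h₁).1 (hmem _ h₁).2.1 (hmem _ h₂).2.1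
      (hmem _ h₁).2.2.2.2.2.2.1 (hmem _ h₂).2.2.2.2.2.2.1)
    (fun n hn => (hmem n hn).2.2.2.2.2.2.2)
  refine (le_of_eq (congrArg norm ?_)).trans key
  refine Finset.sum_congr rfl fun n₁ h₁ => Finset.sum_congr rfl fun n₂ h₂ => ?_
  have h1 := (hmem n₁ h₁).2.2.2.2.2.2.2
  have h2 := (hmem n₂ h₂).2.2.2.2.2.2.2
  rw [kernelGaussSum]
  simp_rw [jacobiChi_mul_jacobiChi (show g ≠ 0 by omega) (show n₁ ≠ 0 by omega)
    (show n₂ ≠ 0 by omega)]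

theorem sum_norm_sq_small_le {𝒦 : Finset ℕ} (h𝒦 : ∀ K ∈ 𝒦, Squarefree K ∧ (K : ℝ) ≤ N ^ 2 / M) :
    ∑ K ∈ 𝒦, ‖∑ n ∈ S, a n * jacobiChi n K‖ ^ 2 ≤
      2 * C * N ^ (1 + 2 * η) * ∑ n ∈ S, ‖a n‖ ^ 2 := by
  have hM : 0 < M := by linarith
  have hκN : N ^ 2 / M ≤ N := by rw [div_le_iff₀ hM]; nlinarith
  have h1 := hP N S 𝒦 a hN (fun n hn => ⟨(hS n hn).1, (hS n hn).2.1, (hS n hn).2.2.2.1⟩)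
    fun K hK => (h𝒦 K hK).1
  have hA : 0 ≤ ∑ n ∈ S, ‖a n‖ ^ 2 := Finset.sum_nonneg fun _ _ => by positivity
  calc ∑ K ∈ 𝒦, ‖∑ n ∈ S, a n * jacobiChi n K‖ ^ 2
      ≤ ∑ K ∈ 𝒦, N ^ η * (2 * N) * (‖∑ n ∈ S, a n * jacobiChi n K‖ ^ 2 *
        ((K : ℝ) ^ η * (N + (K : ℝ) ^ ξ))⁻¹) := by
        refine Finset.sum_le_sum fun K hK => ?_
        have hK0 : (0 : ℝ) < K := by exact_mod_cast Nat.pos_of_ne_zero (h𝒦 K hK).1.ne_zero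
        have h2 : (K : ℝ) ^ η * (N + (K : ℝ) ^ ξ) ≤ N ^ η * (2 * N) := by
          have h3 : (K : ℝ) ^ ξ ≤ N :=
            (Real.rpow_le_rpow hK0.le (h𝒦 K hK).2 (by linarith)).trans hκξ
          have h4 : (K : ℝ) ^ η ≤ N ^ η :=
            Real.rpow_le_rpow hK0.le ((h𝒦 K hK).2.trans hκN) hη.le
          gcongr
          linarith
        have h3 : 0 < (K : ℝ) ^ η * (N + (K : ℝ) ^ ξ) := by positivity
        rw [mul_left_comm, ← div_eq_mul_inv]
        exact le_mul_of_one_le_right (sq_nonneg _) ((one_le_div h3).mpr h2)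
    _ = N ^ η * (2 * N) * ∑ K ∈ 𝒦, ‖∑ n ∈ S, a n * jacobiChi n K‖ ^ 2 *
        ((K : ℝ) ^ η * (N + (K : ℝ) ^ ξ))⁻¹ := (Finset.mul_sum _ _ _).symm
    _ ≤ N ^ η * (2 * N) * (C * N ^ η * ∑ n ∈ S, ‖a n‖ ^ 2) := by gcongr
    _ = _ := by
        rw [show 1 + 2 * η = 1 + η + η by ring, Real.rpow_add (by positivity),
          Real.rpow_add (by positivity), Real.rpow_one]
        ring

omit hP hNM hκξ hξ in
theorem sum_cofactors_divisors_le {D : ℝ}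
    (hD : ∀ n : ℕ, Squarefree n → (n.divisors.card : ℝ) ≤ D * (n : ℝ) ^ η) :
    ∑ g ∈ (Finset.Icc 1 ⌊N⌋₊).filter Squarefree, g.divisors.card *
      ∑ n ∈ cofactors S g, (n.divisors.card : ℝ) ^ 3 * ‖a (g * n)‖ ^ 2 ≤
    (D * N ^ η) ^ 5 * ∑ n ∈ S, ‖a n‖ ^ 2 := by
  have hD0 : 0 ≤ D := by simpa using (Nat.cast_nonneg _).trans (hD 1 squarefree_one)
  have hDN : ∀ n : ℕ, Squarefree n → (n : ℝ) ≤ N → (n.divisors.card : ℝ) ≤ D * N ^ η :=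
    fun n hn hnN => (hD n hn).trans (by gcongr)
  have hB : 0 ≤ D * N ^ η := by positivity
  generalize D * N ^ η = B at hDN hB
  calc _ ≤ ∑ g ∈ (Finset.Icc 1 ⌊N⌋₊).filter Squarefree,
        B * ∑ n ∈ cofactors S g, B ^ 3 * ‖a (g * n)‖ ^ 2 := by
        refine Finset.sum_le_sum fun g hg => ?_
        obtain ⟨hg, hgsq⟩ := Finset.mem_filter.mp hg
        obtain ⟨hg1, hgN⟩ := Finset.mem_Icc.mp hg
        have h1 := hDN g hgsq ((Nat.le_floor_iff (by linarith)).mp hgN)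
        have h2 : ∀ n ∈ cofactors S g, (n.divisors.card : ℝ) ≤ B := by
          intro n hn
          obtain ⟨hn, -⟩ := (mem_cofactors hg1).mp hn
          refine hDN n ((hS _ hn).2.1.squarefree_of_dvd (dvd_mul_left _ _)) (le_trans ?_
            (hS _ hn).2.2.2.1)
          exact_mod_cast Nat.le_mul_of_pos_left n hg1
        gcongr with n hn
        exact h2 n hn
    _ = B ^ 4 * ∑ g ∈ (Finset.Icc 1 ⌊N⌋₊).filter Squarefree,
        ∑ n ∈ cofactors S g, ‖a (g * n)‖ ^ 2 := by
        rw [Finset.mul_sum]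
        refine Finset.sum_congr rfl fun g _ => ?_
        rw [← Finset.mul_sum]
        ring
    _ ≤ B ^ 4 * ∑ m ∈ S, m.divisors.card * ‖a m‖ ^ 2 := by
        gcongr
        exact sum_cofactors_le (h := fun n => ‖a n‖ ^ 2) (fun n hn => (hS n hn).2.1.ne_zero)
          (fun g hg => (Finset.mem_Icc.mp (Finset.mem_filter.mp hg).1).1) fun _ => sq_nonneg _
    _ ≤ B ^ 4 * ∑ m ∈ S, B * ‖a m‖ ^ 2 := by
        gcongr with m hm
        exact hDN m (hS m hm).2.1 (hS m hm).2.2.2.1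
    _ = _ := by
        rw [← Finset.mul_sum]
        ring

include hC in
theorem sum_norm_sq_dyadic_le (hη' : η < 1 / 2) (hξη : ξ + η ≤ 4) {c : ℂ} {Cδ Cδ' CV D : ℝ}
    (hδ : SeparatesVars (squareGaussError c) η Cδ) (hCδ : 0 ≤ Cδ)
    (hδ' : SeparatesVars (squareGaussError c) (1 / 2 - η) Cδ') (hCδ' : 0 ≤ Cδ')
    (hV : SeparatesVars gaussWeight 4 CV) (hCV : 0 ≤ CV)
    (hD : ∀ n : ℕ, Squarefree n → (n.divisors.card : ℝ) ≤ D * (n : ℝ) ^ η)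
    {𝒦 : Finset ℕ} (h𝒦 : ∀ K ∈ 𝒦, Squarefree K ∧ (K : ℝ) ≤ M) :
    ∑ K ∈ 𝒦, ‖∑ n ∈ S, a n * jacobiChi n K‖ ^ 2 ≤
      (2 * C + Real.exp Real.pi * (6 + (6 * Cδ + 4 * Cδ' +
        4 * (∑' s : ℕ, (s : ℝ) ^ (-2 * 4 : ℝ)) * CV) * C * D ^ 5)) * M ^ (1 + 9 * η) *
          ∑ n ∈ S, ‖a n‖ ^ 2 := by
  have hM : 0 < M := by linarith
  have hM1 : 1 ≤ M := hN.trans hNM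
  have hD0 : 0 ≤ D := by simpa using (Nat.cast_nonneg _).trans (hD 1 squarefree_one)
  have hκ : 0 ≤ N ^ 2 / M := by positivity
  have hA : 0 ≤ ∑ n ∈ S, ‖a n‖ ^ 2 := Finset.sum_nonneg fun _ _ => by positivity
  have hZ : 0 ≤ ∑' s : ℕ, (s : ℝ) ^ (-2 * 4 : ℝ) := tsum_nonneg fun s => by positivity
  have hsmall := sum_norm_sq_small_le hP hN hNM hκξ hξ hη hS a
    (𝒦 := 𝒦.filter (· ≤ ⌊N ^ 2 / M⌋₊)) fun K hK => by
      obtain ⟨hK, hKκ⟩ := Finset.mem_filter.mp hK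
      exact ⟨(h𝒦 K hK).1, (Nat.le_floor_iff hκ).mp hKκ⟩
  have hlarge := sum_norm_sq_le_kernelGaussSum hM (k := ⌊N ^ 2 / M⌋₊)
    (𝒦 := 𝒦.filter (¬· ≤ ⌊N ^ 2 / M⌋₊)) (fun K hK => by
      obtain ⟨hK, hKκ⟩ := Finset.mem_filter.mp hK
      exact ⟨(h𝒦 K hK).1, not_le.mp hKκ, (h𝒦 K hK).2⟩) S a
  have hoff := fun g => norm_sum_cofactors_le hP hC hN hNM hκξ hξ hη hS a hη' hξη hδ hCδ hδ' hCδ'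
    hV hCV (g := g)
  have hdiv := sum_cofactors_divisors_le hN hη hS a hD
  rw [sum_sum_eq_diag_add_gcd fun n hn => ⟨(hS n hn).2.1, (hS n hn).2.2.1, (hS n hn).2.2.2.1⟩]
    at hlarge
  have hQ : 0 ≤ 6 * Cδ + 4 * Cδ' + 4 * (∑' s : ℕ, (s : ℝ) ^ (-2 * 4 : ℝ)) * CV := by positivity
  generalize 6 * Cδ + 4 * Cδ' + 4 * (∑' s : ℕ, (s : ℝ) ^ (-2 * 4 : ℝ)) * CV = Q at hQ hoff ⊢
  have hdiag : ‖∑ n ∈ S, a n * (starRingEnd ℂ) (a n) *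
      kernelGaussSum M ⌊N ^ 2 / M⌋₊ fun m => jacobiChi n m * jacobiChi n m‖ ≤
      6 * M * ∑ n ∈ S, ‖a n‖ ^ 2 := by
    rw [Finset.mul_sum]
    refine norm_sum_le_of_le _ fun n _ => ?_
    rw [norm_mul, norm_mul, Complex.norm_conj, ← sq, mul_comm]
    refine mul_le_mul_of_nonneg_right (norm_kernelGaussSum_le _ hM1 fun m => ?_) (sq_nonneg _)
    rw [norm_mul]
    exact mul_le_one₀ (norm_jacobiChi_le_one _ _) (norm_nonneg _) (norm_jacobiChi_le_one _ _)
  have hoff' := norm_sum_le_of_le _ hoff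
  simp_rw [mul_assoc (Q * C * (M * M ^ (4 * η)))] at hoff'
  rw [← Finset.mul_sum] at hoff'
  have e1 : N ^ (1 + 2 * η) ≤ M ^ (1 + 9 * η) :=
    (Real.rpow_le_rpow (by positivity) hNM (by positivity)).trans
      (Real.rpow_le_rpow_of_exponent_le hM1 (by linarith))
  have e2 : M ≤ M ^ (1 + 9 * η) := Real.self_le_rpow_of_one_le hM1 (by linarith)
  have e3 : M * M ^ (4 * η) * (D * N ^ η) ^ 5 ≤ D ^ 5 * M ^ (1 + 9 * η) := by
    calc _ ≤ M * M ^ (4 * η) * (D * M ^ η) ^ 5 := by gcongr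
      _ = D ^ 5 * (M ^ (1 : ℝ) * M ^ (4 * η) * M ^ (η * (5 : ℕ))) := by
        rw [Real.rpow_one, Real.rpow_mul_natCast hM.le]
        ring
      _ = _ := by
        rw [← Real.rpow_add hM, ← Real.rpow_add hM]
        congr 2
        push_cast
        ring
  rw [← Finset.sum_filter_add_sum_filter_not 𝒦 (· ≤ ⌊N ^ 2 / M⌋₊)]
  have hlarge' := hlarge.trans (mul_le_mul_of_nonneg_left ((norm_add_le _ _).trans
    (add_le_add hdiag (hoff'.trans (mul_le_mul_of_nonneg_left hdiv (by positivity)))))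
      (Real.exp_pos _).le)
  refine (add_le_add hsmall hlarge').trans ?_
  generalize ∑ n ∈ S, ‖a n‖ ^ 2 = A at hA ⊢
  calc _ = 2 * C * N ^ (1 + 2 * η) * A + Real.exp Real.pi * (6 * M * A +
        Q * C * (M * M ^ (4 * η) * (D * N ^ η) ^ 5) * A) := by ring
    _ ≤ 2 * C * M ^ (1 + 9 * η) * A + Real.exp Real.pi * (6 * M ^ (1 + 9 * η) * A +
        Q * C * (D ^ 5 * M ^ (1 + 9 * η)) * A) := by gcongr
    _ = _ := by ring

end Dyadic

/-- The quadratic large sieve inequality with exponent `ξ` for the moduli. -/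
def LargeSieveBound (ξ ε C : ℝ) : Prop :=
  ∀ (M N : ℝ) (S 𝒦 : Finset ℕ) (a : ℕ → ℂ), 1 ≤ M → 1 ≤ N →
    (∀ n ∈ S, Odd n ∧ Squarefree n ∧ (n : ℝ) ≤ N) → (∀ K ∈ 𝒦, Squarefree K ∧ (K : ℝ) ≤ M) →
    ∑ K ∈ 𝒦, ‖∑ n ∈ S, a n * jacobiChi n K‖ ^ 2 ≤
      C * (M * N) ^ ε * (M + N ^ ξ) * ∑ n ∈ S, ‖a n‖ ^ 2

theorem sum_norm_sq_le_of_fiberwise {ι κ : Type*} [DecidableEq ι] {S : Finset ℕ} {𝒦 : Finset κ}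
    {I : Finset ι} {φ : ℕ → ι} (hφ : ∀ n ∈ S, φ n ∈ I) (a : ℕ → ℂ) (χ : ℕ → κ → ℂ) {B : ℝ}
    (h : ∀ i ∈ I, ∑ K ∈ 𝒦, ‖∑ n ∈ S with φ n = i, a n * χ n K‖ ^ 2 ≤
      B * ∑ n ∈ S with φ n = i, ‖a n‖ ^ 2) :
    ∑ K ∈ 𝒦, ‖∑ n ∈ S, a n * χ n K‖ ^ 2 ≤ I.card * B * ∑ n ∈ S, ‖a n‖ ^ 2 := by
  calc ∑ K ∈ 𝒦, ‖∑ n ∈ S, a n * χ n K‖ ^ 2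
      ≤ ∑ K ∈ 𝒦, I.card * ∑ i ∈ I, ‖∑ n ∈ S with φ n = i, a n * χ n K‖ ^ 2 := by
        refine Finset.sum_le_sum fun K _ => ?_
        rw [← Finset.sum_fiberwise_of_maps_to hφ]
        exact (pow_le_pow_left₀ (norm_nonneg _) (norm_sum_le _ _) 2).trans
          sq_sum_le_card_mul_sum_sq
    _ = I.card * ∑ i ∈ I, ∑ K ∈ 𝒦, ‖∑ n ∈ S with φ n = i, a n * χ n K‖ ^ 2 := by
        rw [← Finset.mul_sum, Finset.sum_comm]
    _ ≤ I.card * ∑ i ∈ I, B * ∑ n ∈ S with φ n = i, ‖a n‖ ^ 2 := by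
        gcongr with i hi
        exact h i hi
    _ = _ := by
        rw [← Finset.mul_sum, Finset.sum_fiberwise_of_maps_to hφ, mul_assoc]

theorem natLog_add_one_le {η : ℝ} (hη : 0 < η) {N : ℝ} (hN : 1 ≤ N) :
    (Nat.log 2 ⌊N⌋₊ + 1 : ℝ) ≤ (1 + 2 / η) * N ^ η := by
  have h1 : (Nat.log 2 ⌊N⌋₊ : ℝ) ≤ Real.logb 2 ⌊N⌋₊ := by
    exact_mod_cast Real.natLog_le_logb ⌊N⌋₊ 2
  have hf : (1 : ℝ) ≤ ⌊N⌋₊ := by exact_mod_cast Nat.le_floor (by simpa using hN)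
  have h2 : Real.log ⌊N⌋₊ ≤ Real.log N :=
    Real.log_le_log (by linarith) (Nat.floor_le (by linarith))
  have h3 : Real.log N ≤ N ^ η / η := Real.log_le_rpow_div (by linarith) hη
  have h4 : 0 ≤ Real.log ⌊N⌋₊ := Real.log_nonneg hf
  have h5 : Real.logb 2 ⌊N⌋₊ ≤ 2 * Real.log ⌊N⌋₊ := by
    rw [Real.logb, div_le_iff₀ (Real.log_pos one_lt_two)]
    nlinarith [Real.log_two_gt_d9]
  have h6 : 1 ≤ N ^ η := Real.one_le_rpow hN hη.le
  calc (Nat.log 2 ⌊N⌋₊ + 1 : ℝ) ≤ 2 * (N ^ η / η) + N ^ η := by linarith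
    _ = _ := by ring

theorem dyadic_index {N : ℝ} {n : ℕ} (hn : 0 < n) (hnN : (n : ℝ) ≤ N) :
    N / 2 ^ Nat.log 2 ⌊N / n⌋₊ / 2 < n ∧ (n : ℝ) ≤ N / 2 ^ Nat.log 2 ⌊N / n⌋₊ ∧
      Nat.log 2 ⌊N / n⌋₊ ≤ Nat.log 2 ⌊N⌋₊ := by
  have hn0 : (0 : ℝ) < n := by exact_mod_cast hn
  have hn1 : (1 : ℝ) ≤ n := by exact_mod_cast hn
  have h1 : 1 ≤ N / n := (one_le_div hn0).mpr hnN
  have hf : ⌊N / n⌋₊ ≠ 0 := (Nat.floor_pos.mpr h1).ne'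
  have h2 : ((2 ^ Nat.log 2 ⌊N / n⌋₊ : ℕ) : ℝ) ≤ N / n :=
    (Nat.cast_le.mpr (Nat.pow_log_le_self 2 hf)).trans (Nat.floor_le (by linarith))
  have h3 : N / n < (2 ^ (Nat.log 2 ⌊N / n⌋₊ + 1) : ℕ) :=
    (Nat.floor_lt (by linarith)).mp (Nat.lt_pow_succ_log_self one_lt_two _)
  push_cast at h2 h3
  refine ⟨?_, ?_, Nat.log_mono_right (Nat.floor_le_floor ?_)⟩
  · rw [div_div, ← pow_succ, div_lt_iff₀ (by positivity)]
    rwa [div_lt_iff₀ hn0, mul_comm] at h3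
  · rw [le_div_iff₀ (by positivity)]
    rwa [le_div_iff₀ hn0, mul_comm] at h2
  · exact div_le_self (by linarith) hn1

theorem LargeSieveBound.of_kernelSieveBound {ξ : ℝ} (hξ : 1 ≤ ξ) (hξ' : ξ ≤ 3)
    (hP : ∀ ε : ℝ, 0 < ε → ∃ C, 0 ≤ C ∧ KernelSieveBound ξ ε C) {ε : ℝ} (hε : 0 < ε) :
    ∃ C, 0 ≤ C ∧ LargeSieveBound (2 - 1 / ξ) ε C := by
  have hξ0 : 0 < ξ := by linarith
  obtain ⟨η, hη, hηε, hη'⟩ : ∃ η : ℝ, 0 < η ∧ 19 * η ≤ ε ∧ η ≤ 1 / 4 :=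
    ⟨min (ε / 19) (1 / 4), by positivity, by linarith [min_le_left (ε / 19) (1 / 4)],
      min_le_right _ _⟩
  obtain ⟨C, hC, hP⟩ := hP η hη
  obtain ⟨Cδ, hCδ, hδ⟩ := exists_separatesVars_squareGaussError hη (by linarith)
  obtain ⟨Cδ', hCδ', hδ'⟩ := exists_separatesVars_squareGaussError (σ := 1 / 2 - η)
    (by linarith) (by linarith)
  obtain ⟨CV, hCV, hV⟩ := exists_separatesVars_gaussWeight (σ := 4) (by norm_num)
  obtain ⟨D, hD1, hD⟩ := card_divisors_le_rpow_of_squarefree hη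
  obtain ⟨B, hB0, hB⟩ : ∃ B, 0 ≤ B ∧ B = 2 * C + Real.exp Real.pi * (6 + (6 * Cδ + 4 * Cδ' +
      4 * (∑' s : ℕ, (s : ℝ) ^ (-2 * 4 : ℝ)) * CV) * C * D ^ 5) := by
    have hZ : 0 ≤ ∑' s : ℕ, (s : ℝ) ^ (-2 * 4 : ℝ) := tsum_nonneg fun s => by positivity
    exact ⟨_, by positivity, rfl⟩
  refine ⟨4 * (1 + 2 / η) * B, by positivity, fun M N S 𝒦 a hM hN hS h𝒦 => ?_⟩
  have hN0 : 0 < N := by linarith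
  have h1ξ : 1 / ξ ≤ 1 := (div_le_one hξ0).mpr hξ
  have h1ξ' : 0 < 1 / ξ := by positivity
  set M' := max M (N ^ (2 - 1 / ξ)) with hM'
  have hNM : N ^ (2 - 1 / ξ) ≤ M' := le_max_right _ _
  have hM'1 : 1 ≤ M' := hM.trans (le_max_left _ _)
  have hA : 0 ≤ ∑ n ∈ S, ‖a n‖ ^ 2 := Finset.sum_nonneg fun _ _ => by positivity
  have hsplit := sum_norm_sq_le_of_fiberwise (S := S) (𝒦 := 𝒦)
    (I := Finset.range (Nat.log 2 ⌊N⌋₊ + 1) ×ˢ Finset.range 4)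
    (φ := fun n : ℕ => (Nat.log 2 ⌊N / n⌋₊, n % 4)) (fun n hn => by
      have := (dyadic_index (Nat.pos_of_ne_zero (hS n hn).2.1.ne_zero) (hS n hn).2.2).2.2
      simp only [Finset.mem_product, Finset.mem_range]
      omega) a jacobiChi (B := B * M' ^ (1 + 9 * η)) ?_
  · refine hsplit.trans (mul_le_mul_of_nonneg_right ?_ hA)
    rw [Finset.card_product, Finset.card_range, Finset.card_range]
    push_cast
    have e1 := natLog_add_one_le hη hN
    have hMN : 1 ≤ M * N := one_le_mul_of_one_le_of_one_le hM hN
    have e2 : M' ≤ (M * N) ^ (2 : ℝ) := by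
      refine max_le ?_ ?_
      · calc M ≤ M * N := le_mul_of_one_le_right (by linarith) hN
          _ ≤ _ := Real.self_le_rpow_of_one_le hMN (by norm_num)
      · calc N ^ (2 - 1 / ξ) ≤ (M * N) ^ (2 - 1 / ξ) :=
              Real.rpow_le_rpow hN0.le (le_mul_of_one_le_left hN0.le hM) (by linarith)
          _ ≤ _ := Real.rpow_le_rpow_of_exponent_le hMN (by linarith)
    have e3 : M' ≤ M + N ^ (2 - 1 / ξ) := max_le_add_of_nonneg (by linarith) (by positivity)
    have e4 : M' ^ (1 + 9 * η) ≤ (M + N ^ (2 - 1 / ξ)) * (M * N) ^ (18 * η) := by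
      rw [Real.rpow_add (by linarith), Real.rpow_one]
      gcongr
      calc M' ^ (9 * η) ≤ ((M * N) ^ (2 : ℝ)) ^ (9 * η) :=
            Real.rpow_le_rpow (by linarith) e2 (by positivity)
        _ = _ := by
            rw [← Real.rpow_mul (by positivity)]
            ring_nf
    have e5 : N ^ η * (M * N) ^ (18 * η) ≤ (M * N) ^ ε := by
      calc N ^ η * (M * N) ^ (18 * η) ≤ (M * N) ^ η * (M * N) ^ (18 * η) := by
            gcongr
            exact le_mul_of_one_le_left hN0.le hM
        _ = (M * N) ^ (η + 18 * η) := (Real.rpow_add (by positivity) _ _).symm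
        _ ≤ _ := Real.rpow_le_rpow_of_exponent_le hMN (by linarith)
    calc (Nat.log 2 ⌊N⌋₊ + 1 : ℝ) * 4 * (B * M' ^ (1 + 9 * η))
        ≤ (1 + 2 / η) * N ^ η * 4 * (B * ((M + N ^ (2 - 1 / ξ)) * (M * N) ^ (18 * η))) := by
          gcongr
      _ = 4 * (1 + 2 / η) * B * (N ^ η * (M * N) ^ (18 * η)) * (M + N ^ (2 - 1 / ξ)) := by ring
      _ ≤ _ := by gcongr
  · rintro ⟨j, r⟩ -
    rcases (S.filter fun n : ℕ => (Nat.log 2 ⌊N / n⌋₊, n % 4) = (j, r)).eq_empty_or_nonempty with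
      hem | ⟨n₀, hn₀⟩
    · rw [hem]
      simp
    have hmem : ∀ n ∈ S.filter fun n : ℕ => (Nat.log 2 ⌊N / n⌋₊, n % 4) = (j, r),
        Odd n ∧ Squarefree n ∧ N / 2 ^ j / 2 < n ∧ (n : ℝ) ≤ N / 2 ^ j ∧ n % 4 = r := by
      intro n hn
      obtain ⟨hnS, hjr⟩ := Finset.mem_filter.mp hn
      have hjr := Prod.ext_iff.mp hjr
      have := dyadic_index (Nat.pos_of_ne_zero (hS n hnS).2.1.ne_zero) (hS n hnS).2.2
      simp only at hjr
      rw [hjr.1] at this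
      exact ⟨(hS n hnS).1, (hS n hnS).2.1, this.1, this.2.1, hjr.2⟩
    have hn₀ := hmem n₀ hn₀
    have hNj : 1 ≤ N / 2 ^ j := le_trans (by exact_mod_cast Nat.pos_of_ne_zero hn₀.2.1.ne_zero)
      hn₀.2.2.2.1
    have hNjN : N / 2 ^ j ≤ N := div_le_self hN0.le (one_le_pow₀ (by norm_num))
    have hNjM : (N / 2 ^ j) ^ (2 - 1 / ξ) ≤ M' :=
      (Real.rpow_le_rpow (by positivity) hNjN (by linarith)).trans hNM
    rw [hB]
    refine sum_norm_sq_dyadic_le hP hC hNj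
      ((Real.self_le_rpow_of_one_le hNj (by linarith)).trans hNjM) ?_ hξ hη hmem a (by linarith)
      (by linarith) hδ hCδ hδ' hCδ' hV hCV hD fun K hK => ⟨(h𝒦 K hK).1,
        (h𝒦 K hK).2.trans (le_max_left _ _)⟩
    generalize N / 2 ^ j = L at hNj hNjM
    have hL0 : 0 < L := by linarith
    calc (L ^ 2 / M') ^ ξ ≤ (L ^ (1 / ξ)) ^ ξ := by
          refine Real.rpow_le_rpow (by positivity) ?_ hξ0.le
          rw [div_le_iff₀ (by linarith)]
          calc L ^ 2 = L ^ (1 / ξ) * L ^ (2 - 1 / ξ) := by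
                rw [← Real.rpow_add hL0, ← Real.rpow_natCast]
                congr 1
                push_cast
                ring
            _ ≤ _ := by gcongr
      _ = L := by rw [← Real.rpow_mul hL0.le, one_div_mul_cancel hξ0.ne', Real.rpow_one]

theorem exists_jacobiSym_eq_neg_one_of_prime {p n₁ n₂ : ℕ} (hp : p.Prime) (h₁ : Odd n₁)
    (hsq : Squarefree n₁) (h₂ : n₂ ≠ 0) (hp₁ : p ∣ n₁) (hp₂ : ¬p ∣ n₂) :
    ∃ c : ℕ, jacobiSym c (n₁ * n₂) = -1 := by
  have : Fact p.Prime := ⟨hp⟩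
  obtain ⟨m, rfl⟩ := hp₁
  obtain ⟨hpm, -, hm⟩ := Nat.squarefree_mul_iff.mp hsq
  have hp2 : ringChar (ZMod p) ≠ 2 := by
    rw [ZMod.ringChar_zmod_n]
    rintro rfl
    exact absurd (Nat.odd_mul.mp h₁).1 (by decide)
  obtain ⟨x, hx⟩ := FiniteField.exists_nonsquare hp2
  have hu : jacobiSym (x.val : ℤ) p = -1 := by
    rw [← jacobiSym.legendreSym.to_jacobiSym, legendreSym.eq_neg_one_iff]
    simpa using hx
  obtain ⟨c, hc₁, hc₂⟩ := Nat.chineseRemainder (hpm.mul_right ((hp.coprime_iff_not_dvd).mpr hp₂))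
    x.val 1
  refine ⟨c, ?_⟩
  rw [mul_assoc, jacobiSym.mul_right' _ hp.ne_zero (mul_ne_zero hm.ne_zero h₂),
    jacobiSym_eq_of_modEq (Int.natCast_modEq_iff.mpr hc₁),
    jacobiSym_eq_of_modEq (Int.natCast_modEq_iff.mpr hc₂), hu]
  simp

theorem exists_jacobiSym_eq_neg_one {n₁ n₂ : ℕ} (h₁ : Odd n₁) (h₂ : Odd n₂) (hsq₁ : Squarefree n₁)
    (hsq₂ : Squarefree n₂) (hne : n₁ ≠ n₂) : ∃ c : ℕ, jacobiSym c (n₁ * n₂) = -1 := by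
  by_contra! hno
  refine hne ?_
  rw [← Nat.prod_primeFactors_of_squarefree hsq₁, ← Nat.prod_primeFactors_of_squarefree hsq₂]
  congr 1
  ext p
  simp only [Nat.mem_primeFactors, hsq₁.ne_zero, hsq₂.ne_zero, ne_eq, not_false_eq_true, and_true]
  refine and_congr_right fun hp => ⟨fun hd => ?_, fun hd => ?_⟩ <;> by_contra hd'
  · obtain ⟨c, hc⟩ := exists_jacobiSym_eq_neg_one_of_prime hp h₁ hsq₁ hsq₂.ne_zero hd hd'
    exact hno c hc
  · obtain ⟨c, hc⟩ := exists_jacobiSym_eq_neg_one_of_prime hp h₂ hsq₂ hsq₁.ne_zero hd hd'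
    exact hno c (mul_comm n₁ n₂ ▸ hc)

theorem sum_range_jacobiSym_eq_zero {q c : ℕ} (hq : q ≠ 0) (hc : jacobiSym c q = -1) :
    ∑ m ∈ Finset.range q, jacobiChi q m = 0 := by
  have hcop : IsCoprime (c : ℤ) q := by
    rw [Int.isCoprime_iff_gcd_eq_one]
    by_contra hg
    rw [jacobiSym.eq_zero_iff.mpr ⟨hq, hg⟩] at hc
    norm_num at hc
  have h1 := sum_range_mul_unit hq hcop (fun a => (jacobiSym a q : ℂ))
    fun a b hab => by rw [jacobiSym_eq_of_modEq hab]
  simp_rw [jacobiSym.mul_left, hc] at h1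
  push_cast at h1
  rw [← Finset.mul_sum] at h1
  change ∑ m ∈ Finset.range q, (jacobiSym m q : ℂ) = 0
  linear_combination (-1 / 2) * h1

theorem norm_sum_range_le_of_periodic {q : ℕ} (hq : 0 < q) {f : ℕ → ℂ} (hf : ∀ m, f (q + m) = f m)
    (hf1 : ∀ m, ‖f m‖ ≤ 1) (h0 : ∑ m ∈ Finset.range q, f m = 0) (k : ℕ) :
    ‖∑ m ∈ Finset.range k, f m‖ ≤ q := by
  induction k using Nat.strong_induction_on with
  | _ k ih =>
    rcases le_or_gt k q with hk | hk
    · refine (norm_sum_le_of_le _ fun m _ => hf1 m).trans ?_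
      simpa using hk
    · obtain ⟨k, rfl⟩ := Nat.exists_eq_add_of_le hk.le
      rw [Finset.sum_range_add, h0, zero_add]
      simp_rw [hf]
      exact ih k (by omega)

theorem norm_sum_range_jacobiChi_mul_le {n₁ n₂ : ℕ} (h₁ : Odd n₁) (h₂ : Odd n₂)
    (hsq₁ : Squarefree n₁) (hsq₂ : Squarefree n₂) (hne : n₁ ≠ n₂) (k : ℕ) :
    ‖∑ m ∈ Finset.range k, jacobiChi n₁ m * jacobiChi n₂ m‖ ≤ n₁ * n₂ := by
  obtain ⟨c, hc⟩ := exists_jacobiSym_eq_neg_one h₁ h₂ hsq₁ hsq₂ hne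
  simp_rw [← jacobiChi_mul_modulus hsq₁.ne_zero hsq₂.ne_zero]
  rw [← Nat.cast_mul]
  refine norm_sum_range_le_of_periodic
    (Nat.mul_pos h₁.pos h₂.pos) (fun m => ?_) (norm_jacobiChi_le_one _)
    (sum_range_jacobiSym_eq_zero (mul_ne_zero hsq₁.ne_zero hsq₂.ne_zero) hc) k
  rw [jacobiChi, jacobiChi, jacobiSym_eq_of_modEq (b := (m : ℤ))]
  rw [Int.natCast_modEq_iff]
  simp [Nat.ModEq]

theorem largeSieveBound_three {ε : ℝ} (hε : 0 < ε) : LargeSieveBound 3 ε 2 := by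
  intro M N S 𝒦 a hM hN hS h𝒦
  have hA : 0 ≤ ∑ n ∈ S, ‖a n‖ ^ 2 := Finset.sum_nonneg fun _ _ => by positivity
  set k := ⌊M⌋₊ + 1 with hk
  have hkM : (k : ℝ) ≤ 2 * M := by
    have := Nat.floor_le (show 0 ≤ M by linarith)
    push_cast [hk]
    linarith
  have h1 : ∑ K ∈ 𝒦, ‖∑ n ∈ S, a n * jacobiChi n K‖ ^ 2 ≤
      ∑ m ∈ Finset.range k, ‖∑ n ∈ S, a n * jacobiChi n m‖ ^ 2 := by
    refine Finset.sum_le_sum_of_subset_of_nonneg (fun K hK => ?_) fun _ _ _ => sq_nonneg _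
    exact Finset.mem_range_succ_iff.mpr (Nat.le_floor (h𝒦 K hK).2)
  have h2 : ((∑ m ∈ Finset.range k, ‖∑ n ∈ S, a n * jacobiChi n m‖ ^ 2 : ℝ) : ℂ) =
      ∑ n₁ ∈ S, ∑ n₂ ∈ S, a n₁ * (starRingEnd ℂ) (a n₂) *
        ∑ m ∈ Finset.range k, jacobiChi n₁ m * jacobiChi n₂ m := by
    rw [Complex.ofReal_sum]
    simp_rw [norm_sq_sum_jacobiChi, Finset.mul_sum]
    rw [Finset.sum_comm]
    exact Finset.sum_congr rfl fun _ _ => Finset.sum_comm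
  have h3 : ∀ n₁ ∈ S, ∀ n₂ ∈ S, ‖a n₁ * (starRingEnd ℂ) (a n₂) *
      ∑ m ∈ Finset.range k, jacobiChi n₁ m * jacobiChi n₂ m‖ ≤
      (if n₁ = n₂ then k * ‖a n₁‖ ^ 2 else 0) + N ^ 2 * (‖a n₁‖ * ‖a n₂‖) := by
    intro n₁ hn₁ n₂ hn₂
    rw [norm_mul, norm_mul, Complex.norm_conj]
    split_ifs with h
    · subst h
      have : ‖∑ m ∈ Finset.range k, jacobiChi n₁ m * jacobiChi n₁ m‖ ≤ k := by
        refine (norm_sum_le_of_le _ fun m _ => ?_).trans (b := ∑ m ∈ Finset.range k, (1 : ℝ))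
          (by simp)
        rw [norm_mul]
        exact mul_le_one₀ (norm_jacobiChi_le_one _ _) (norm_nonneg _) (norm_jacobiChi_le_one _ _)
      calc ‖a n₁‖ * ‖a n₁‖ * ‖∑ m ∈ Finset.range k, jacobiChi n₁ m * jacobiChi n₁ m‖
          ≤ ‖a n₁‖ * ‖a n₁‖ * k := by gcongr
        _ = k * ‖a n₁‖ ^ 2 := by ring
        _ ≤ _ := le_add_of_nonneg_right (by positivity)
    · have h4 := norm_sum_range_jacobiChi_mul_le (hS _ hn₁).1 (hS _ hn₂).1 (hS _ hn₁).2.1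
        (hS _ hn₂).2.1 h k
      calc _ ≤ ‖a n₁‖ * ‖a n₂‖ * (N * N) := by
            gcongr
            refine h4.trans ?_
            gcongr
            exacts [(hS _ hn₁).2.2, (hS _ hn₂).2.2]
        _ = _ := by ring
  have hcard : (S.card : ℝ) ≤ N := by
    have : S ⊆ Finset.Icc 1 ⌊N⌋₊ := fun n hn => Finset.mem_Icc.mpr
      ⟨Nat.pos_of_ne_zero (hS n hn).2.1.ne_zero, Nat.le_floor (hS n hn).2.2⟩
    have := Finset.card_le_card this
    rw [Nat.card_Icc, Nat.add_sub_cancel] at this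
    exact (Nat.cast_le.mpr this).trans (Nat.floor_le (by linarith))
  have h5 : ∑ m ∈ Finset.range k, ‖∑ n ∈ S, a n * jacobiChi n m‖ ^ 2 ≤
      (k + N ^ 3) * ∑ n ∈ S, ‖a n‖ ^ 2 := by
    have h6 := norm_sum_le_of_le S fun n₁ hn₁ => norm_sum_le_of_le S (h3 n₁ hn₁)
    rw [← h2, Complex.norm_real] at h6
    refine (Real.le_norm_self _).trans (h6.trans ?_)
    simp_rw [Finset.sum_add_distrib, ← Finset.mul_sum]
    rw [← Finset.sum_mul, ← sq]
    have h7 : (∑ n ∈ S, ‖a n‖) ^ 2 ≤ S.card * ∑ n ∈ S, ‖a n‖ ^ 2 := sq_sum_le_card_mul_sum_sq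
    have h8 : ∑ n₁ ∈ S, ∑ n₂ ∈ S, (if n₁ = n₂ then k * ‖a n₁‖ ^ 2 else 0) =
        k * ∑ n ∈ S, ‖a n‖ ^ 2 := by
      rw [Finset.mul_sum]
      exact Finset.sum_congr rfl fun n hn => by rw [Finset.sum_ite_eq, if_pos hn]
    rw [h8, add_mul]
    refine add_le_add le_rfl ?_
    calc N ^ 2 * (∑ n ∈ S, ‖a n‖) ^ 2 ≤ N ^ 2 * (N * ∑ n ∈ S, ‖a n‖ ^ 2) := by
          gcongr
          exact h7.trans (by gcongr)
      _ = N ^ 3 * ∑ n ∈ S, ‖a n‖ ^ 2 := by ring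
  refine h1.trans (h5.trans (mul_le_mul_of_nonneg_right ?_ hA))
  have h9 : 1 ≤ (M * N) ^ ε := Real.one_le_rpow (one_le_mul_of_one_le_of_one_le hM hN) hε.le
  have h10 : N ^ (3 : ℝ) = N ^ 3 := by norm_cast
  have h11 : 0 ≤ N ^ 3 := by positivity
  rw [h10]
  calc (k + N ^ 3 : ℝ) ≤ 2 * 1 * (M + N ^ 3) := by linarith
    _ ≤ _ := by gcongr

theorem duality_principle {ι κ : Type*} {S : Finset ι} {𝒦 : Finset κ} (χ : ι → κ → ℂ) {B : ℝ}
    (h : ∀ c : κ → ℂ, ∑ n ∈ S, ‖∑ K ∈ 𝒦, c K * χ n K‖ ^ 2 ≤ B * ∑ K ∈ 𝒦, ‖c K‖ ^ 2)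
    (hB : 0 ≤ B) (b : ι → ℂ) :
    ∑ K ∈ 𝒦, ‖∑ n ∈ S, b n * χ n K‖ ^ 2 ≤ B * ∑ n ∈ S, ‖b n‖ ^ 2 := by
  set T : κ → ℂ := fun K => ∑ n ∈ S, b n * χ n K with hT
  set L : ℝ := ∑ K ∈ 𝒦, ‖T K‖ ^ 2 with hL
  have h1 : (L : ℂ) = ∑ n ∈ S, b n * ∑ K ∈ 𝒦, (starRingEnd ℂ) (T K) * χ n K := by
    rw [hL, Complex.ofReal_sum]
    simp_rw [Finset.mul_sum]
    rw [Finset.sum_comm]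
    refine Finset.sum_congr rfl fun K _ => ?_
    rw [Complex.ofReal_pow, ← Complex.conj_mul']
    conv_lhs => rw [hT]
    rw [Finset.mul_sum]
    exact Finset.sum_congr rfl fun n _ => by ring
  have hL0 : 0 ≤ L := Finset.sum_nonneg fun _ _ => by positivity
  have h2 : L ≤ ∑ n ∈ S, ‖b n‖ * ‖∑ K ∈ 𝒦, (starRingEnd ℂ) (T K) * χ n K‖ := by
    calc L = ‖(L : ℂ)‖ := by rw [Complex.norm_real, Real.norm_of_nonneg hL0]
      _ ≤ _ := by
        rw [h1]
        exact norm_sum_le_of_le _ fun n _ => (norm_mul _ _).le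
  have h3 := h fun K => (starRingEnd ℂ) (T K)
  simp only [Complex.norm_conj] at h3
  have h4 : L ^ 2 ≤ (∑ n ∈ S, ‖b n‖ ^ 2) * (B * L) :=
    (pow_le_pow_left₀ hL0 h2 2).trans ((Finset.sum_mul_sq_le_sq_mul_sq _ _ _).trans
      (mul_le_mul_of_nonneg_left h3 (Finset.sum_nonneg fun _ _ => by positivity)))
  rcases hL0.eq_or_lt with h0 | h0
  · rw [← h0]
    exact mul_nonneg hB (Finset.sum_nonneg fun _ _ => by positivity)
  · refine le_of_mul_le_mul_right ?_ h0
    calc L * L = L ^ 2 := by ring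
      _ ≤ _ := h4
      _ = _ := by ring

theorem norm_sum_jacobiChi_sq_le_reciprocal {n : ℕ} (hn : Odd n) {𝒦 : Finset ℕ}
    (h𝒦 : ∀ K ∈ 𝒦, Odd K) (c : ℕ → ℂ) :
    ‖∑ K ∈ 𝒦, c K * jacobiChi n K‖ ^ 2 ≤ ‖∑ K ∈ 𝒦, c K * jacobiChi K n‖ ^ 2 +
      ‖∑ K ∈ 𝒦, c K * (if K % 4 = 3 then -1 else 1) * jacobiChi K n‖ ^ 2 := by
  by_cases h3 : n % 4 = 3
  · refine (le_of_eq ?_).trans (le_add_of_nonneg_left (sq_nonneg _))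
    congr 2
    refine Finset.sum_congr rfl fun K hK => ?_
    rw [mul_assoc, jacobiChi, jacobiChi,
      ← jacobiSym.quadratic_reciprocity_if (Nat.odd_iff.mp (h𝒦 K hK)) (Nat.odd_iff.mp hn)]
    by_cases hK3 : K % 4 = 3 <;> simp [h3, hK3]
  · refine (le_of_eq ?_).trans (le_add_of_nonneg_right (sq_nonneg _))
    congr 2
    refine Finset.sum_congr rfl fun K hK => ?_
    rw [jacobiChi, jacobiChi,
      ← jacobiSym.quadratic_reciprocity_if (Nat.odd_iff.mp (h𝒦 K hK)) (Nat.odd_iff.mp hn)]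
    simp [h3]

section
variable {ξ ε C : ℝ} (hH : LargeSieveBound ξ ε C) (hC : 0 ≤ C) {X Y : ℝ} (hX : 1 ≤ X)
  (hY : 1 ≤ Y) {S 𝒦 : Finset ℕ} (hS : ∀ n ∈ S, Odd n ∧ Squarefree n ∧ (n : ℝ) ≤ Y)
include hH hC hX hY hS

theorem LargeSieveBound.dual_of_odd
    (h𝒦 : ∀ K ∈ 𝒦, Odd K ∧ Squarefree K ∧ (K : ℝ) ≤ X) (b : ℕ → ℂ) :
    ∑ K ∈ 𝒦, ‖∑ n ∈ S, b n * jacobiChi n K‖ ^ 2 ≤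
      2 * C * (X * Y) ^ ε * (Y + X ^ ξ) * ∑ n ∈ S, ‖b n‖ ^ 2 := by
  refine duality_principle _ (fun c => ?_) (by positivity) b
  have hH' := fun c : ℕ → ℂ => hH Y X 𝒦 S c hY hX h𝒦 fun n hn => (hS n hn).2
  have h1 := hH' c
  have h2 := hH' fun K => c K * (if K % 4 = 3 then -1 else 1)
  have h3 : ∀ K : ℕ, ‖c K * (if K % 4 = 3 then -1 else 1)‖ = ‖c K‖ := fun K => by
    rw [norm_mul]
    split_ifs <;> simp
  simp only [h3] at h2
  refine (Finset.sum_le_sum fun n hn => norm_sum_jacobiChi_sq_le_reciprocal (hS n hn).1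
    (fun K hK => (h𝒦 K hK).1) c).trans ?_
  rw [Finset.sum_add_distrib]
  refine (add_le_add h1 h2).trans_eq ?_
  rw [mul_comm Y X]
  ring

theorem LargeSieveBound.dual
    (h𝒦 : ∀ K ∈ 𝒦, Squarefree K ∧ (K : ℝ) ≤ X) (b : ℕ → ℂ) :
    ∑ K ∈ 𝒦, ‖∑ n ∈ S, b n * jacobiChi n K‖ ^ 2 ≤
      4 * C * (X * Y) ^ ε * (Y + X ^ ξ) * ∑ n ∈ S, ‖b n‖ ^ 2 := by
  have hodd := hH.dual_of_odd hC hX hY hS (𝒦 := 𝒦.filter Odd) (fun K hK =>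
    ⟨(Finset.mem_filter.mp hK).2, h𝒦 K (Finset.mem_filter.mp hK).1⟩) b
  have htwo : ∀ K ∈ 𝒦.filter (¬ Odd ·), 2 * (K / 2) = K := fun K hK =>
    Nat.two_mul_div_two_of_even (Nat.not_odd_iff_even.mp (Finset.mem_filter.mp hK).2)
  have hinj : Set.InjOn (· / 2) (𝒦.filter (¬ Odd ·) : Set ℕ) := fun K hK L hL h => by
    rw [← htwo K hK, ← htwo L hL]
    exact congrArg _ h
  have heven := hH.dual_of_odd hC hX hY hS (𝒦 := (𝒦.filter (¬ Odd ·)).image (· / 2)) (by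
    intro K' hK'
    obtain ⟨K, hK, rfl⟩ := Finset.mem_image.mp hK'
    have h1 := h𝒦 K (Finset.mem_filter.mp hK).1
    have h2 := h1.1
    rw [← htwo K hK] at h2
    have h3 := Nat.squarefree_mul_iff.mp h2
    refine ⟨(Nat.coprime_two_left).mp h3.1, h3.2.2, le_trans ?_ h1.2⟩
    exact_mod_cast Nat.div_le_self K 2) fun n => b n * jacobiChi n 2
  rw [Finset.sum_image hinj] at heven
  rw [← Finset.sum_filter_add_sum_filter_not 𝒦 Odd]
  have h4 : ∑ n ∈ S, ‖b n * jacobiChi n 2‖ ^ 2 ≤ ∑ n ∈ S, ‖b n‖ ^ 2 := by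
    gcongr with n
    rw [norm_mul]
    exact mul_le_of_le_one_right (norm_nonneg _) (norm_jacobiChi_le_one _ _)
  have h5 : ∑ K ∈ 𝒦 with ¬ Odd K, ‖∑ n ∈ S, b n * jacobiChi n K‖ ^ 2 =
      ∑ K ∈ 𝒦 with ¬ Odd K, ‖∑ n ∈ S, b n * jacobiChi n 2 * jacobiChi n (K / 2)‖ ^ 2 := by
    refine Finset.sum_congr rfl fun K hK => ?_
    congr 2
    refine Finset.sum_congr rfl fun n _ => ?_
    rw [mul_assoc, ← jacobiChi_mul, htwo K hK]
  rw [h5]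
  calc _ ≤ _ := add_le_add hodd (heven.trans (mul_le_mul_of_nonneg_left h4 (by positivity)))
    _ = _ := by ring

end

theorem KernelSieveBound.of_largeSieveBound {ξ : ℝ} (hξ : 1 ≤ ξ) (hξ' : ξ ≤ 3)
    (hH : ∀ ε : ℝ, 0 < ε → ∃ C, 0 ≤ C ∧ LargeSieveBound ξ ε C) {ε : ℝ} (hε : 0 < ε) :
    ∃ C, 0 ≤ C ∧ KernelSieveBound ξ ε C := by
  obtain ⟨η, hη, rfl⟩ : ∃ η, 0 < η ∧ ε = η + η := ⟨ε / 2, by linarith, by ring⟩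
  obtain ⟨C, hC, hCH⟩ := hH η hη
  have hr0 : 0 ≤ (2 : ℝ) ^ (-η) := by positivity
  have hr1 : (2 : ℝ) ^ (-η) < 1 := Real.rpow_lt_one_of_one_lt_of_neg one_lt_two (by linarith)
  refine ⟨32 * 2 ^ η * C * (1 - 2 ^ (-η))⁻¹,
    mul_nonneg (by positivity) (inv_nonneg.mpr (by linarith)), ?_⟩
  intro Y S 𝒦 b hY hS h𝒦
  set F : ℕ → ℝ := fun K => ‖∑ n ∈ S, b n * jacobiChi n K‖ ^ 2 with hF
  set A : ℝ := ∑ n ∈ S, ‖b n‖ ^ 2 with hA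
  have hA0 : 0 ≤ A := Finset.sum_nonneg fun _ _ => by positivity
  have hfib : ∀ j : ℕ, ∑ K ∈ 𝒦 with Nat.log 2 K = j,
      F K * ((K : ℝ) ^ (η + η) * (Y + (K : ℝ) ^ ξ))⁻¹ ≤
      (2 ^ (-η)) ^ j * (32 * 2 ^ η * C * Y ^ η * A) := by
    intro j
    set x : ℝ := 2 ^ j with hx
    have hx1 : 1 ≤ x := one_le_pow₀ one_le_two
    have hx0 : 0 < x := by linarith
    have hK1 : ∀ K ∈ 𝒦.filter (Nat.log 2 · = j), Squarefree K ∧ (K : ℝ) ≤ 2 * x := by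
      intro K hK
      obtain ⟨hK, hj⟩ := Finset.mem_filter.mp hK
      refine ⟨h𝒦 K hK, ?_⟩
      have := (Nat.lt_pow_succ_log_self one_lt_two K).le
      rw [hj, pow_succ'] at this
      rw [hx]
      exact_mod_cast this
    have hw : ∀ K ∈ 𝒦.filter (Nat.log 2 · = j),
        ((K : ℝ) ^ (η + η) * (Y + (K : ℝ) ^ ξ))⁻¹ ≤ (x ^ (η + η) * (Y + x ^ ξ))⁻¹ := by
      intro K hK
      obtain ⟨hK, hj⟩ := Finset.mem_filter.mp hK
      have : x ≤ K := by
        have := Nat.pow_log_le_self 2 (h𝒦 K hK).ne_zero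
        rw [hj] at this
        rw [hx]
        exact_mod_cast this
      gcongr
    have hd := hCH.dual hC (X := 2 * x) (by linarith) hY hS hK1 b
    have h8 : (2 : ℝ) ^ ξ ≤ 8 := (Real.rpow_le_rpow_of_exponent_le one_le_two hξ').trans
      (by norm_num)
    have hxj : x ^ (-η) = (2 ^ (-η)) ^ j := by
      rw [hx, ← Real.rpow_natCast, ← Real.rpow_mul (by norm_num), mul_comm,
        Real.rpow_mul (by norm_num), Real.rpow_natCast]
    have h9 : Y + (2 * x) ^ ξ ≤ 8 * (Y + x ^ ξ) := by
      rw [Real.mul_rpow (by norm_num) hx0.le]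
      nlinarith [Real.rpow_pos_of_pos hx0 ξ]
    calc _ ≤ ∑ K ∈ 𝒦 with Nat.log 2 K = j, F K * (x ^ (η + η) * (Y + x ^ ξ))⁻¹ :=
          Finset.sum_le_sum fun K hK => mul_le_mul_of_nonneg_left (hw K hK) (sq_nonneg _)
      _ ≤ 4 * C * (2 * x * Y) ^ η * (8 * (Y + x ^ ξ)) * A * (x ^ (η + η) * (Y + x ^ ξ))⁻¹ := by
          rw [← Finset.sum_mul]
          refine mul_le_mul_of_nonneg_right (hd.trans ?_) (by positivity)
          gcongr
      _ = _ := by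
          rw [← hxj, Real.mul_rpow (by positivity) (by positivity),
            Real.mul_rpow (by positivity) (by positivity), Real.rpow_add hx0,
            Real.rpow_neg hx0.le]
          have : 0 < x ^ η := by positivity
          have : 0 < Y + x ^ ξ := by positivity
          field_simp
          ring
  set I := 𝒦.image (Nat.log 2) with hI
  rw [← Finset.sum_fiberwise_of_maps_to (t := I) (g := Nat.log 2)
    fun K hK => Finset.mem_image_of_mem _ hK]
  have hgeom : ∑ j ∈ I, ((2 : ℝ) ^ (-η)) ^ j ≤ (1 - 2 ^ (-η))⁻¹ := by
    rw [← tsum_geometric_of_lt_one hr0 hr1]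
    exact (summable_geometric_of_lt_one hr0 hr1).sum_le_tsum _ fun j _ => by positivity
  calc _ ≤ ∑ j ∈ I, (2 ^ (-η)) ^ j * (32 * 2 ^ η * C * Y ^ η * A) :=
        Finset.sum_le_sum fun j _ => hfib j
    _ ≤ (1 - 2 ^ (-η))⁻¹ * (32 * 2 ^ η * C * Y ^ η * A) := by
        rw [← Finset.sum_mul]
        exact mul_le_mul_of_nonneg_right hgeom (by positivity)
    _ = 32 * 2 ^ η * C * (1 - 2 ^ (-η))⁻¹ * Y ^ η * A := by ring
    _ ≤ _ := by
        have : 0 ≤ (1 - (2 : ℝ) ^ (-η))⁻¹ := inv_nonneg.mpr (by linarith)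
        gcongr
        linarith

theorem LargeSieveBound.mono {ξ ξ' ε C : ℝ} (h : LargeSieveBound ξ ε C) (hC : 0 ≤ C)
    (hξ : ξ ≤ ξ') : LargeSieveBound ξ' ε C := by
  intro M N S 𝒦 a hM hN hS h𝒦
  refine (h M N S 𝒦 a hM hN hS h𝒦).trans ?_
  gcongr

theorem exists_largeSieveBound_iterate (k : ℕ) :
    ∀ ε : ℝ, 0 < ε → ∃ C, 0 ≤ C ∧ LargeSieveBound (1 + 2 / (2 * k + 1)) ε C := by
  induction k with
  | zero =>
    intro ε hε
    refine ⟨2, zero_le_two, ?_⟩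
    norm_num
    exact largeSieveBound_three hε
  | succ k ih =>
    intro ε hε
    have h0 : (0 : ℝ) < 2 * k + 1 := by positivity
    have h1 : 1 ≤ 1 + 2 / (2 * (k : ℝ) + 1) := le_add_of_nonneg_right (by positivity)
    have h2 : 1 + 2 / (2 * (k : ℝ) + 1) ≤ 3 := by
      have : 2 / (2 * (k : ℝ) + 1) ≤ 2 := div_le_self zero_le_two (by
        have : (0 : ℝ) ≤ k := Nat.cast_nonneg k
        linarith)
      linarith
    obtain ⟨C, hC, h⟩ := LargeSieveBound.of_kernelSieveBound h1 h2
      (fun ε hε => KernelSieveBound.of_largeSieveBound h1 h2 ih hε) hε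
    refine ⟨C, hC, ?_⟩
    convert h using 1
    push_cast
    field_simp
    ring

theorem exists_largeSieveBound {δ ε : ℝ} (hδ : 0 < δ) (hε : 0 < ε) :
    ∃ C, 0 ≤ C ∧ LargeSieveBound (1 + δ) ε C := by
  obtain ⟨k, hk⟩ := exists_nat_gt (2 / δ)
  obtain ⟨C, hC, h⟩ := exists_largeSieveBound_iterate k ε hε
  refine ⟨C, hC, h.mono hC ?_⟩
  have h0 : (0 : ℝ) < 2 * k + 1 := by positivity
  have h1 : 2 < k * δ := by rwa [div_lt_iff₀ hδ] at hk
  have : 2 / (2 * (k : ℝ) + 1) ≤ δ := by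
    rw [div_le_iff₀ h0]
    nlinarith
  linarith

theorem norm_sum_sum_jacobiChi_le {ε : ℝ} (hε : 0 < ε) :
    ∃ C, 0 < C ∧ ∀ (M N : ℝ) (S 𝒦 : Finset ℕ) (α β : ℕ → ℂ), 1 ≤ M → 1 ≤ N →
      (∀ n ∈ S, Odd n ∧ Squarefree n ∧ (n : ℝ) ≤ N) → (∀ m ∈ 𝒦, Squarefree m ∧ (m : ℝ) ≤ M) →
      (∀ m, ‖α m‖ ≤ 1) → (∀ n, ‖β n‖ ≤ 1) →
      ‖∑ m ∈ 𝒦, ∑ n ∈ S, α m * β n * jacobiChi n m‖ ≤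
        C * M * N * (M ^ (-(1 : ℝ) / 2) + N ^ (-(1 : ℝ) / 2)) * (M * N) ^ ε := by
  obtain ⟨C, hC, hL⟩ := exists_largeSieveBound hε hε
  refine ⟨C + 1, by linarith, fun M N S 𝒦 α β hM hN hS h𝒦 hα hβ => ?_⟩
  have hM0 : 0 < M := by linarith
  have hN0 : 0 < N := by linarith
  have hcard : ∀ (T : Finset ℕ) (x : ℝ), 1 ≤ x → (∀ n ∈ T, Squarefree n ∧ (n : ℝ) ≤ x) →
      (T.card : ℝ) ≤ x := fun T x hx hT => by
    have h : T ⊆ Finset.Icc 1 ⌊x⌋₊ := fun n hn => Finset.mem_Icc.mpr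
      ⟨Nat.pos_of_ne_zero (hT n hn).1.ne_zero, Nat.le_floor (hT n hn).2⟩
    have h := Finset.card_le_card h
    rw [Nat.card_Icc, Nat.add_sub_cancel] at h
    exact (Nat.cast_le.mpr h).trans (Nat.floor_le (by linarith))
  have hA : ∑ n ∈ S, ‖β n‖ ^ 2 ≤ N := by
    refine le_trans ?_ (hcard S N hN fun n hn => (hS n hn).2)
    rw [Finset.card_eq_sum_ones, Nat.cast_sum]
    gcongr with n
    simpa using hβ n
  have h1 : ‖∑ m ∈ 𝒦, ∑ n ∈ S, α m * β n * jacobiChi n m‖ ≤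
      ∑ m ∈ 𝒦, ‖∑ n ∈ S, β n * jacobiChi n m‖ := by
    refine norm_sum_le_of_le _ fun m _ => ?_
    simp_rw [mul_assoc, ← Finset.mul_sum, norm_mul]
    exact mul_le_of_le_one_left (norm_nonneg _) (hα m)
  have h2 : ‖∑ m ∈ 𝒦, ∑ n ∈ S, α m * β n * jacobiChi n m‖ ^ 2 ≤
      M * (C * (M * N) ^ ε * (M + N ^ (1 + ε)) * N) := by
    refine (pow_le_pow_left₀ (norm_nonneg _) h1 2).trans (sq_sum_le_card_mul_sum_sq.trans ?_)
    exact mul_le_mul (hcard 𝒦 M hM h𝒦) ((hL M N S 𝒦 β hM hN hS h𝒦).trans (by gcongr))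
      (Finset.sum_nonneg fun _ _ => by positivity) hM0.le
  refine le_of_sq_le_sq ?_ (by positivity)
  refine h2.trans ?_
  have hMs : (M ^ (-(1 : ℝ) / 2)) ^ 2 = M⁻¹ := by
    rw [← Real.rpow_natCast, ← Real.rpow_mul hM0.le]
    norm_num [Real.rpow_neg_one]
  have hNs : (N ^ (-(1 : ℝ) / 2)) ^ 2 = N⁻¹ := by
    rw [← Real.rpow_natCast, ← Real.rpow_mul hN0.le]
    norm_num [Real.rpow_neg_one]
  have hE : 1 ≤ (M * N) ^ ε := Real.one_le_rpow (one_le_mul_of_one_le_of_one_le hM hN) hε.le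
  have hNE : N ^ (1 + ε) ≤ N * (M * N) ^ ε := by
    rw [Real.rpow_add hN0, Real.rpow_one]
    gcongr
    exact le_mul_of_one_le_left hN0.le hM
  have hx : 0 < M ^ (-(1 : ℝ) / 2) := by positivity
  have hy : 0 < N ^ (-(1 : ℝ) / 2) := by positivity
  generalize M ^ (-(1 : ℝ) / 2) = x at *
  generalize N ^ (-(1 : ℝ) / 2) = y at *
  generalize (M * N) ^ ε = E at *
  calc M * (C * E * (M + N ^ (1 + ε)) * N)
      ≤ M * (C * E * (M * E + N * E) * N) := by
        gcongr
        exact le_mul_of_one_le_right hM0.le hE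
    _ = C * (M * N * E) ^ 2 * (M⁻¹ + N⁻¹) := by
        field_simp
        ring
    _ = C * (M * N * E) ^ 2 * (x ^ 2 + y ^ 2) := by rw [hMs, hNs]
    _ ≤ (C + 1) ^ 2 * (M * N * E) ^ 2 * (x + y) ^ 2 := by
        gcongr
        · nlinarith
        · nlinarith
    _ = _ := by ring

theorem squarefree_two_mul_iff {n : ℕ} : Squarefree (2 * n) ↔ Odd n ∧ Squarefree n := by
  rw [Nat.squarefree_mul_iff, Nat.coprime_two_left]
  exact ⟨fun h => ⟨h.1, h.2.2⟩, fun h => ⟨h.1, Nat.prime_two.squarefree, h.2⟩⟩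

open Real

theorem double_oscillation_jacobi :
    ∀ ε : ℝ, 0 < ε → ∃ C : ℝ, 0 < C ∧
      ∀ (M N : ℝ), 1 ≤ M → 1 ≤ N →
        ∀ (α β : ℕ → ℂ), (∀ m, ‖α m‖ ≤ 1) → (∀ n, ‖β n‖ ≤ 1) →
          ‖∑ m ∈ Finset.Icc 1 ⌊M⌋₊, ∑ n ∈ Finset.Icc 1 ⌊N⌋₊,
              α m * β n * (if Squarefree (2 * m) then 1 else 0) *
                (if Squarefree (2 * n) then 1 else 0) * (jacobiSym (m : ℤ) n : ℂ)‖ ≤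
            C * M * N * (M ^ (-(1 : ℝ) / 2) + N ^ (-(1 : ℝ) / 2)) * (M * N) ^ ε := by
  intro ε hε
  obtain ⟨C, hC, h⟩ := norm_sum_sum_jacobiChi_le hε
  refine ⟨C, hC, fun M N hM hN α β hα hβ => ?_⟩
  have key := h M N ((Finset.Icc 1 ⌊N⌋₊).filter fun n => Squarefree (2 * n))
    ((Finset.Icc 1 ⌊M⌋₊).filter fun m => Squarefree (2 * m)) α β hM hN
    (fun n hn => by
      obtain ⟨h1, h2⟩ := Finset.mem_filter.mp hn
      have h3 := squarefree_two_mul_iff.mp h2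
      exact ⟨h3.1, h3.2, (Nat.le_floor_iff (by linarith)).mp (Finset.mem_Icc.mp h1).2⟩)
    (fun m hm => by
      obtain ⟨h1, h2⟩ := Finset.mem_filter.mp hm
      exact ⟨(squarefree_two_mul_iff.mp h2).2,
        (Nat.le_floor_iff (by linarith)).mp (Finset.mem_Icc.mp h1).2⟩) hα hβ
  refine (congrArg norm ?_).trans_le key
  rw [Finset.sum_filter]
  refine Finset.sum_congr rfl fun m _ => ?_
  rw [Finset.sum_filter]
  split_ifs
  · refine Finset.sum_congr rfl fun n _ => ?_
    split_ifs <;> simp [jacobiChi]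
  · simp
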